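/- arXiv:2103.16374 — 3 statements merged into one kernel-verified Lean document; each statement's English description precedes it below -/
import Mathlib

section
/- Classification of singular vectors of degree 3: Let F be an irreducible finite-dimensional g_0-module with highest weight μ. A vector in Ind(F) is a nontrivial highest weight singular vector of degree 3 if and only if, up to scalar, it is one of: (a) μ=(1,0,5/2,−1/2) and vector w_{11}w_{22}w_{21}⊗x_1 + w_{21}w_{12}w_{11}⊗x_2; (b) μ=(0,1,5/2,1/2) and vector w_{11}w_{22}w_{12}⊗y_1 + w_{12}w_{21}w_{11}⊗y_2. -/
/-!
Core definitions modelling the annihilation superalgebra `𝔤 = 𝒜(K'₄) = K(1,4)₊ ⊕ ℂC`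
and generalized Verma modules `Ind F ≅ ℂ[Θ] ⊗ Λ(η₁,…,η₄) ⊗ F` over it.

Grassmann monomials `ξ_I`/`η_I` (with `I` in increasing order) are indexed by
`Idx = Finset (Fin 4)`.
-/

open Finset

noncomputable section

/-- Index set of a Grassmann monomial in `ξ₁,…,ξ₄` (0-indexed). -/
abbrev Idx : Type := Finset (Fin 4)

/-- Sign appearing when multiplying two Grassmann monomials: `ξ_I ξ_J = msign I J • ξ_{I ∪ J}`
(for `I, J` disjoint). -/
def msign (I J : Idx) : ℤ := (-1 : ℤ) ^ ((I ×ˢ J).filter (fun p => p.2 < p.1)).card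

/-- Sign of `∂ᵢ ξ_I` (for `i ∈ I`): `∂ᵢ ξ_I = dsign i I • ξ_{I \ {i}}`. -/
def dsign (i : Fin 4) (I : Idx) : ℤ := (-1 : ℤ) ^ (I.filter (fun j => j < i)).card

/-- Sign of the iterated derivative `∂_S η_L = ∂_{s₁} ⋯ ∂_{s_k} η_L` (`s₁ < ⋯ < s_k`,
`S ⊆ L`): `∂_S η_L = ddsign S L • η_{L \ S}`. -/
def ddsign (S L : Idx) : ℤ :=
  (-1 : ℤ) ^ (S.card * (S.card - 1) / 2) *
    (-1 : ℤ) ^ (∑ i ∈ S, ((L \ S).filter (fun j => j < i)).card)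

/-- `epsSign I` is the sign `ε_I` of the permutation `(I, Iᶜ)` of `(1,2,3,4)`. -/
def epsSign (I : Idx) : ℤ := msign I Iᶜ

variable (F : Type*) [AddCommGroup F] [Module ℂ F]

/-- The generalized Verma module `Ind F = ℂ[Θ] ⊗ Λ(η₁,…,η₄) ⊗ F`,
with `(k, L)`-component the coefficient of `Θ^k η_L`. -/
abbrev VInd : Type _ := (ℕ × Idx) →₀ F

variable {F}

/-- Basis-type element `Θ^k η_L ⊗ v` of `Ind F`. -/
def bv (k : ℕ) (L : Idx) (v : F) : VInd F := Finsupp.single (k, L) v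

/-- Action of the central element `C` on `Ind F`: it acts through its action `ρC` on `F`. -/
def Cop (ρC : F →ₗ[ℂ] F) : VInd F →ₗ[ℂ] VInd F := Finsupp.mapRange.linearMap ρC

/-- Multiplication by `Θ` on `Ind F`. -/
def thOp : VInd F →ₗ[ℂ] VInd F := Finsupp.lmapDomain F ℂ (fun p => (p.1 + 1, p.2))

/-- The 2-cocycle `ψ` on `K(1,4)₊` defining the central extension `𝒜(K'₄)`, evaluated on the
basis monomials `t^0 ξ_I`, `t^0 ξ_J`: the only nonzero values are
`ψ(1, ξ₁₂₃₄) = -2`, `ψ(ξ₁₂₃₄, 1) = 2` and `ψ(ξ_i, ξ_{{i}ᶜ}) = ψ(ξ_{{i}ᶜ}, ξ_i) = -∂ᵢ-sign`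
(equivalently `ψ(ξ_i, ∂ᵢξ₁₂₃₄) = -1`). -/
def psi0 (I J : Idx) : ℂ :=
  (if I = (∅ : Idx) ∧ J = (Finset.univ : Idx) then (-2 : ℂ) else 0)
  + (if I = (Finset.univ : Idx) ∧ J = (∅ : Idx) then (2 : ℂ) else 0)
  + ∑ i : Fin 4, (if I = ({i} : Idx) ∧ J = ({i}ᶜ : Idx) then (-(dsign i Finset.univ) : ℂ) else 0)
  + ∑ i : Fin 4, (if I = ({i}ᶜ : Idx) ∧ J = ({i} : Idx) then (-(dsign i Finset.univ) : ℂ) else 0)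

/-- The action on `Ind F` of the bracket `[t^m ξ_I, t^n ξ_J]` in `𝒜(K'₄) = K(1,4)₊ ⊕ ℂC`,
namely of
`(2n-2m-n|I|+m|J|) t^{m+n-1} ξ_{IJ} + (-1)^{|I|} t^{m+n} ∑ᵢ ∂ᵢξ_I ∂ᵢξ_J + ψ(t^mξ_I, t^nξ_J) C`,
expressed through a family `act` of operators (the actions of the `t^m ξ_I`). -/
def brkAct (ρC : F →ₗ[ℂ] F) (act : ℕ → Idx → (VInd F →ₗ[ℂ] VInd F))
    (m : ℕ) (I : Idx) (n : ℕ) (J : Idx) : VInd F →ₗ[ℂ] VInd F :=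
  ((2 * (n : ℤ) - 2 * (m : ℤ) - (n : ℤ) * I.card + (m : ℤ) * J.card : ℤ) : ℂ) •
      (if Disjoint I J then ((msign I J : ℤ) : ℂ) • act (m + n - 1) (I ∪ J) else 0)
  + ((-1 : ℂ) ^ I.card) • (∑ i : Fin 4,
      if i ∈ I ∧ i ∈ J ∧ Disjoint (I.erase i) (J.erase i) then
        ((dsign i I * dsign i J * msign (I.erase i) (J.erase i) : ℤ) : ℂ) •
          act (m + n) (I.erase i ∪ J.erase i)
      else 0)
  + (if m = 0 ∧ n = 0 then psi0 I J else 0) • Cop ρC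

/-- The data of a generalized Verma module over `𝒜(K'₄)`:
the action `ρt, ρC, ρξ i j` of the degree-zero part `𝔤₀ = ⟨C, t, ξ_{ij}⟩` on `F`,
and the action `act m I` of the basis elements `t^m ξ_I` of `K(1,4)₊` on
`Ind F = ℂ[Θ] ⊗ Λ(η) ⊗ F`. -/
structure VermaData (F : Type*) [AddCommGroup F] [Module ℂ F] where
  ρt : F →ₗ[ℂ] F
  ρC : F →ₗ[ℂ] F
  ρξ : Fin 4 → Fin 4 → (F →ₗ[ℂ] F)
  act : ℕ → Idx → (VInd F →ₗ[ℂ] VInd F)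

/-- The properties characterizing the generalized Verma module `Ind F` over `𝒜(K'₄)`:
* `anti` : `ξ_{ij} = -ξ_{ji}`;
* `lie`  : `act` is an action of the Lie superalgebra `𝒜(K'₄) = K(1,4)₊ ⊕ ℂC`
  (with `C` acting through `ρC`);
* `vac_pos` : the positive part `𝔤_{>0}` (spanned by the `t^m ξ_I` with `2m + |I| - 2 > 0`)
  kills the vacuum subspace `1 ⊗ F`;
* `vac_xi`, `vac_t` : `𝔤₀` acts on `1 ⊗ F` through `ρξ`, `ρt`;
* `low_eta`, `low_one` : the negative part acts by left multiplication in
  `U(𝔤_{<0}) = ℂ[Θ] ⊗ Λ(η₁,…,η₄)` (with `η_i² = Θ` and `ξ_∅ = -2Θ`). -/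
structure IsVerma (D : VermaData F) : Prop where
  anti : ∀ i j, D.ρξ i j = - D.ρξ j i
  lie : ∀ (m : ℕ) (I : Idx) (n : ℕ) (J : Idx),
      D.act m I ∘ₗ D.act n J - ((-1 : ℂ) ^ (I.card * J.card)) • (D.act n J ∘ₗ D.act m I)
        = brkAct D.ρC D.act m I n J
  vac_pos : ∀ (v : F) (m : ℕ) (I : Idx), 2 < 2 * m + I.card → D.act m I (bv 0 ∅ v) = 0
  vac_xi : ∀ (v : F) (i j : Fin 4), i < j →
      D.act 0 {i, j} (bv 0 ∅ v) = bv 0 ∅ (D.ρξ i j v)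
  vac_t : ∀ v : F, D.act 1 ∅ (bv 0 ∅ v) = bv 0 ∅ (D.ρt v)
  low_eta : ∀ (v : F) (k : ℕ) (L : Idx) (i : Fin 4),
      D.act 0 {i} (bv k L v) =
        if i ∈ L then ((dsign i L : ℤ) : ℂ) • bv (k + 1) (L.erase i) v
        else ((msign {i} L : ℤ) : ℂ) • bv k (insert i L) v
  low_one : ∀ (v : F) (k : ℕ) (L : Idx),
      D.act 0 ∅ (bv k L v) = (-2 : ℂ) • bv (k + 1) L v

/-- A (nonzero) singular vector: a nonzero vector killed by
`𝔤_{>0} = ⟨t^m ξ_I : 2m + |I| - 2 > 0⟩`. -/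
def IsSingular (D : VermaData F) (u : VInd F) : Prop :=
  u ≠ 0 ∧ ∀ (m : ℕ) (I : Idx), 2 < 2 * m + I.card → D.act m I u = 0

/-- `u` is homogeneous of degree `d` (`Θ^k η_L ⊗ v` has degree `2k + |L|`). -/
def HomogDeg (u : VInd F) (d : ℕ) : Prop := ∀ p ∈ u.support, 2 * p.1 + p.2.card = d

/-- `u` is a highest weight vector: it is killed by the positive root vectors
`e₁ = -ξ₁₃ + i ξ₂₃` and `e₂ = -ξ₂₄ - i ξ₁₄` of `𝔤₀` (0-indexed below). -/
def IsHW (D : VermaData F) (u : VInd F) : Prop :=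
  Complex.I • D.act 0 {1, 2} u - D.act 0 {0, 2} u = 0 ∧
  -(D.act 0 {1, 3} u) - Complex.I • D.act 0 {0, 3} u = 0

/-- `e₁ = e_x + e_y = -ξ₁₃ + i ξ₂₃` acting on `F`. -/
def e1F (D : VermaData F) : F →ₗ[ℂ] F := -(D.ρξ 0 2) + Complex.I • D.ρξ 1 2

/-- `e₂ = e_x - e_y = -ξ₂₄ - i ξ₁₄` acting on `F`. -/
def e2F (D : VermaData F) : F →ₗ[ℂ] F := -(D.ρξ 1 3) - Complex.I • D.ρξ 0 3

/-- `h_x = -iξ₁₂ + iξ₃₄` acting on `F`. -/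
def hxF (D : VermaData F) : F →ₗ[ℂ] F := -(Complex.I • D.ρξ 0 1) + Complex.I • D.ρξ 2 3

/-- `h_y = -iξ₁₂ - iξ₃₄` acting on `F`. -/
def hyF (D : VermaData F) : F →ₗ[ℂ] F := -(Complex.I • D.ρξ 0 1) - Complex.I • D.ρξ 2 3

/-- `f_x = (ξ₁₃ + ξ₂₄ - iξ₁₄ + iξ₂₃)/2` acting on `F`. -/
def fxF (D : VermaData F) : F →ₗ[ℂ] F :=
  (2 : ℂ)⁻¹ • (D.ρξ 0 2 + D.ρξ 1 3 - Complex.I • D.ρξ 0 3 + Complex.I • D.ρξ 1 2)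

/-- `f_y = (ξ₁₃ - ξ₂₄ + iξ₁₄ + iξ₂₃)/2` acting on `F`. -/
def fyF (D : VermaData F) : F →ₗ[ℂ] F :=
  (2 : ℂ)⁻¹ • (D.ρξ 0 2 - D.ρξ 1 3 + Complex.I • D.ρξ 0 3 + Complex.I • D.ρξ 1 2)

/-- `v` is a highest weight vector of `F` of weight `μ = (μ.1, μ.2.1, μ.2.2.1, μ.2.2.2)`
with respect to `(h_x, h_y, t, C)`. -/
def IsHWvec (D : VermaData F) (μ : ℂ × ℂ × ℂ × ℂ) (v : F) : Prop :=
  v ≠ 0 ∧ e1F D v = 0 ∧ e2F D v = 0 ∧ hxF D v = μ.1 • v ∧ hyF D v = μ.2.1 • v ∧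
    D.ρt v = μ.2.2.1 • v ∧ D.ρC v = μ.2.2.2 • v

/-- `F` is an irreducible `𝔤₀`-module. -/
def IsIrred (D : VermaData F) : Prop :=
  (∃ v : F, v ≠ 0) ∧ ∀ p : Submodule ℂ F,
    (∀ v ∈ p, D.ρt v ∈ p ∧ D.ρC v ∈ p ∧ ∀ i j, D.ρξ i j v ∈ p) → p = ⊥ ∨ p = ⊤

/-- The commutative-in-`Θ` algebra `U(𝔤_{<0}) = ℂ[Θ] ⊗ Λ(η₁,…,η₄)` (as a ℂ-module with
basis `Θ^k η_L`). -/
abbrev CA : Type := (ℕ × Idx) →₀ ℂ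

/-- Multiplication in `U(𝔤_{<0})` (`η_i² = Θ`, `Θ` central, `η_i η_j = -η_j η_i`). -/
def cmul (x y : CA) : CA :=
  x.sum fun p c => y.sum fun q c' =>
    Finsupp.single (p.1 + q.1 + (p.2 ∩ q.2).card, (p.2 \ q.2) ∪ (q.2 \ p.2))
      (c * c' * ((msign p.2 q.2 : ℤ) : ℂ))

/-- `w₁₁ = η₂ + i η₁`. -/
def w11 : CA := Finsupp.single (0, ({1} : Idx)) 1 + Complex.I • Finsupp.single (0, ({0} : Idx)) 1
/-- `w₂₂ = η₂ - i η₁`. -/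
def w22 : CA := Finsupp.single (0, ({1} : Idx)) 1 - Complex.I • Finsupp.single (0, ({0} : Idx)) 1
/-- `w₁₂ = -η₄ + i η₃`. -/
def w12 : CA := -Finsupp.single (0, ({3} : Idx)) 1 + Complex.I • Finsupp.single (0, ({2} : Idx)) 1
/-- `w₂₁ = η₄ + i η₃`. -/
def w21 : CA := Finsupp.single (0, ({3} : Idx)) 1 + Complex.I • Finsupp.single (0, ({2} : Idx)) 1

/-- `a ⊗ v ∈ U(𝔤_{<0}) ⊗ F = Ind F`. -/
def tens (a : CA) (v : F) : VInd F := a.sum fun p c => Finsupp.single p (c • v)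

end


namespace K4

variable {F : Type*} [AddCommGroup F] [Module ℂ F]

lemma psi0_single (I : Idx) (j : Fin 4) :
    psi0 I {j} = if I = ({j}ᶜ : Idx) then (-(dsign j Finset.univ) : ℂ) else 0 := by
  have h1 : ({j} : Idx) ≠ Finset.univ := by revert j; decide
  have h2 : ({j} : Idx) ≠ ∅ := by revert j; decide
  have h3 : ∀ i : Fin 4, ({j} : Idx) ≠ {i}ᶜ := by revert j; decide
  unfold psi0
  simp only [h1, h2, h3, and_false, if_false, Finset.sum_const_zero, zero_add]
  rw [Finset.sum_eq_single j]
  · simp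
  · intro b _ hb
    have : ({j} : Idx) ≠ {b} := by simpa using hb.symm
    simp [this]
  · simp

/-- Commuting `t^m ξ_I` past `η_j`. -/
lemma act_eta {D : VermaData F} (hD : IsVerma D) (m : ℕ) (I : Idx) (j : Fin 4) (w : VInd F) :
    D.act m I (D.act 0 {j} w) = ((-1 : ℂ) ^ I.card) • D.act 0 {j} (D.act m I w)
      + (if j ∈ I then (((-1) ^ I.card * dsign j I : ℤ) : ℂ) • D.act m (I.erase j) w
          else ((-(m : ℤ) * msign I {j} : ℤ) : ℂ) • D.act (m - 1) (insert j I) w)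
      + (if m = 0 ∧ I = {j}ᶜ then ((-dsign j Finset.univ : ℤ) : ℂ) else 0) • Cop D.ρC w := by
  have hd : dsign j {j} = 1 := by revert j; decide
  have h := LinearMap.congr_fun (hD.lie m I 0 {j}) w
  have hm : ∀ K : Idx, msign K ∅ = 1 := by decide
  simp only [LinearMap.sub_apply, LinearMap.comp_apply, LinearMap.smul_apply, brkAct,
    LinearMap.add_apply, psi0_single, LinearMap.sum_apply] at h
  rw [sub_eq_iff_eq_add] at h
  rw [h, Finset.sum_eq_single j]
  · by_cases hj : j ∈ I
    · have : ¬ Disjoint I {j} := by simpa using hj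
      by_cases hm0 : m = 0 ∧ I = {j}ᶜ
      · simp [hj, this, hm, hd, hm0, smul_smul]; abel
      · by_cases hm1 : m = 0
        · have : I ≠ {j}ᶜ := fun h => hm0 ⟨hm1, h⟩
          simp [*, hm, hd, smul_smul]; try abel
        · simp [*, hm, hd, smul_smul]; abel
    · have : Disjoint I {j} := by simpa using hj
      have e : I ∪ {j} = insert j I := by rw [Finset.union_comm]; rfl
      by_cases hm0 : m = 0
      · subst hm0
        simp [hj, this, e]; try abel
      · simp [hj, this, e, smul_smul, hm0, LinearMap.smul_apply]
        module
  · intro b _ hb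
    simp [hb]
  · simp

end K4

namespace K4

variable {F : Type*} [AddCommGroup F] [Module ℂ F]

/-- The antisymmetric family `ξ_{ij}` acting on `Ind F`. -/
noncomputable def Xs (D : VermaData F) (i j : Fin 4) : VInd F →ₗ[ℂ] VInd F :=
  if i < j then D.act 0 {i, j} else if j < i then -D.act 0 {j, i} else 0

/-- First index in `[ξ_{lᶜ}, ξ_k] = ξ_{yi l k, yj l k}`. -/
def yi : Fin 4 → Fin 4 → Fin 4 := ![![0, 3, 1, 2], ![3, 0, 0, 2], ![3, 0, 0, 1], ![2, 0, 1, 0]]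
/-- Second index in `[ξ_{lᶜ}, ξ_k] = ξ_{yi l k, yj l k}`. -/
def yj : Fin 4 → Fin 4 → Fin 4 := ![![0, 2, 3, 1], ![2, 0, 3, 0], ![1, 3, 0, 0], ![1, 2, 0, 0]]

lemma T_eta {D : VermaData F} (hD : IsVerma D) (i j : Fin 4) (w : VInd F) :
    D.act 1 {i} (D.act 0 {j} w) = -D.act 0 {j} (D.act 1 {i} w)
      - (if i = j then D.act 1 ∅ w else Xs D i j w) := by
  rw [act_eta hD]
  rcases lt_trichotomy i j with h | h | h
  · have h1 : msign {i} {j} = 1 := by revert i j; decide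
    simp [Xs, h, h1, h.ne, h.ne', Finset.pair_comm j i]; abel
  · subst h
    have h1 : dsign i {i} = 1 := by revert i; decide
    simp [h1]; abel
  · have h1 : msign {i} {j} = -1 := by revert i j; decide
    simp [Xs, h, h1, h.ne, h.ne', not_lt.2 h.le]

lemma E_eta {D : VermaData F} (hD : IsVerma D) (j : Fin 4) (w : VInd F) :
    D.act 1 ∅ (D.act 0 {j} w) = D.act 0 {j} (D.act 1 ∅ w) - D.act 0 {j} w := by
  rw [act_eta hD]
  have h1 : msign ∅ {j} = 1 := by revert j; decide
  simp [h1]; abel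

lemma X_eta {D : VermaData F} (hD : IsVerma D) (i j k : Fin 4) (w : VInd F) (h : i < j) :
    D.act 0 {i, j} (D.act 0 {k} w) = D.act 0 {k} (D.act 0 {i, j} w)
      + (if i = k then D.act 0 {j} w else 0) - (if j = k then D.act 0 {i} w else 0) := by
  rw [act_eta hD]
  have h0 : ({i, j} : Idx) ≠ {k}ᶜ := by revert i j k; decide
  have h1 : ({i, j} : Idx).card = 2 := Finset.card_pair h.ne
  rcases eq_or_ne i k with h2 | h2
  · subst h2
    have h3 : dsign i {i, j} = 1 := by clear h0 h1; revert i j; decide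
    have h4 : ({i, j} : Idx).erase i = {j} := by clear h0 h1 h3; revert i j; decide
    simp [h0, h1, h3, h4, h.ne']
  · rcases eq_or_ne j k with h5 | h5
    · subst h5
      have h3 : dsign j {i, j} = -1 := by clear h0 h1 h2; revert i j; decide
      have h4 : ({i, j} : Idx).erase j = {i} := by clear h0 h1 h2 h3; revert i j; decide
      simp [h0, h1, h3, h4, h.ne]; abel
    · simp [h0, h1, h2, h5, h2.symm, h5.symm]

lemma Xs_eta {D : VermaData F} (hD : IsVerma D) (i j k : Fin 4) (w : VInd F) :
    Xs D i j (D.act 0 {k} w) = D.act 0 {k} (Xs D i j w)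
      + (if i = k then D.act 0 {j} w else 0) - (if j = k then D.act 0 {i} w else 0) := by
  unfold Xs
  rcases lt_trichotomy i j with h | h | h
  · simp only [h, if_true]; exact X_eta hD i j k w h
  · subst h; simp
  · simp only [h, h.le, not_lt.2 h.le, if_true, if_false, LinearMap.neg_apply, X_eta hD j i k w h,
      map_neg]
    abel

lemma Y_eta {D : VermaData F} (hD : IsVerma D) (l k : Fin 4) (w : VInd F) :
    D.act 0 {l}ᶜ (D.act 0 {k} w) = -D.act 0 {k} (D.act 0 {l}ᶜ w)
      + (if l = k then ((-dsign l Finset.univ : ℤ) : ℂ) • Cop D.ρC w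
          else Xs D (yi l k) (yj l k) w) := by
  rw [act_eta hD]
  have h1 : ({l}ᶜ : Idx).card = 3 := by revert l; decide
  rcases eq_or_ne l k with h | h
  · subst h
    simp [h1]; module
  · have h2 : ({l}ᶜ : Idx) ≠ {k}ᶜ := by simpa using h
    have h3 : (yi l k < yj l k ∧ dsign k {l}ᶜ = -1 ∧ ({l}ᶜ : Idx).erase k = {yi l k, yj l k}) ∨
       (yj l k < yi l k ∧ dsign k {l}ᶜ = 1 ∧ ({l}ᶜ : Idx).erase k = {yj l k, yi l k}) := by
      clear h1 h2; revert l k; decide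
    rcases h3 with ⟨h3, h4, h5⟩ | ⟨h3, h4, h5⟩
    · simp [h1, h, h.symm, h3, h4, h5, Xs]; try module
    · simp [h1, h, h.symm, h3, h4, h5, Xs, not_lt.2 h3.le]; try module

lemma T_vac {D : VermaData F} (hD : IsVerma D) (i : Fin 4) (v : F) :
    D.act 1 {i} (bv 0 ∅ v) = 0 := hD.vac_pos v 1 {i} (by simp)

lemma Y_vac {D : VermaData F} (hD : IsVerma D) (l : Fin 4) (v : F) :
    D.act 0 {l}ᶜ (bv 0 ∅ v) = 0 :=
  hD.vac_pos v 0 {l}ᶜ (by revert l; decide)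

lemma Xs_vac {D : VermaData F} (hD : IsVerma D) (i j : Fin 4) (v : F) :
    Xs D i j (bv 0 ∅ v) = bv 0 ∅ (D.ρξ i j v) := by
  unfold Xs
  rcases lt_trichotomy i j with h | h | h
  · simp only [h, if_true]; exact hD.vac_xi v i j h
  · subst h
    have h2 : D.ρξ i i = 0 := by
      have h3 : (2 : ℂ) • D.ρξ i i = 0 := by
        rw [two_smul]; nth_rewrite 1 [hD.anti i i]; simp
      simpa using h3
    simp [h2, bv]
  · simp only [h, not_lt.2 h.le, if_true, if_false, LinearMap.neg_apply, hD.vac_xi v j i h]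
    rw [hD.anti i j]
    simp [bv]

lemma C_bv (D : VermaData F) (k : ℕ) (L : Idx) (v : F) :
    Cop D.ρC (bv k L v) = bv k L (D.ρC v) := by
  simp [Cop, bv]

lemma C_eta {D : VermaData F} (hD : IsVerma D) (k : Fin 4) (w : VInd F) :
    Cop D.ρC (D.act 0 {k} w) = D.act 0 {k} (Cop D.ρC w) := by
  induction w using Finsupp.induction_linear with
  | zero => simp
  | add f g hf hg => simp [hf, hg]
  | single p v =>
    obtain ⟨n, L⟩ := p
    change Cop D.ρC (D.act 0 {k} (bv n L v)) = D.act 0 {k} (Cop D.ρC (bv n L v))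
    rw [C_bv, hD.low_eta, hD.low_eta]
    split_ifs <;> simp [C_bv]

lemma bv_add (k : ℕ) (L : Idx) (v w : F) : bv k L (v + w) = bv k L v + bv k L w := by
  simp [bv]
lemma bv_sub (k : ℕ) (L : Idx) (v w : F) : bv k L (v - w) = bv k L v - bv k L w := by
  simp [bv, Finsupp.single_sub]
lemma bv_neg (k : ℕ) (L : Idx) (v : F) : bv k L (-v) = -bv k L v := by
  simp [bv]
lemma bv_smul (k : ℕ) (L : Idx) (c : ℂ) (v : F) : bv k L (c • v) = c • bv k L v := by
  simp [bv]
lemma bv_zero (k : ℕ) (L : Idx) : bv k L (0 : F) = 0 := by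
  simp [bv]

/-- Product of two `η`s on the vacuum. -/
lemma eta_sq {D : VermaData F} (hD : IsVerma D) (i : Fin 4) (k : ℕ) (L : Idx) (v : F) :
    D.act 0 {i} (D.act 0 {i} (bv k L v)) = bv (k + 1) L v := by
  have h1 : dsign i {i} = 1 := by revert i; decide
  have h2 : msign ∅ ∅ = 1 := by decide
  have h3 : ({i} : Idx) ≠ {i}ᶜ := by clear h1; revert i; decide
  have h := LinearMap.congr_fun (hD.lie 0 {i} 0 {i}) (bv k L v)
  simp only [LinearMap.sub_apply, LinearMap.comp_apply, LinearMap.smul_apply, brkAct,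
    LinearMap.add_apply, psi0_single, LinearMap.sum_apply] at h
  rw [Finset.sum_eq_single i (by intro b _ hb; simp [hb]) (by simp)] at h
  simp [h1, h2, h3, hD.low_one] at h
  have h4 : (2 : ℂ) • D.act 0 {i} (D.act 0 {i} (bv k L v)) = (2 : ℂ) • bv (k + 1) L v := by
    rw [← h]; module
  exact smul_right_injective _ (two_ne_zero) h4

lemma eta_vac {D : VermaData F} (hD : IsVerma D) (i : Fin 4) (k : ℕ) (v : F) :
    D.act 0 {i} (bv k ∅ v) = bv k {i} v := by
  rw [hD.low_eta]
  have h1 : msign {i} ∅ = 1 := by revert i; decide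
  simp [h1]

lemma eta_eta {D : VermaData F} (hD : IsVerma D) (i j : Fin 4) (k : ℕ) (v : F) :
    D.act 0 {i} (bv k {j} v) = if i = j then bv (k + 1) ∅ v
      else if i < j then bv k {i, j} v else - bv k {j, i} v := by
  rw [hD.low_eta]
  rcases lt_trichotomy i j with h | h | h
  · have h1 : msign {i} {j} = 1 := by revert i j; decide
    simp [h, h1, h.ne]
  · subst h
    have h1 : dsign i {i} = 1 := by revert i; decide
    simp [h1]
  · have h1 : msign {i} {j} = -1 := by revert i j; decide
    simp [h1, h.ne', h.le, not_lt.2 h.le, Finset.pair_comm j i]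

end K4

namespace K4

variable {F : Type*} [AddCommGroup F] [Module ℂ F]

/-- The general vector of degree 3. -/
noncomputable def U (a0 a1 a2 a3 b0 b1 b2 b3 : F) : VInd F :=
  bv 1 {0} a0 + bv 1 {1} a1 + bv 1 {2} a2 + bv 1 {3} a3
    + bv 0 {1, 2, 3} b0 + bv 0 {0, 2, 3} b1 + bv 0 {0, 1, 3} b2 + bv 0 {0, 1, 2} b3

lemma word_cube {D : VermaData F} (hD : IsVerma D) (i : Fin 4) (v : F) :
    bv 1 {i} v = D.act 0 {i} (D.act 0 {i} (D.act 0 {i} (bv 0 ∅ v))) := by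
  rw [eta_sq hD, eta_vac hD]

lemma word_three {D : VermaData F} (hD : IsVerma D) (i j k : Fin 4) (hij : i < j) (hjk : j < k)
    (v : F) :
    bv 0 {i, j, k} v = D.act 0 {i} (D.act 0 {j} (D.act 0 {k} (bv 0 ∅ v))) := by
  have h1 : msign {i} {j, k} = 1 := by revert i j k; decide
  have h2 : i ∉ ({j, k} : Idx) := by clear h1; revert i j k; decide
  rw [eta_vac hD, eta_eta hD, if_neg hjk.ne, if_pos hjk, hD.low_eta, if_neg h2, h1]
  simp

lemma U_words {D : VermaData F} (hD : IsVerma D) (a0 a1 a2 a3 b0 b1 b2 b3 : F) :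
    U a0 a1 a2 a3 b0 b1 b2 b3 =
      D.act 0 {0} (D.act 0 {0} (D.act 0 {0} (bv 0 ∅ a0)))
      + D.act 0 {1} (D.act 0 {1} (D.act 0 {1} (bv 0 ∅ a1)))
      + D.act 0 {2} (D.act 0 {2} (D.act 0 {2} (bv 0 ∅ a2)))
      + D.act 0 {3} (D.act 0 {3} (D.act 0 {3} (bv 0 ∅ a3)))
      + D.act 0 {1} (D.act 0 {2} (D.act 0 {3} (bv 0 ∅ b0)))
      + D.act 0 {0} (D.act 0 {2} (D.act 0 {3} (bv 0 ∅ b1)))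
      + D.act 0 {0} (D.act 0 {1} (D.act 0 {3} (bv 0 ∅ b2)))
      + D.act 0 {0} (D.act 0 {1} (D.act 0 {2} (bv 0 ∅ b3))) := by
  rw [U, word_cube hD 0, word_cube hD 1, word_cube hD 2, word_cube hD 3,
    word_three hD 1 2 3 (by decide) (by decide), word_three hD 0 2 3 (by decide) (by decide),
    word_three hD 0 1 3 (by decide) (by decide), word_three hD 0 1 2 (by decide) (by decide)]

lemma T0_U {D : VermaData F} (hD : IsVerma D) (a0 a1 a2 a3 b0 b1 b2 b3 : F) :
    D.act 1 {0} (U a0 a1 a2 a3 b0 b1 b2 b3) =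
      bv 1 ∅ (-D.ρt a0 + a0 - D.ρξ 0 1 a1 - D.ρξ 0 2 a2 - D.ρξ 0 3 a3)
      + bv 0 {0, 1} (a1 - D.ρξ 0 3 b2 - D.ρξ 0 2 b3)
      + bv 0 {0, 2} (a2 - D.ρξ 0 3 b1 + D.ρξ 0 1 b3)
      + bv 0 {0, 3} (a3 + D.ρξ 0 2 b1 + D.ρξ 0 1 b2)
      + bv 0 {1, 2} (-D.ρξ 0 3 b0 - D.ρt b3 + (2 : ℂ) • b3)
      + bv 0 {1, 3} (D.ρξ 0 2 b0 - D.ρt b2 + (2 : ℂ) • b2)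
      + bv 0 {2, 3} (-D.ρξ 0 1 b0 - D.ρt b1 + (2 : ℂ) • b1) := by
  rw [U_words hD]
  have h : ∀ j < 0, D.ρξ 0 j = -D.ρξ j 0 := fun j _ => hD.anti 0 j
  simp [T_eta hD, Xs_eta hD, E_eta hD, T_vac hD, Xs_vac hD, hD.vac_t]
  simp [eta_vac hD, eta_eta hD, h, bv_add, bv_sub, bv_neg, bv_zero, bv_smul]
  try module

lemma T1_U {D : VermaData F} (hD : IsVerma D) (a0 a1 a2 a3 b0 b1 b2 b3 : F) :
    D.act 1 {1} (U a0 a1 a2 a3 b0 b1 b2 b3) =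
      bv 1 ∅ (D.ρξ 0 1 a0 - D.ρt a1 + a1 - D.ρξ 1 2 a2 - D.ρξ 1 3 a3)
      + bv 0 {0, 1} (-a0 - D.ρξ 1 3 b2 - D.ρξ 1 2 b3)
      + bv 0 {0, 2} (-D.ρξ 1 3 b1 + D.ρt b3 - (2 : ℂ) • b3)
      + bv 0 {0, 3} (D.ρξ 1 2 b1 + D.ρt b2 - (2 : ℂ) • b2)
      + bv 0 {1, 2} (a2 - D.ρξ 1 3 b0 + D.ρξ 0 1 b3)
      + bv 0 {1, 3} (a3 + D.ρξ 1 2 b0 + D.ρξ 0 1 b2)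
      + bv 0 {2, 3} (-D.ρt b0 + (2 : ℂ) • b0 + D.ρξ 0 1 b1) := by
  rw [U_words hD]
  have h : ∀ j < 1, D.ρξ 1 j = -D.ρξ j 1 := fun j _ => hD.anti 1 j
  simp [T_eta hD, Xs_eta hD, E_eta hD, T_vac hD, Xs_vac hD, hD.vac_t]
  simp [eta_vac hD, eta_eta hD, h, bv_add, bv_sub, bv_neg, bv_zero, bv_smul]
  try module

lemma T2_U {D : VermaData F} (hD : IsVerma D) (a0 a1 a2 a3 b0 b1 b2 b3 : F) :
    D.act 1 {2} (U a0 a1 a2 a3 b0 b1 b2 b3) =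
      bv 1 ∅ (D.ρξ 0 2 a0 + D.ρξ 1 2 a1 - D.ρt a2 + a2 - D.ρξ 2 3 a3)
      + bv 0 {0, 1} (-D.ρξ 2 3 b2 - D.ρt b3 + (2 : ℂ) • b3)
      + bv 0 {0, 2} (-a0 - D.ρξ 2 3 b1 - D.ρξ 1 2 b3)
      + bv 0 {0, 3} (D.ρt b1 - (2 : ℂ) • b1 - D.ρξ 1 2 b2)
      + bv 0 {1, 2} (-a1 - D.ρξ 2 3 b0 + D.ρξ 0 2 b3)
      + bv 0 {1, 3} (D.ρt b0 - (2 : ℂ) • b0 + D.ρξ 0 2 b2)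
      + bv 0 {2, 3} (a3 + D.ρξ 1 2 b0 + D.ρξ 0 2 b1) := by
  rw [U_words hD]
  have h : ∀ j < 2, D.ρξ 2 j = -D.ρξ j 2 := fun j _ => hD.anti 2 j
  simp [T_eta hD, Xs_eta hD, E_eta hD, T_vac hD, Xs_vac hD, hD.vac_t]
  simp [eta_vac hD, eta_eta hD, h, bv_add, bv_sub, bv_neg, bv_zero, bv_smul]
  try module

lemma T3_U {D : VermaData F} (hD : IsVerma D) (a0 a1 a2 a3 b0 b1 b2 b3 : F) :
    D.act 1 {3} (U a0 a1 a2 a3 b0 b1 b2 b3) =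
      bv 1 ∅ (D.ρξ 0 3 a0 + D.ρξ 1 3 a1 + D.ρξ 2 3 a2 - D.ρt a3 + a3)
      + bv 0 {0, 1} (-D.ρt b2 + (2 : ℂ) • b2 + D.ρξ 2 3 b3)
      + bv 0 {0, 2} (-D.ρt b1 + (2 : ℂ) • b1 - D.ρξ 1 3 b3)
      + bv 0 {0, 3} (-a0 - D.ρξ 2 3 b1 - D.ρξ 1 3 b2)
      + bv 0 {1, 2} (-D.ρt b0 + (2 : ℂ) • b0 + D.ρξ 0 3 b3)
      + bv 0 {1, 3} (-a1 - D.ρξ 2 3 b0 + D.ρξ 0 3 b2)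
      + bv 0 {2, 3} (-a2 + D.ρξ 1 3 b0 + D.ρξ 0 3 b1) := by
  rw [U_words hD]
  have h : ∀ j < 3, D.ρξ 3 j = -D.ρξ j 3 := fun j _ => hD.anti 3 j
  simp [T_eta hD, Xs_eta hD, E_eta hD, T_vac hD, Xs_vac hD, hD.vac_t]
  simp [eta_vac hD, eta_eta hD, h, bv_add, bv_sub, bv_neg, bv_zero, bv_smul]
  try module

lemma Y0_U {D : VermaData F} (hD : IsVerma D) (a0 a1 a2 a3 b0 b1 b2 b3 : F) :
    D.act 0 {0}ᶜ (U a0 a1 a2 a3 b0 b1 b2 b3) =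
      bv 1 ∅ (-D.ρC a0 - D.ρξ 2 3 a1 + D.ρξ 1 3 a2 - D.ρξ 1 2 a3 + b0)
      + bv 0 {0, 1} (b1 - D.ρξ 1 2 b2 + D.ρξ 1 3 b3)
      + bv 0 {0, 2} (-D.ρξ 1 2 b1 - b2 + D.ρξ 2 3 b3)
      + bv 0 {0, 3} (-D.ρξ 1 3 b1 + D.ρξ 2 3 b2 + b3)
      + bv 0 {1, 2} (-D.ρξ 1 2 b0 - D.ρC b3)
      + bv 0 {1, 3} (-D.ρξ 1 3 b0 - D.ρC b2)
      + bv 0 {2, 3} (-D.ρξ 2 3 b0 - D.ρC b1) := by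
  rw [U_words hD]
  have h : ∀ i j, j < i → D.ρξ i j = -D.ρξ j i := fun i j _ => hD.anti i j
  have hs : dsign 0 Finset.univ = 1 := by decide
  simp [Y_eta hD, Xs_eta hD, Y_vac hD, Xs_vac hD, C_eta hD, C_bv, hs, yi, yj]
  simp [eta_vac hD, eta_eta hD, h, bv_add, bv_sub, bv_neg, bv_zero, bv_smul]
  try module

lemma Y1_U {D : VermaData F} (hD : IsVerma D) (a0 a1 a2 a3 b0 b1 b2 b3 : F) :
    D.act 0 {1}ᶜ (U a0 a1 a2 a3 b0 b1 b2 b3) =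
      bv 1 ∅ (-D.ρξ 2 3 a0 + D.ρC a1 + D.ρξ 0 3 a2 - D.ρξ 0 2 a3 + b1)
      + bv 0 {0, 1} (-b0 - D.ρξ 0 2 b2 + D.ρξ 0 3 b3)
      + bv 0 {0, 2} (-D.ρξ 0 2 b1 - D.ρC b3)
      + bv 0 {0, 3} (-D.ρξ 0 3 b1 - D.ρC b2)
      + bv 0 {1, 2} (-D.ρξ 0 2 b0 + b2 - D.ρξ 2 3 b3)
      + bv 0 {1, 3} (-D.ρξ 0 3 b0 - D.ρξ 2 3 b2 - b3)
      + bv 0 {2, 3} (D.ρC b0 - D.ρξ 2 3 b1) := by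
  rw [U_words hD]
  have h : ∀ i j, j < i → D.ρξ i j = -D.ρξ j i := fun i j _ => hD.anti i j
  have hs : dsign 1 Finset.univ = -1 := by decide
  simp [Y_eta hD, Xs_eta hD, Y_vac hD, Xs_vac hD, C_eta hD, C_bv, hs, yi, yj]
  simp [eta_vac hD, eta_eta hD, h, bv_add, bv_sub, bv_neg, bv_zero, bv_smul]
  try module

lemma Y2_U {D : VermaData F} (hD : IsVerma D) (a0 a1 a2 a3 b0 b1 b2 b3 : F) :
    D.act 0 {2}ᶜ (U a0 a1 a2 a3 b0 b1 b2 b3) =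
      bv 1 ∅ (-D.ρξ 1 3 a0 + D.ρξ 0 3 a1 - D.ρC a2 - D.ρξ 0 1 a3 + b2)
      + bv 0 {0, 1} (-D.ρξ 0 1 b2 - D.ρC b3)
      + bv 0 {0, 2} (b0 - D.ρξ 0 1 b1 - D.ρξ 0 3 b3)
      + bv 0 {0, 3} (D.ρC b1 - D.ρξ 0 3 b2)
      + bv 0 {1, 2} (-D.ρξ 0 1 b0 - b1 - D.ρξ 1 3 b3)
      + bv 0 {1, 3} (D.ρC b0 - D.ρξ 1 3 b2)
      + bv 0 {2, 3} (D.ρξ 0 3 b0 - D.ρξ 1 3 b1 + b3) := by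
  rw [U_words hD]
  have h : ∀ i j, j < i → D.ρξ i j = -D.ρξ j i := fun i j _ => hD.anti i j
  have hs : dsign 2 Finset.univ = 1 := by decide
  simp [Y_eta hD, Xs_eta hD, Y_vac hD, Xs_vac hD, C_eta hD, C_bv, hs, yi, yj]
  simp [eta_vac hD, eta_eta hD, h, bv_add, bv_sub, bv_neg, bv_zero, bv_smul]
  try module

lemma Y3_U {D : VermaData F} (hD : IsVerma D) (a0 a1 a2 a3 b0 b1 b2 b3 : F) :
    D.act 0 {3}ᶜ (U a0 a1 a2 a3 b0 b1 b2 b3) =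
      bv 1 ∅ (-D.ρξ 1 2 a0 + D.ρξ 0 2 a1 - D.ρξ 0 1 a2 + D.ρC a3 + b3)
      + bv 0 {0, 1} (D.ρC b2 - D.ρξ 0 1 b3)
      + bv 0 {0, 2} (D.ρC b1 - D.ρξ 0 2 b3)
      + bv 0 {0, 3} (-b0 + D.ρξ 0 1 b1 - D.ρξ 0 2 b2)
      + bv 0 {1, 2} (D.ρC b0 - D.ρξ 1 2 b3)
      + bv 0 {1, 3} (D.ρξ 0 1 b0 + b1 - D.ρξ 1 2 b2)
      + bv 0 {2, 3} (D.ρξ 0 2 b0 - D.ρξ 1 2 b1 - b2) := by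
  rw [U_words hD]
  have h : ∀ i j, j < i → D.ρξ i j = -D.ρξ j i := fun i j _ => hD.anti i j
  have hs : dsign 3 Finset.univ = -1 := by decide
  simp [Y_eta hD, Xs_eta hD, Y_vac hD, Xs_vac hD, C_eta hD, C_bv, hs, yi, yj]
  simp [eta_vac hD, eta_eta hD, h, bv_add, bv_sub, bv_neg, bv_zero, bv_smul]
  try module

end K4

namespace K4

variable {F : Type*} [AddCommGroup F] [Module ℂ F]

lemma eta_eta_eta {D : VermaData F} (hD : IsVerma D) (i j k : Fin 4) (n : ℕ) (v : F)
    (hjk : j < k) :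
    D.act 0 {i} (bv n {j, k} v) = if i = j then bv (n + 1) {k} v
      else if i = k then -bv (n + 1) {j} v
      else if i < j then bv n {i, j, k} v
      else if i < k then -bv n {j, i, k} v else bv n {j, k, i} v := by
  rw [hD.low_eta]
  split_ifs with h1 h2 h3 h4 h5 h2 h3 h4 h5
  · have e1 : dsign i {j, k} = 1 := by revert i j k; decide
    have e2 : ({j, k} : Idx).erase i = {k} := by clear e1; revert i j k; decide
    simp [e1, e2]
  · have e1 : dsign i {j, k} = -1 := by revert i j k; decide
    have e2 : ({j, k} : Idx).erase i = {j} := by clear e1; revert i j k; decide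
    simp [e1, e2]
  · exfalso; revert i j k; decide
  · exfalso; revert i j k; decide
  · exfalso; revert i j k; decide
  · exfalso; revert i j k; decide
  · exfalso; revert i j k; decide
  · have e1 : msign {i} {j, k} = 1 := by revert i j k; decide
    simp [e1]
  · have e1 : msign {i} {j, k} = -1 := by revert i j k; decide
    have e2 : insert i ({j, k} : Idx) = {j, i, k} := by clear e1; revert i j k; decide
    simp [e1, e2]
  · have e1 : msign {i} {j, k} = 1 := by revert i j k; decide
    have e2 : insert i ({j, k} : Idx) = {j, k, i} := by clear e1; revert i j k; decide
    simp [e1, e2]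

lemma e1_U {D : VermaData F} (hD : IsVerma D) (a0 a1 a2 a3 b0 b1 b2 b3 : F) :
    Complex.I • D.act 0 {1, 2} (U a0 a1 a2 a3 b0 b1 b2 b3)
      - D.act 0 {0, 2} (U a0 a1 a2 a3 b0 b1 b2 b3) =
      bv 1 {0} (Complex.I • D.ρξ 1 2 a0 - D.ρξ 0 2 a0 + a2)
      + bv 1 {1} (Complex.I • D.ρξ 1 2 a1 - Complex.I • a2 - D.ρξ 0 2 a1)
      + bv 1 {2} (Complex.I • a1 + Complex.I • D.ρξ 1 2 a2 - a0 - D.ρξ 0 2 a2)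
      + bv 1 {3} (Complex.I • D.ρξ 1 2 a3 - D.ρξ 0 2 a3)
      + bv 0 {0, 1, 2} (Complex.I • D.ρξ 1 2 b3 - D.ρξ 0 2 b3)
      + bv 0 {0, 1, 3} (-Complex.I • b1 + Complex.I • D.ρξ 1 2 b2 - b0 - D.ρξ 0 2 b2)
      + bv 0 {0, 2, 3} (Complex.I • D.ρξ 1 2 b1 + Complex.I • b2 - D.ρξ 0 2 b1)
      + bv 0 {1, 2, 3} (Complex.I • D.ρξ 1 2 b0 - D.ρξ 0 2 b0 + b2) := by
  rw [U_words hD]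
  have h1 : D.act 0 {1, 2} = Xs D 1 2 := by simp [Xs]
  have h2 : D.act 0 {0, 2} = Xs D 0 2 := by simp [Xs]
  rw [h1, h2]
  simp [Xs_eta hD, Xs_vac hD]
  simp [eta_vac hD, eta_eta hD, eta_eta_eta hD, bv_add, bv_sub, bv_neg, bv_smul]
  try module

lemma e2_U {D : VermaData F} (hD : IsVerma D) (a0 a1 a2 a3 b0 b1 b2 b3 : F) :
    -(D.act 0 {1, 3} (U a0 a1 a2 a3 b0 b1 b2 b3))
      - Complex.I • D.act 0 {0, 3} (U a0 a1 a2 a3 b0 b1 b2 b3) =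
      bv 1 {0} (-D.ρξ 1 3 a0 - Complex.I • D.ρξ 0 3 a0 + Complex.I • a3)
      + bv 1 {1} (-D.ρξ 1 3 a1 + a3 - Complex.I • D.ρξ 0 3 a1)
      + bv 1 {2} (-D.ρξ 1 3 a2 - Complex.I • D.ρξ 0 3 a2)
      + bv 1 {3} (-a1 - D.ρξ 1 3 a3 - Complex.I • a0 - Complex.I • D.ρξ 0 3 a3)
      + bv 0 {0, 1, 2} (-b1 - D.ρξ 1 3 b3 + Complex.I • b0 - Complex.I • D.ρξ 0 3 b3)
      + bv 0 {0, 1, 3} (-D.ρξ 1 3 b2 - Complex.I • D.ρξ 0 3 b2)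
      + bv 0 {0, 2, 3} (-D.ρξ 1 3 b1 + b3 - Complex.I • D.ρξ 0 3 b1)
      + bv 0 {1, 2, 3} (-D.ρξ 1 3 b0 - Complex.I • D.ρξ 0 3 b0 - Complex.I • b3) := by
  rw [U_words hD]
  have h1 : D.act 0 {1, 3} = Xs D 1 3 := by simp [Xs]
  have h2 : D.act 0 {0, 3} = Xs D 0 3 := by simp [Xs]
  rw [h1, h2]
  simp [Xs_eta hD, Xs_vac hD]
  simp [eta_vac hD, eta_eta hD, eta_eta_eta hD, bv_add, bv_sub, bv_neg, bv_smul]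
  try module

end K4

namespace K4

variable {F : Type*} [AddCommGroup F] [Module ℂ F]

lemma brk_zero {D : VermaData F} (hD : IsVerma D) {u : VInd F} {m n : ℕ} {I J : Idx}
    (h1 : D.act m I u = 0) (h2 : D.act n J u = 0) : brkAct D.ρC D.act m I n J u = 0 := by
  rw [← hD.lie]
  simp [h1, h2]

/-- One-term brackets: if the derivative part of `[t^mξ_I, t^nξ_J]` has the only term `a`. -/
lemma brk_one {D : VermaData F} (hD : IsVerma D) {u : VInd F} {m n : ℕ} {I J : Idx}
    (h1 : D.act m I u = 0) (h2 : D.act n J u = 0) (hmn : m ≠ 0) (a : Fin 4)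
    (ha : ∀ b, (b ∈ I ∧ b ∈ J ∧ Disjoint (I.erase b) (J.erase b)) ↔ b = a)
    (s : ℤ) (hs : dsign a I * dsign a J * msign (I.erase a) (J.erase a) = s) (hs0 : s ≠ 0) :
    D.act (m + n) (I.erase a ∪ J.erase a) u = 0 := by
  have h := brk_zero hD h1 h2
  have hd : ¬ Disjoint I J := by
    have := (ha a).2 rfl
    exact fun hd => Finset.disjoint_left.1 hd this.1 this.2.1
  simp only [brkAct, ha, hd, if_false, smul_zero, zero_add, hmn, false_and, zero_smul, add_zero,
    Finset.sum_ite_eq', Finset.mem_univ, if_true, LinearMap.smul_apply, hs] at h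
  simpa [hs0] using h

lemma sing_of_gens {D : VermaData F} (hD : IsVerma D) {u : VInd F}
    (hT : ∀ i, D.act 1 {i} u = 0) (hY : ∀ l, D.act 0 {l}ᶜ u = 0) :
    ∀ (m : ℕ) (I : Idx), 2 < 2 * m + I.card → D.act m I u = 0 := by
  have h20 : D.act 2 ∅ u = 0 := by
    have := brk_one hD (hT 0) (hT 0) one_ne_zero 0 (by decide) 1 (by decide) (by decide)
    simpa using this
  have h12 : ∀ I : Idx, I.card = 2 → D.act 1 I u = 0 := by
    intro I hI
    obtain ⟨k, l, hkl, he, ha, hs⟩ : ∃ k l : Fin 4, k ≠ l ∧ ({k} : Idx).erase k ∪ ({l}ᶜ : Idx).erase k = I ∧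
       (∀ b, (b ∈ ({k} : Idx) ∧ b ∈ ({l}ᶜ : Idx) ∧ Disjoint (({k} : Idx).erase b) (({l}ᶜ : Idx).erase b)) ↔ b = k)
       ∧ dsign k {k} * dsign k {l}ᶜ * msign (({k} : Idx).erase k) (({l}ᶜ : Idx).erase k) ≠ 0 := by
      revert I; decide
    have := brk_one hD (hT k) (hY l) one_ne_zero k ha _ rfl hs
    rwa [he] at this
  have h21 : ∀ j, D.act 2 {j} u = 0 := by
    intro j
    obtain ⟨i, hc, he, ha, hs⟩ : ∃ i : Fin 4, ({i, j} : Idx).card = 2 ∧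
       ({i} : Idx).erase i ∪ ({i, j} : Idx).erase i = {j} ∧
       (∀ b, (b ∈ ({i} : Idx) ∧ b ∈ ({i, j} : Idx) ∧ Disjoint (({i} : Idx).erase b) (({i, j} : Idx).erase b)) ↔ b = i)
       ∧ dsign i {i} * dsign i {i, j} * msign (({i} : Idx).erase i) (({i, j} : Idx).erase i) ≠ 0 := by
      revert j; decide
    have := brk_one hD (hT i) (h12 _ hc) one_ne_zero i ha _ rfl hs
    rwa [he] at this
  have h30 : D.act 3 ∅ u = 0 := by
    have := brk_one hD (hT 0) (h21 0) one_ne_zero 0 (by decide) 1 (by decide) (by decide)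
    simpa using this
  have h04 : D.act 0 Finset.univ u = 0 := by
    have h := brk_zero hD (hT 0) (hY 0)
    have hd : Disjoint ({0} : Idx) {0}ᶜ := by decide
    have hm : msign {0} {0}ᶜ = 1 := by decide
    have hc : ({0}ᶜ : Idx).card = 3 := by decide
    have hu : ({0} ∪ {0}ᶜ : Idx) = Finset.univ := by decide
    have hb : ∀ b : Fin 4, ¬ (b ∈ ({0} : Idx) ∧ b ∈ ({0}ᶜ : Idx) ∧
      Disjoint (({0} : Idx).erase b) (({0}ᶜ : Idx).erase b)) := by decide
    simp only [brkAct, hd, hm, hc, hu, hb, if_true, if_false] at h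
    norm_num at h
    simpa using h
  have hstep : ∀ (n : ℕ) (J : Idx), n + J.card ≠ 2 → D.act n J u = 0 → D.act (n + 1) J u = 0 := by
    intro n J hn hJ
    have h := brk_zero hD h20 hJ
    have hm : msign ∅ J = 1 := by clear hn hJ h; revert J; decide
    have hz : ((2 * (n : ℤ) - 2 * ((2 : ℕ) : ℤ) - (n : ℤ) * (∅ : Idx).card
        + ((2 : ℕ) : ℤ) * J.card : ℤ) : ℂ) ≠ 0 := by
      rw [Int.cast_ne_zero]
      simp only [Finset.card_empty]
      push_cast
      omega
    have he : 2 + n - 1 = n + 1 := by omega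
    rw [brkAct, he] at h
    simp only [hm, Finset.disjoint_empty_left, if_true, Finset.notMem_empty, false_and, if_false,
      Finset.sum_const_zero, smul_zero, add_zero, Finset.empty_union, OfNat.ofNat_ne_zero,
      zero_smul, LinearMap.smul_apply, Int.cast_one, one_smul] at h
    exact (smul_eq_zero.1 h).resolve_left hz
  intro m
  induction m with
  | zero =>
    intro I hI
    have : (∃ l, I = {l}ᶜ) ∨ I = Finset.univ := by revert I; decide
    rcases this with ⟨l, rfl⟩ | rfl
    · exact hY l
    · exact h04
  | succ k ih =>
    intro I hI
    by_cases h1 : 2 < 2 * k + I.card ∧ k + I.card ≠ 2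
    · exact hstep k I h1.2 (ih I h1.1)
    · have h2 : (k = 0 ∧ I.card = 1) ∨ (k = 0 ∧ I.card = 2) ∨ (k = 1 ∧ I.card = 0) ∨
        (k = 1 ∧ I.card = 1) ∨ (k = 2 ∧ I.card = 0) := by omega
      rcases h2 with ⟨rfl, h⟩ | ⟨rfl, h⟩ | ⟨rfl, h⟩ | ⟨rfl, h⟩ | ⟨rfl, h⟩
      · obtain ⟨i, rfl⟩ := Finset.card_eq_one.1 h
        exact hT i
      · exact h12 I h
      · rw [Finset.card_eq_zero.1 h]; exact h20
      · obtain ⟨i, rfl⟩ := Finset.card_eq_one.1 h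
        exact h21 i
      · rw [Finset.card_eq_zero.1 h]; exact h30

lemma bv_inj {k : ℕ} {L : Idx} {v w : F} (h : bv k L v = bv k L w) : v = w :=
  Finsupp.single_injective _ h

lemma lie_vac {D : VermaData F} (hD : IsVerma D) (i j k l : Fin 4) (hij : i < j) (hkl : k < l)
    (v : F) : bv 0 ∅ (D.ρξ i j (D.ρξ k l v) - D.ρξ k l (D.ρξ i j v))
      = brkAct D.ρC D.act 0 {i, j} 0 {k, l} (bv 0 ∅ v) := by
  rw [← hD.lie, bv_sub]
  simp [Finset.card_pair hij.ne, Finset.card_pair hkl.ne, hD.vac_xi _ _ _ hij,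
    hD.vac_xi _ _ _ hkl]
  norm_num

lemma psi0_pair (i j : Fin 4) (J : Idx) (hij : i < j) : psi0 {i, j} J = 0 := by
  have h1 : ({i, j} : Idx) ≠ ∅ := by simp
  have h2 : ({i, j} : Idx) ≠ Finset.univ := by clear h1; revert i j; decide
  have h3 : ∀ b, ({i, j} : Idx) ≠ {b} := by clear h1 h2; revert i j; decide
  have h4 : ∀ b, ({i, j} : Idx) ≠ {b}ᶜ := by clear h1 h2 h3; revert i j; decide
  simp only [psi0, h1, h2, h3, h4, false_and, if_false, Finset.sum_const_zero, add_zero]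

lemma xi_lie {D : VermaData F} (hD : IsVerma D) (i j k l a p q : Fin 4) (s : ℤ)
    (hij : i < j) (hkl : k < l) (hpq : p < q)
    (ha : ∀ b, (b ∈ ({i, j} : Idx) ∧ b ∈ ({k, l} : Idx) ∧
      Disjoint (({i, j} : Idx).erase b) (({k, l} : Idx).erase b)) ↔ b = a)
    (hs : dsign a {i, j} * dsign a {k, l} *
      msign (({i, j} : Idx).erase a) (({k, l} : Idx).erase a) = s)
    (hU : ({i, j} : Idx).erase a ∪ ({k, l} : Idx).erase a = {p, q}) (v : F) :
    D.ρξ i j (D.ρξ k l v) = D.ρξ k l (D.ρξ i j v) + (s : ℂ) • D.ρξ p q v := by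
  rw [← sub_eq_iff_eq_add']
  apply bv_inj (k := 0) (L := ∅)
  rw [lie_vac hD i j k l hij hkl]
  have hd : ¬ Disjoint ({i, j} : Idx) {k, l} := by
    have := (ha a).2 rfl
    exact fun hd => Finset.disjoint_left.1 hd this.1 this.2.1
  simp only [brkAct, ha, hd, if_false, smul_zero, zero_add, and_self, if_true,
    Finset.sum_ite_eq', Finset.mem_univ, LinearMap.smul_apply, LinearMap.add_apply, hs, hU,
    psi0_pair i j _ hij, hD.vac_xi v p q hpq, Finset.card_pair hij.ne, zero_smul, bv_smul]
  simp

lemma xi_comm {D : VermaData F} (hD : IsVerma D) (i j k l : Fin 4)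
    (hij : i < j) (hkl : k < l) (hd : Disjoint ({i, j} : Idx) {k, l}) (v : F) :
    D.ρξ i j (D.ρξ k l v) = D.ρξ k l (D.ρξ i j v) := by
  rw [← sub_eq_zero]
  apply bv_inj (k := 0) (L := ∅)
  rw [lie_vac hD i j k l hij hkl]
  have ha : ∀ b, ¬ (b ∈ ({i, j} : Idx) ∧ b ∈ ({k, l} : Idx) ∧
      Disjoint (({i, j} : Idx).erase b) (({k, l} : Idx).erase b)) :=
    fun b hb => Finset.disjoint_left.1 hd hb.1 hb.2.1
  simp only [brkAct, ha, if_false, Finset.sum_const_zero, psi0_pair i j _ hij, bv_zero]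
  simp

lemma t_xi {D : VermaData F} (hD : IsVerma D) (i j : Fin 4) (hij : i < j) (v : F) :
    D.ρt (D.ρξ i j v) = D.ρξ i j (D.ρt v) := by
  rw [← sub_eq_zero]
  apply bv_inj (k := 0) (L := ∅)
  have h := LinearMap.congr_fun (hD.lie 1 ∅ 0 {i, j}) (bv 0 ∅ v)
  simp only [brkAct, Finset.notMem_empty, false_and, if_false, Finset.sum_const_zero,
    Finset.card_pair hij.ne] at h
  simp [hD.vac_xi _ _ _ hij, hD.vac_t] at h
  rw [bv_sub, h, bv_zero]

lemma C_word {D : VermaData F} (hD : IsVerma D) (k : Fin 4) (v : F) :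
    bv 0 ∅ (D.ρC v) =
      ((-dsign k Finset.univ : ℤ) : ℂ) • D.act 0 {k}ᶜ (D.act 0 {k} (bv 0 ∅ v)) := by
  rw [Y_eta hD, Y_vac hD, C_bv]
  have : dsign k Finset.univ * dsign k Finset.univ = 1 := by revert k; decide
  simp [smul_smul]
  rw [← Int.cast_mul, this]; simp

lemma C_xi {D : VermaData F} (hD : IsVerma D) (i j : Fin 4) (hij : i < j) (v : F) :
    D.ρC (D.ρξ i j v) = D.ρξ i j (D.ρC v) := by
  obtain ⟨k, hki, hkj, ha⟩ : ∃ k, k ≠ i ∧ k ≠ j ∧ ∀ b, ¬ (b ∈ ({i, j} : Idx) ∧ b ∈ ({k}ᶜ : Idx) ∧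
      Disjoint (({i, j} : Idx).erase b) (({k}ᶜ : Idx).erase b)) := by
    revert i j; decide
  apply bv_inj (k := 0) (L := ∅)
  have h := LinearMap.congr_fun (hD.lie 0 {i, j} 0 {k}ᶜ) (D.act 0 {k} (bv 0 ∅ v))
  have hp : psi0 {i, j} {k}ᶜ = 0 := psi0_pair i j _ hij
  simp only [brkAct, ha, if_false, Finset.sum_const_zero, hp, Finset.card_pair hij.ne] at h
  simp [X_eta hD i j k _ hij, hki.symm, hkj.symm, hD.vac_xi _ _ _ hij, sub_eq_zero] at h
  rw [← hD.vac_xi _ _ _ hij, C_word hD k, C_word hD k, map_smul, h]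

lemma C_t {D : VermaData F} (hD : IsVerma D) (v : F) :
    D.ρC (D.ρt v) = D.ρt (D.ρC v) := by
  apply bv_inj (k := 0) (L := ∅)
  have h := LinearMap.congr_fun (hD.lie 1 ∅ 0 {0}ᶜ) (D.act 0 {0} (bv 0 ∅ v))
  have hc : ({0}ᶜ : Idx).card = 3 := by decide
  have hm : msign ∅ {0}ᶜ = 1 := by decide
  simp only [brkAct, Finset.notMem_empty, false_and, if_false, Finset.sum_const_zero, hc, hm] at h
  norm_num at h
  simp [E_eta hD, hD.vac_t] at h
  rw [← hD.vac_t, C_word hD 0, C_word hD 0, map_smul]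
  congr 1
  rw [sub_eq_iff_eq_add] at h
  rw [h]; abel

/-- The central elements act by scalars. -/
lemma t_scalar {D : VermaData F} (hD : IsVerma D) (hirr : IsIrred D) {c : ℂ} {v0 : F}
    (h0 : v0 ≠ 0) (h : D.ρt v0 = c • v0) (v : F) : D.ρt v = c • v := by
  have hx : ∀ i j v, D.ρt v = c • v → D.ρt (D.ρξ i j v) = c • D.ρξ i j v := by
    intro i j v hv
    rcases lt_trichotomy i j with h | h | h
    · rw [t_xi hD i j h, hv, map_smul]
    · subst h
      have h2 := Xs_vac hD i i v
      have h3 : D.ρξ i i v = 0 := by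
        apply bv_inj (k := 0) (L := ∅); rw [← h2, bv_zero]; simp [Xs]
      simp [h3]
    · rw [hD.anti i j]; simp [t_xi hD j i h, hv]
  have hp := hirr.2 (LinearMap.ker (D.ρt - c • LinearMap.id)) (by
    intro v hv
    simp only [LinearMap.mem_ker, LinearMap.sub_apply, LinearMap.smul_apply, LinearMap.id_apply,
      sub_eq_zero] at hv ⊢
    refine ⟨?_, ?_, fun i j => hx i j v hv⟩
    · rw [hv, map_smul, hv]
    · rw [← C_t hD, hv, map_smul])
  rcases hp with hp | hp
  · exfalso; apply h0
    have : v0 ∈ LinearMap.ker (D.ρt - c • LinearMap.id) := by simp [h]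
    rwa [hp, Submodule.mem_bot] at this
  · have : v ∈ LinearMap.ker (D.ρt - c • LinearMap.id) := by rw [hp]; trivial
    simpa [sub_eq_zero] using this

lemma C_scalar {D : VermaData F} (hD : IsVerma D) (hirr : IsIrred D) {c : ℂ} {v0 : F}
    (h0 : v0 ≠ 0) (h : D.ρC v0 = c • v0) (v : F) : D.ρC v = c • v := by
  have hx : ∀ i j v, D.ρC v = c • v → D.ρC (D.ρξ i j v) = c • D.ρξ i j v := by
    intro i j v hv
    rcases lt_trichotomy i j with h | h | h
    · rw [C_xi hD i j h, hv, map_smul]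
    · subst h
      have h2 := Xs_vac hD i i v
      have h3 : D.ρξ i i v = 0 := by
        apply bv_inj (k := 0) (L := ∅); rw [← h2, bv_zero]; simp [Xs]
      simp [h3]
    · rw [hD.anti i j]; simp [C_xi hD j i h, hv]
  have hp := hirr.2 (LinearMap.ker (D.ρC - c • LinearMap.id)) (by
    intro v hv
    simp only [LinearMap.mem_ker, LinearMap.sub_apply, LinearMap.smul_apply, LinearMap.id_apply,
      sub_eq_zero] at hv ⊢
    refine ⟨?_, ?_, fun i j => hx i j v hv⟩
    · rw [C_t hD, hv, map_smul]
    · rw [hv, map_smul, hv])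
  rcases hp with hp | hp
  · exfalso; apply h0
    have : v0 ∈ LinearMap.ker (D.ρC - c • LinearMap.id) := by simp [h]
    rwa [hp, Submodule.mem_bot] at this
  · have : v ∈ LinearMap.ker (D.ρC - c • LinearMap.id) := by rw [hp]; trivial
    simpa [sub_eq_zero] using this

end K4

namespace K4

variable {F : Type*} [AddCommGroup F] [Module ℂ F]

lemma split7 {z c01 c02 c03 c12 c13 c23 : F}
    (h : bv 1 ∅ z + bv 0 {0, 1} c01 + bv 0 {0, 2} c02 + bv 0 {0, 3} c03 + bv 0 {1, 2} c12
      + bv 0 {1, 3} c13 + bv 0 {2, 3} c23 = 0) :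
    z = 0 ∧ c01 = 0 ∧ c02 = 0 ∧ c03 = 0 ∧ c12 = 0 ∧ c13 = 0 ∧ c23 = 0 := by
  have e := fun p => DFunLike.congr_fun h p
  simp only [bv, Finsupp.add_apply, Finsupp.single_apply, Finsupp.zero_apply] at e
  refine ⟨?_, ?_, ?_, ?_, ?_, ?_, ?_⟩
  · simpa +decide using e (1, ∅)
  · simpa +decide using e (0, {0, 1})
  · simpa +decide using e (0, {0, 2})
  · simpa +decide using e (0, {0, 3})
  · simpa +decide using e (0, {1, 2})
  · simpa +decide using e (0, {1, 3})
  · simpa +decide using e (0, {2, 3})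

lemma U_apply (a0 a1 a2 a3 b0 b1 b2 b3 : F) :
    U a0 a1 a2 a3 b0 b1 b2 b3 (1, {0}) = a0 ∧ U a0 a1 a2 a3 b0 b1 b2 b3 (1, {1}) = a1 ∧
    U a0 a1 a2 a3 b0 b1 b2 b3 (1, {2}) = a2 ∧ U a0 a1 a2 a3 b0 b1 b2 b3 (1, {3}) = a3 ∧
    U a0 a1 a2 a3 b0 b1 b2 b3 (0, {1, 2, 3}) = b0 ∧ U a0 a1 a2 a3 b0 b1 b2 b3 (0, {0, 2, 3}) = b1 ∧
    U a0 a1 a2 a3 b0 b1 b2 b3 (0, {0, 1, 3}) = b2 ∧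
    U a0 a1 a2 a3 b0 b1 b2 b3 (0, {0, 1, 2}) = b3 := by
  simp only [U, bv, Finsupp.add_apply, Finsupp.single_apply]
  refine ⟨?_, ?_, ?_, ?_, ?_, ?_, ?_, ?_⟩ <;> simp +decide

lemma split8 {a0 a1 a2 a3 b0 b1 b2 b3 : F}
    (h : bv 1 {0} a0 + bv 1 {1} a1 + bv 1 {2} a2 + bv 1 {3} a3
      + bv 0 {0, 1, 2} b3 + bv 0 {0, 1, 3} b2 + bv 0 {0, 2, 3} b1 + bv 0 {1, 2, 3} b0 = 0) :
    a0 = 0 ∧ a1 = 0 ∧ a2 = 0 ∧ a3 = 0 ∧ b0 = 0 ∧ b1 = 0 ∧ b2 = 0 ∧ b3 = 0 := by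
  have h' : U a0 a1 a2 a3 b0 b1 b2 b3 = 0 := by rw [← h, U]; abel
  have e := U_apply a0 a1 a2 a3 b0 b1 b2 b3
  rw [h'] at e
  simpa [eq_comm] using e

lemma keys (p : ℕ × Idx) (hp : 2 * p.1 + p.2.card = 3) :
    p = (1, {0}) ∨ p = (1, {1}) ∨ p = (1, {2}) ∨ p = (1, {3}) ∨ p = (0, {1, 2, 3}) ∨
    p = (0, {0, 2, 3}) ∨ p = (0, {0, 1, 3}) ∨ p = (0, {0, 1, 2}) := by
  obtain ⟨k, L⟩ := p
  have hk : k = 0 ∨ k = 1 := by simp only at hp; omega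
  rcases hk with rfl | rfl
  · revert L; decide
  · revert L; decide

lemma U_homog (a0 a1 a2 a3 b0 b1 b2 b3 : F) : HomogDeg (U a0 a1 a2 a3 b0 b1 b2 b3) 3 := by
  intro p hp
  by_contra hne
  rw [Finsupp.mem_support_iff] at hp
  apply hp
  have hk : ∀ q : ℕ × Idx, 2 * q.1 + q.2.card = 3 → q ≠ p := by
    rintro q hq rfl; exact hne hq
  simp only [U, bv, Finsupp.add_apply]
  rw [Finsupp.single_eq_of_ne (hk _ (by decide)).symm, Finsupp.single_eq_of_ne (hk _ (by decide)).symm,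
    Finsupp.single_eq_of_ne (hk _ (by decide)).symm, Finsupp.single_eq_of_ne (hk _ (by decide)).symm,
    Finsupp.single_eq_of_ne (hk _ (by decide)).symm, Finsupp.single_eq_of_ne (hk _ (by decide)).symm,
    Finsupp.single_eq_of_ne (hk _ (by decide)).symm, Finsupp.single_eq_of_ne (hk _ (by decide)).symm]
  simp

lemma homog_eq_U {u : VInd F} (hu : HomogDeg u 3) :
    u = U (u (1, {0})) (u (1, {1})) (u (1, {2})) (u (1, {3})) (u (0, {1, 2, 3}))
      (u (0, {0, 2, 3})) (u (0, {0, 1, 3})) (u (0, {0, 1, 2})) := by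
  have e := U_apply (u (1, {0})) (u (1, {1})) (u (1, {2})) (u (1, {3})) (u (0, {1, 2, 3}))
      (u (0, {0, 2, 3})) (u (0, {0, 1, 3})) (u (0, {0, 1, 2}))
  have hU := U_homog (u (1, {0})) (u (1, {1})) (u (1, {2})) (u (1, {3})) (u (0, {1, 2, 3}))
      (u (0, {0, 2, 3})) (u (0, {0, 1, 3})) (u (0, {0, 1, 2}))
  obtain ⟨e0, e1, e2, e3, e4, e5, e6, e7⟩ := e
  ext p
  by_cases hp : 2 * p.1 + p.2.card = 3
  · rcases keys p hp with rfl | rfl | rfl | rfl | rfl | rfl | rfl | rfl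
    · exact e0.symm
    · exact e1.symm
    · exact e2.symm
    · exact e3.symm
    · exact e4.symm
    · exact e5.symm
    · exact e6.symm
    · exact e7.symm
  · have h1 : u p = 0 := by
      by_contra h; exact hp (hu p (Finsupp.mem_support_iff.2 h))
    rw [h1, eq_comm]
    by_contra h; exact hp (hU p (Finsupp.mem_support_iff.2 h))

/-- `p, q` span a two-dimensional `𝔰𝔬(4)`-module (spin module of chirality `s = ±1`), with
highest weight vector `p`. -/
structure TwoMod (D : VermaData F) (s : ℂ) (p q : F) : Prop where
  q01 : D.ρξ 0 1 q = (-(Complex.I / 2)) • q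
  p01 : D.ρξ 0 1 p = (Complex.I / 2) • p
  q02 : D.ρξ 0 2 q = (1 / 2 : ℂ) • p
  p02 : D.ρξ 0 2 p = (-(1 / 2) : ℂ) • q
  q03 : D.ρξ 0 3 q = (-(Complex.I * s / 2)) • p
  p03 : D.ρξ 0 3 p = (-(Complex.I * s / 2)) • q
  q12 : D.ρξ 1 2 q = (Complex.I / 2) • p
  p12 : D.ρξ 1 2 p = (Complex.I / 2) • q
  q13 : D.ρξ 1 3 q = (s / 2) • p
  p13 : D.ρξ 1 3 p = (-(s / 2)) • q
  q23 : D.ρξ 2 3 q = (Complex.I * s / 2) • q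
  p23 : D.ρξ 2 3 p = (-(Complex.I * s / 2)) • p

/-- The candidate singular vector attached to the pair `p, q`. -/
noncomputable def V (s : ℂ) (p q : F) : VInd F :=
  U (s • q) (-(s * Complex.I) • q) (s • p) (-Complex.I • p) q (Complex.I • q) p
    ((Complex.I * s) • p)

section back
variable {D : VermaData F} {s : ℂ} {p q : F}

lemma T_V (hD : IsVerma D) (hs : s * s = 1) (h : TwoMod D s p q)
    (tp : D.ρt p = (5 / 2 : ℂ) • p) (tq : D.ρt q = (5 / 2 : ℂ) • q) (i : Fin 4) :
    D.act 1 {i} (V s p q) = 0 := by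
  have hI : Complex.I * Complex.I = -1 := Complex.I_mul_I
  have hz : ∀ (k : ℕ) (L : Idx) (v : F), v = 0 → bv k L v = 0 := by
    rintro k L v rfl; exact bv_zero k L
  have key : D.act 1 {0} (V s p q) = 0 ∧ D.act 1 {1} (V s p q) = 0 ∧
      D.act 1 {2} (V s p q) = 0 ∧ D.act 1 {3} (V s p q) = 0 := by
    unfold V
    rw [T0_U hD, T1_U hD, T2_U hD, T3_U hD]
    simp only [map_smul, h.q01, h.p01, h.q02, h.p02, h.q03, h.p03, h.q12, h.p12, h.q13, h.p13,
      h.q23, h.p23, tp, tq]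
    refine ⟨?_, ?_, ?_, ?_⟩ <;> repeat rw [hz _ _ _ (by match_scalars <;> grind)]
    all_goals simp
  obtain ⟨h0, h1, h2, h3⟩ := key
  fin_cases i
  · exact h0
  · exact h1
  · exact h2
  · exact h3

lemma Y_V (hD : IsVerma D) (hs : s * s = 1) (h : TwoMod D s p q)
    (cp : D.ρC p = (-(s / 2)) • p) (cq : D.ρC q = (-(s / 2)) • q) (l : Fin 4) :
    D.act 0 {l}ᶜ (V s p q) = 0 := by
  have hI : Complex.I * Complex.I = -1 := Complex.I_mul_I
  have hz : ∀ (k : ℕ) (L : Idx) (v : F), v = 0 → bv k L v = 0 := by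
    rintro k L v rfl; exact bv_zero k L
  have key : D.act 0 {0}ᶜ (V s p q) = 0 ∧ D.act 0 {1}ᶜ (V s p q) = 0 ∧
      D.act 0 {2}ᶜ (V s p q) = 0 ∧ D.act 0 {3}ᶜ (V s p q) = 0 := by
    unfold V
    rw [Y0_U hD, Y1_U hD, Y2_U hD, Y3_U hD]
    simp only [map_smul, h.q01, h.p01, h.q02, h.p02, h.q03, h.p03, h.q12, h.p12, h.q13, h.p13,
      h.q23, h.p23, cp, cq]
    refine ⟨?_, ?_, ?_, ?_⟩ <;> repeat rw [hz _ _ _ (by match_scalars <;> grind)]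
    all_goals simp
  obtain ⟨h0, h1, h2, h3⟩ := key
  fin_cases l
  · exact h0
  · exact h1
  · exact h2
  · exact h3

lemma V_HW (hD : IsVerma D) (hs : s * s = 1) (h : TwoMod D s p q) : IsHW D (V s p q) := by
  have hI : Complex.I * Complex.I = -1 := Complex.I_mul_I
  have hz : ∀ (k : ℕ) (L : Idx) (v : F), v = 0 → bv k L v = 0 := by
    rintro k L v rfl; exact bv_zero k L
  unfold IsHW V
  rw [e1_U hD, e2_U hD]
  simp only [map_smul, h.q01, h.p01, h.q02, h.p02, h.q03, h.p03, h.q12, h.p12, h.q13, h.p13,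
      h.q23, h.p23]
  refine ⟨?_, ?_⟩ <;> repeat rw [hz _ _ _ (by match_scalars <;> grind)]
  all_goals simp

lemma V_singular (hD : IsVerma D) (hs : s * s = 1) (h : TwoMod D s p q) (hp : p ≠ 0)
    (tp : D.ρt p = (5 / 2 : ℂ) • p) (tq : D.ρt q = (5 / 2 : ℂ) • q)
    (cp : D.ρC p = (-(s / 2)) • p) (cq : D.ρC q = (-(s / 2)) • q) :
    IsSingular D (V s p q) ∧ HomogDeg (V s p q) 3 ∧ IsHW D (V s p q) := by
  refine ⟨⟨?_, sing_of_gens hD (T_V hD hs h tp tq) (Y_V hD hs h cp cq)⟩, U_homog _ _ _ _ _ _ _ _,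
    V_HW hD hs h⟩
  intro h0
  apply hp
  have := (U_apply (s • q) (-(s * Complex.I) • q) (s • p) (-Complex.I • p) q (Complex.I • q) p
    ((Complex.I * s) • p)).2.2.2.2.2.2.1
  rw [← this]
  change (V s p q) _ = 0
  rw [h0]; rfl

end back

end K4

namespace K4

variable {F : Type*} [AddCommGroup F] [Module ℂ F]

lemma cmul_add_left (x y z : CA) : cmul (x + y) z = cmul x z + cmul y z := by
  unfold cmul
  rw [Finsupp.sum_add_index']
  · intro p; simp
  · intro p c c'
    rw [← Finsupp.sum_add]
    simp only [add_mul, Finsupp.single_add]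

lemma cmul_add_right (x y z : CA) : cmul x (y + z) = cmul x y + cmul x z := by
  unfold cmul
  rw [← Finsupp.sum_add]
  congr 1
  funext p c
  rw [Finsupp.sum_add_index']
  · intro p; simp
  · intro p c c'
    simp only [mul_add, add_mul, Finsupp.single_add]

lemma cmul_single (p q : ℕ × Idx) (c c' : ℂ) :
    cmul (Finsupp.single p c) (Finsupp.single q c') =
      Finsupp.single (p.1 + q.1 + (p.2 ∩ q.2).card, (p.2 \ q.2) ∪ (q.2 \ p.2))
      (c * c' * ((msign p.2 q.2 : ℤ) : ℂ)) := by
  unfold cmul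
  rw [Finsupp.sum_single_index, Finsupp.sum_single_index] <;> simp

lemma tens_add (a b : CA) (v : F) : tens (a + b) v = tens a v + tens b v := by
  unfold tens
  rw [Finsupp.sum_add_index']
  · intro p; simp
  · intro p c c'
    simp only [add_smul, Finsupp.single_add]

lemma tens_single (k : ℕ) (L : Idx) (c : ℂ) (v : F) :
    tens (Finsupp.single (k, L) c) v = bv k L (c • v) := by
  unfold tens bv
  rw [Finsupp.sum_single_index]; simp

/-- multiplication by a single generator on the right -/
lemma cmul_gen (k : ℕ) (L : Idx) (i : Fin 4) (c c' : ℂ) (k' : ℕ) (L' : Idx) (s : ℤ)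
    (hk : k + 0 + (L ∩ {i}).card = k') (hL : (L \ {i}) ∪ ({i} \ L) = L') (hs : msign L {i} = s) :
    cmul (Finsupp.single (k, L) c) (Finsupp.single (0, {i}) c') =
      Finsupp.single (k', L') (c * c' * (s : ℂ)) := by
  rw [cmul_single, hk, hL, hs]

lemma V_smul (c s : ℂ) (p q : F) : c • V s p q = V s (c • p) (c • q) := by
  simp only [V, U, smul_add, ← bv_smul]
  simp only [smul_smul, mul_comm]

lemma w11_eq : w11 = Finsupp.single (0, ({1} : Idx)) 1 + Finsupp.single (0, ({0} : Idx)) Complex.I := by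
  simp [w11]
lemma w22_eq : w22 = Finsupp.single (0, ({1} : Idx)) 1 + Finsupp.single (0, ({0} : Idx)) (-Complex.I) := by
  simp [w22, sub_eq_add_neg]
lemma w12_eq : w12 = Finsupp.single (0, ({3} : Idx)) (-1) + Finsupp.single (0, ({2} : Idx)) Complex.I := by
  simp [w12]
lemma w21_eq : w21 = Finsupp.single (0, ({3} : Idx)) 1 + Finsupp.single (0, ({2} : Idx)) Complex.I := by
  simp [w21]

/-- basis monomials -/
noncomputable def mon (p : ℕ × Idx) : CA := Finsupp.single p 1

lemma single_smul_one (p : ℕ × Idx) (c : ℂ) :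
    (Finsupp.single p c : CA) = c • mon p := by simp [mon]

lemma c1122 : cmul w11 w22 = Finsupp.single (0, ({0, 1} : Idx)) (2 * Complex.I)
    + Finsupp.single (1, (∅ : Idx)) 2 := by
  rw [w11_eq, w22_eq]
  simp only [cmul_add_left, cmul_add_right]
  rw [cmul_gen 0 {1} 1 _ _ 1 ∅ 1 (by decide) (by decide) (by decide),
    cmul_gen 0 {1} 0 _ _ 0 {0, 1} (-1) (by decide) (by decide) (by decide),
    cmul_gen 0 {0} 1 _ _ 0 {0, 1} 1 (by decide) (by decide) (by decide),
    cmul_gen 0 {0} 0 _ _ 1 ∅ 1 (by decide) (by decide) (by decide)]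
  have hI : Complex.I * Complex.I = -1 := Complex.I_mul_I
  simp only [single_smul_one (1, ∅), single_smul_one (0, {0, 1})]
  push_cast
  match_scalars <;> grind

lemma c2112 : cmul w21 w12 = Finsupp.single (0, ({2, 3} : Idx)) (-(2 * Complex.I))
    + Finsupp.single (1, (∅ : Idx)) (-2) := by
  rw [w21_eq, w12_eq]
  simp only [cmul_add_left, cmul_add_right]
  rw [cmul_gen 0 {3} 3 _ _ 1 ∅ 1 (by decide) (by decide) (by decide),
    cmul_gen 0 {3} 2 _ _ 0 {2, 3} (-1) (by decide) (by decide) (by decide),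
    cmul_gen 0 {2} 3 _ _ 0 {2, 3} 1 (by decide) (by decide) (by decide),
    cmul_gen 0 {2} 2 _ _ 1 ∅ 1 (by decide) (by decide) (by decide)]
  have hI : Complex.I * Complex.I = -1 := Complex.I_mul_I
  simp only [single_smul_one (1, ∅), single_smul_one (0, {2, 3})]
  push_cast
  match_scalars <;> grind

lemma c1221 : cmul w12 w21 = Finsupp.single (0, ({2, 3} : Idx)) (2 * Complex.I)
    + Finsupp.single (1, (∅ : Idx)) (-2) := by
  rw [w12_eq, w21_eq]
  simp only [cmul_add_left, cmul_add_right]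
  rw [cmul_gen 0 {3} 3 _ _ 1 ∅ 1 (by decide) (by decide) (by decide),
    cmul_gen 0 {3} 2 _ _ 0 {2, 3} (-1) (by decide) (by decide) (by decide),
    cmul_gen 0 {2} 3 _ _ 0 {2, 3} 1 (by decide) (by decide) (by decide),
    cmul_gen 0 {2} 2 _ _ 1 ∅ 1 (by decide) (by decide) (by decide)]
  have hI : Complex.I * Complex.I = -1 := Complex.I_mul_I
  simp only [single_smul_one (1, ∅), single_smul_one (0, {2, 3})]
  push_cast
  match_scalars <;> grind

lemma tensA (x y : F) :
    tens (cmul (cmul w11 w22) w21) x + tens (cmul (cmul w21 w12) w11) y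
      = V (1) (((2 * Complex.I)) • x) ((-(2 * Complex.I)) • y) := by
  rw [c1122, c2112, w21_eq, w11_eq]
  simp only [cmul_add_left, cmul_add_right, tens_add]
  rw [cmul_gen 0 {0, 1} 3 _ _ 0 {0, 1, 3} 1 (by decide) (by decide) (by decide),
    cmul_gen 0 {0, 1} 2 _ _ 0 {0, 1, 2} 1 (by decide) (by decide) (by decide),
    cmul_gen 1 ∅ 3 _ _ 1 {3} 1 (by decide) (by decide) (by decide),
    cmul_gen 1 ∅ 2 _ _ 1 {2} 1 (by decide) (by decide) (by decide),
    cmul_gen 0 {2, 3} 1 _ _ 0 {1, 2, 3} 1 (by decide) (by decide) (by decide),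
    cmul_gen 0 {2, 3} 0 _ _ 0 {0, 2, 3} 1 (by decide) (by decide) (by decide),
    cmul_gen 1 ∅ 1 _ _ 1 {1} 1 (by decide) (by decide) (by decide),
    cmul_gen 1 ∅ 0 _ _ 1 {0} 1 (by decide) (by decide) (by decide)]
  have hI : Complex.I * Complex.I = -1 := Complex.I_mul_I
  simp only [tens_single, V, U, bv_smul]
  push_cast
  match_scalars <;> grind

lemma tensB (x y : F) :
    tens (cmul (cmul w11 w22) w12) x + tens (cmul (cmul w12 w21) w11) y
      = V (-1) ((-(2 * Complex.I)) • x) (((2 * Complex.I)) • y) := by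
  rw [c1122, c1221, w12_eq, w11_eq]
  simp only [cmul_add_left, cmul_add_right, tens_add]
  rw [cmul_gen 0 {0, 1} 3 _ _ 0 {0, 1, 3} 1 (by decide) (by decide) (by decide),
    cmul_gen 0 {0, 1} 2 _ _ 0 {0, 1, 2} 1 (by decide) (by decide) (by decide),
    cmul_gen 1 ∅ 3 _ _ 1 {3} 1 (by decide) (by decide) (by decide),
    cmul_gen 1 ∅ 2 _ _ 1 {2} 1 (by decide) (by decide) (by decide),
    cmul_gen 0 {2, 3} 1 _ _ 0 {1, 2, 3} 1 (by decide) (by decide) (by decide),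
    cmul_gen 0 {2, 3} 0 _ _ 0 {0, 2, 3} 1 (by decide) (by decide) (by decide),
    cmul_gen 1 ∅ 1 _ _ 1 {1} 1 (by decide) (by decide) (by decide),
    cmul_gen 1 ∅ 0 _ _ 1 {0} 1 (by decide) (by decide) (by decide)]
  have hI : Complex.I * Complex.I = -1 := Complex.I_mul_I
  simp only [tens_single, V, U, bv_smul]
  push_cast
  match_scalars <;> grind

end K4

namespace K4

variable {F : Type*} [AddCommGroup F] [Module ℂ F]

lemma r0201 {D : VermaData F} (hD : IsVerma D) (v : F) :
    D.ρξ 0 2 (D.ρξ 0 1 v) =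
      D.ρξ 0 1 (D.ρξ 0 2 v) - D.ρξ 1 2 v := by
  rw [xi_lie hD 0 2 0 1 0 1 2 (-1) (by decide) (by decide) (by decide) (by decide)
    (by decide) (by decide)]
  simp [sub_eq_add_neg]

lemma r0301 {D : VermaData F} (hD : IsVerma D) (v : F) :
    D.ρξ 0 3 (D.ρξ 0 1 v) =
      D.ρξ 0 1 (D.ρξ 0 3 v) - D.ρξ 1 3 v := by
  rw [xi_lie hD 0 3 0 1 0 1 3 (-1) (by decide) (by decide) (by decide) (by decide)
    (by decide) (by decide)]
  simp [sub_eq_add_neg]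

lemma r0302 {D : VermaData F} (hD : IsVerma D) (v : F) :
    D.ρξ 0 3 (D.ρξ 0 2 v) =
      D.ρξ 0 2 (D.ρξ 0 3 v) - D.ρξ 2 3 v := by
  rw [xi_lie hD 0 3 0 2 0 2 3 (-1) (by decide) (by decide) (by decide) (by decide)
    (by decide) (by decide)]
  simp [sub_eq_add_neg]

lemma r1201 {D : VermaData F} (hD : IsVerma D) (v : F) :
    D.ρξ 1 2 (D.ρξ 0 1 v) =
      D.ρξ 0 1 (D.ρξ 1 2 v) + D.ρξ 0 2 v := by
  rw [xi_lie hD 1 2 0 1 1 0 2 (1) (by decide) (by decide) (by decide) (by decide)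
    (by decide) (by decide)]
  simp

lemma r1202 {D : VermaData F} (hD : IsVerma D) (v : F) :
    D.ρξ 1 2 (D.ρξ 0 2 v) =
      D.ρξ 0 2 (D.ρξ 1 2 v) - D.ρξ 0 1 v := by
  rw [xi_lie hD 1 2 0 2 2 0 1 (-1) (by decide) (by decide) (by decide) (by decide)
    (by decide) (by decide)]
  simp [sub_eq_add_neg]

lemma r1203 {D : VermaData F} (hD : IsVerma D) (v : F) :
    D.ρξ 1 2 (D.ρξ 0 3 v) =
      D.ρξ 0 3 (D.ρξ 1 2 v) :=
  xi_comm hD 1 2 0 3 (by decide) (by decide) (by decide) v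

lemma r1301 {D : VermaData F} (hD : IsVerma D) (v : F) :
    D.ρξ 1 3 (D.ρξ 0 1 v) =
      D.ρξ 0 1 (D.ρξ 1 3 v) + D.ρξ 0 3 v := by
  rw [xi_lie hD 1 3 0 1 1 0 3 (1) (by decide) (by decide) (by decide) (by decide)
    (by decide) (by decide)]
  simp

lemma r1302 {D : VermaData F} (hD : IsVerma D) (v : F) :
    D.ρξ 1 3 (D.ρξ 0 2 v) =
      D.ρξ 0 2 (D.ρξ 1 3 v) :=
  xi_comm hD 1 3 0 2 (by decide) (by decide) (by decide) v

lemma r1303 {D : VermaData F} (hD : IsVerma D) (v : F) :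
    D.ρξ 1 3 (D.ρξ 0 3 v) =
      D.ρξ 0 3 (D.ρξ 1 3 v) - D.ρξ 0 1 v := by
  rw [xi_lie hD 1 3 0 3 3 0 1 (-1) (by decide) (by decide) (by decide) (by decide)
    (by decide) (by decide)]
  simp [sub_eq_add_neg]

lemma r1312 {D : VermaData F} (hD : IsVerma D) (v : F) :
    D.ρξ 1 3 (D.ρξ 1 2 v) =
      D.ρξ 1 2 (D.ρξ 1 3 v) - D.ρξ 2 3 v := by
  rw [xi_lie hD 1 3 1 2 1 2 3 (-1) (by decide) (by decide) (by decide) (by decide)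
    (by decide) (by decide)]
  simp [sub_eq_add_neg]

lemma r2301 {D : VermaData F} (hD : IsVerma D) (v : F) :
    D.ρξ 2 3 (D.ρξ 0 1 v) =
      D.ρξ 0 1 (D.ρξ 2 3 v) :=
  xi_comm hD 2 3 0 1 (by decide) (by decide) (by decide) v

lemma r2302 {D : VermaData F} (hD : IsVerma D) (v : F) :
    D.ρξ 2 3 (D.ρξ 0 2 v) =
      D.ρξ 0 2 (D.ρξ 2 3 v) + D.ρξ 0 3 v := by
  rw [xi_lie hD 2 3 0 2 2 0 3 (1) (by decide) (by decide) (by decide) (by decide)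
    (by decide) (by decide)]
  simp

lemma r2303 {D : VermaData F} (hD : IsVerma D) (v : F) :
    D.ρξ 2 3 (D.ρξ 0 3 v) =
      D.ρξ 0 3 (D.ρξ 2 3 v) - D.ρξ 0 2 v := by
  rw [xi_lie hD 2 3 0 3 3 0 2 (-1) (by decide) (by decide) (by decide) (by decide)
    (by decide) (by decide)]
  simp [sub_eq_add_neg]

lemma r2312 {D : VermaData F} (hD : IsVerma D) (v : F) :
    D.ρξ 2 3 (D.ρξ 1 2 v) =
      D.ρξ 1 2 (D.ρξ 2 3 v) + D.ρξ 1 3 v := by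
  rw [xi_lie hD 2 3 1 2 2 1 3 (1) (by decide) (by decide) (by decide) (by decide)
    (by decide) (by decide)]
  simp

lemma r2313 {D : VermaData F} (hD : IsVerma D) (v : F) :
    D.ρξ 2 3 (D.ρξ 1 3 v) =
      D.ρξ 1 3 (D.ρξ 2 3 v) - D.ρξ 1 2 v := by
  rw [xi_lie hD 2 3 1 3 3 1 2 (-1) (by decide) (by decide) (by decide) (by decide)
    (by decide) (by decide)]
  simp [sub_eq_add_neg]

/-- `h` of the `s`-th `𝔰𝔩₂` factor. -/
noncomputable def hS (D : VermaData F) (s : ℂ) : F →ₗ[ℂ] F :=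
  -(Complex.I • D.ρξ 0 1) + (s * Complex.I) • D.ρξ 2 3

/-- `e` of the `s`-th `𝔰𝔩₂` factor. -/
noncomputable def eS (D : VermaData F) (s : ℂ) : F →ₗ[ℂ] F :=
  (2 : ℂ)⁻¹ • (e1F D + s • e2F D)

/-- `f` of the `s`-th `𝔰𝔩₂` factor. -/
noncomputable def fS (D : VermaData F) (s : ℂ) : F →ₗ[ℂ] F :=
  (2 : ℂ)⁻¹ • (D.ρξ 0 2 + s • D.ρξ 1 3 - (s * Complex.I) • D.ρξ 0 3 + Complex.I • D.ρξ 1 2)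

lemma ef {D : VermaData F} (hD : IsVerma D) {s : ℂ} (hs : s * s = 1) (v : F) :
    eS D s (fS D s v) = fS D s (eS D s v) + hS D s v := by
  have hI : Complex.I * Complex.I = -1 := Complex.I_mul_I
  simp only [hS, eS, fS, e1F, e2F, LinearMap.add_apply, LinearMap.sub_apply, LinearMap.neg_apply,
    LinearMap.smul_apply, map_add, map_sub, map_neg, map_smul]
  simp only [r0201 hD, r0301 hD, r0302 hD, r1201 hD, r1202 hD, r1203 hD, r1301 hD, r1302 hD, r1303 hD, r1312 hD, r2301 hD, r2302 hD, r2303 hD, r2312 hD, r2313 hD]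
  match_scalars <;> grind

lemma he {D : VermaData F} (hD : IsVerma D) {s : ℂ} (hs : s * s = 1) (v : F) :
    hS D s (eS D s v) = eS D s (hS D s v) + (2 : ℂ) • eS D s v := by
  have hI : Complex.I * Complex.I = -1 := Complex.I_mul_I
  simp only [hS, eS, fS, e1F, e2F, LinearMap.add_apply, LinearMap.sub_apply, LinearMap.neg_apply,
    LinearMap.smul_apply, map_add, map_sub, map_neg, map_smul]
  simp only [r0201 hD, r0301 hD, r0302 hD, r1201 hD, r1202 hD, r1203 hD, r1301 hD, r1302 hD, r1303 hD, r1312 hD, r2301 hD, r2302 hD, r2303 hD, r2312 hD, r2313 hD]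
  match_scalars <;> grind

lemma hf {D : VermaData F} (hD : IsVerma D) {s : ℂ} (hs : s * s = 1) (v : F) :
    hS D s (fS D s v) = fS D s (hS D s v) - (2 : ℂ) • fS D s v := by
  have hI : Complex.I * Complex.I = -1 := Complex.I_mul_I
  simp only [hS, eS, fS, e1F, e2F, LinearMap.add_apply, LinearMap.sub_apply, LinearMap.neg_apply,
    LinearMap.smul_apply, map_add, map_sub, map_neg, map_smul]
  simp only [r0201 hD, r0301 hD, r0302 hD, r1201 hD, r1202 hD, r1203 hD, r1301 hD, r1302 hD, r1303 hD, r1312 hD, r2301 hD, r2302 hD, r2303 hD, r2312 hD, r2313 hD]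
  match_scalars <;> grind

lemma ef_neg {D : VermaData F} (hD : IsVerma D) {s : ℂ} (hs : s * s = 1) (v : F) :
    eS D s (fS D (-s) v) = fS D (-s) (eS D s v) := by
  have hI : Complex.I * Complex.I = -1 := Complex.I_mul_I
  simp only [hS, eS, fS, e1F, e2F, LinearMap.add_apply, LinearMap.sub_apply, LinearMap.neg_apply,
    LinearMap.smul_apply, map_add, map_sub, map_neg, map_smul]
  simp only [r0201 hD, r0301 hD, r0302 hD, r1201 hD, r1202 hD, r1203 hD, r1301 hD, r1302 hD, r1303 hD, r1312 hD, r2301 hD, r2302 hD, r2303 hD, r2312 hD, r2313 hD]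
  match_scalars <;> grind

lemma hf_neg {D : VermaData F} (hD : IsVerma D) {s : ℂ} (hs : s * s = 1) (v : F) :
    hS D s (fS D (-s) v) = fS D (-s) (hS D s v) := by
  have hI : Complex.I * Complex.I = -1 := Complex.I_mul_I
  simp only [hS, eS, fS, e1F, e2F, LinearMap.add_apply, LinearMap.sub_apply, LinearMap.neg_apply,
    LinearMap.smul_apply, map_add, map_sub, map_neg, map_smul]
  simp only [r0201 hD, r0301 hD, r0302 hD, r1201 hD, r1202 hD, r1203 hD, r1301 hD, r1302 hD, r1303 hD, r1312 hD, r2301 hD, r2302 hD, r2303 hD, r2312 hD, r2313 hD]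
  match_scalars <;> grind

lemma ff_neg {D : VermaData F} (hD : IsVerma D) {s : ℂ} (hs : s * s = 1) (v : F) :
    fS D s (fS D (-s) v) = fS D (-s) (fS D s v) := by
  have hI : Complex.I * Complex.I = -1 := Complex.I_mul_I
  simp only [hS, eS, fS, e1F, e2F, LinearMap.add_apply, LinearMap.sub_apply, LinearMap.neg_apply,
    LinearMap.smul_apply, map_add, map_sub, map_neg, map_smul]
  simp only [r0201 hD, r0301 hD, r0302 hD, r1201 hD, r1202 hD, r1203 hD, r1301 hD, r1302 hD, r1303 hD, r1312 hD, r2301 hD, r2302 hD, r2303 hD, r2312 hD, r2313 hD]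
  match_scalars <;> grind

end K4

namespace K4

variable {F : Type*} [AddCommGroup F] [Module ℂ F]

/-- In a finite-dimensional `𝔰𝔩₂`-module, `f^(n+1)` kills a highest weight vector of weight `n`. -/
lemma f_pow_zero [FiniteDimensional ℂ F] (h e f : Module.End ℂ F)
    (hef : ∀ v, e (f v) = f (e v) + h v) (hhe : ∀ v, h (e v) = e (h v) + (2 : ℂ) • e v)
    (hhf : ∀ v, h (f v) = f (h v) - (2 : ℂ) • f v) {v : F} (hv : v ≠ 0) {n : ℕ}
    (h1 : h v = (n : ℂ) • v) (h2 : e v = 0) : (f ^ (n + 1)) v = 0 := by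
  letI : LieRing (Module.End ℂ F) := LieRing.ofAssociativeRing
  by_cases h0 : h = 0
  · have hf : ∀ w, f w = 0 := by
      intro w
      have := hhf w
      simpa [h0] using this
    rw [pow_succ', Module.End.mul_apply, hf]
  · have t : IsSl2Triple h e f := by
      refine ⟨h0, ?_, ?_, ?_⟩
      · ext w; simp [Ring.lie_def, hef]
      · ext w; simp only [Ring.lie_def, LinearMap.sub_apply, Module.End.mul_apply, hhe,
          LinearMap.smul_apply]; module
      · ext w; simp only [Ring.lie_def, LinearMap.sub_apply, Module.End.mul_apply, hhf,
          LinearMap.smul_apply, LinearMap.neg_apply]; module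
    have P : t.HasPrimitiveVectorWith v (n : ℂ) := ⟨hv, h1, h2⟩
    exact P.pow_toEnd_f_eq_zero_of_eq_nat rfl

lemma invert (D : VermaData F) {s : ℂ} (hs : s * s = 1) (x : F) :
    D.ρξ 0 1 x = (Complex.I / 2) • (hS D s x + hS D (-s) x) ∧
    D.ρξ 0 2 x = (1 / 2 : ℂ) • (fS D s x + fS D (-s) x - eS D s x - eS D (-s) x) ∧
    D.ρξ 0 3 x = (Complex.I * s / 2) • (eS D s x - eS D (-s) x + fS D s x - fS D (-s) x) ∧
    D.ρξ 1 2 x = (-(Complex.I / 2)) • (fS D s x + fS D (-s) x + eS D s x + eS D (-s) x) ∧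
    D.ρξ 1 3 x = (s / 2) • (fS D s x - fS D (-s) x - eS D s x + eS D (-s) x) ∧
    D.ρξ 2 3 x = (-(Complex.I * s / 2)) • (hS D s x - hS D (-s) x) := by
  have hI : Complex.I * Complex.I = -1 := Complex.I_mul_I
  simp only [hS, eS, fS, e1F, e2F, LinearMap.add_apply, LinearMap.sub_apply, LinearMap.neg_apply,
    LinearMap.smul_apply]
  refine ⟨?_, ?_, ?_, ?_, ?_, ?_⟩ <;> match_scalars <;> grind

lemma twoMod_of {D : VermaData F} (hD : IsVerma D) [FiniteDimensional ℂ F] {s : ℂ}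
    (hs : s * s = 1) {v : F} (hv : v ≠ 0) (e1 : e1F D v = 0) (e2 : e2F D v = 0)
    (h1 : hS D s v = v) (h2 : hS D (-s) v = 0) : TwoMod D s v (-(fS D s v)) := by
  have hI : Complex.I * Complex.I = -1 := Complex.I_mul_I
  have hs' : (-s) * (-s) = 1 := by rw [neg_mul_neg, hs]
  have E1 : eS D s v = 0 := by simp [eS, e1, e2]
  have E2 : eS D (-s) v = 0 := by simp [eS, e1, e2]
  have F2 : fS D (-s) v = 0 := by
    have := f_pow_zero (hS D (-s)) (eS D (-s)) (fS D (-s)) (ef hD hs') (he hD hs') (hf hD hs')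
      hv (n := 0) (by simpa using h2) E2
    simpa using this
  have F1 : fS D s (fS D s v) = 0 := by
    have := f_pow_zero (hS D s) (eS D s) (fS D s) (ef hD hs) (he hD hs) (hf hD hs)
      hv (n := 1) (by simpa using h1) E1
    simpa [pow_succ] using this
  have W1 : eS D s (fS D s v) = v := by rw [ef hD hs, E1, h1]; simp
  have W2 : eS D (-s) (fS D s v) = 0 := by
    have := ef_neg hD hs' v
    rw [neg_neg] at this
    rw [this, E2, map_zero]
  have W3 : hS D s (fS D s v) = -fS D s v := by rw [hf hD hs, h1]; module
  have W4 : hS D (-s) (fS D s v) = 0 := by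
    have := hf_neg hD hs' v
    rw [neg_neg] at this
    rw [this, h2, map_zero]
  have W5 : fS D (-s) (fS D s v) = 0 := by
    rw [← ff_neg hD hs, F2, map_zero]
  obtain ⟨v01, v02, v03, v12, v13, v23⟩ := invert D hs v
  obtain ⟨w01, w02, w03, w12, w13, w23⟩ := invert D hs (fS D s v)
  rw [E1, E2, F2] at *
  simp only [h1, h2] at v01 v23
  rw [W1, W2, F1, W5] at w02 w03 w12 w13
  rw [W3, W4] at w01 w23
  generalize fS D s v = w at *
  refine ⟨?_, ?_, ?_, ?_, ?_, ?_, ?_, ?_, ?_, ?_, ?_, ?_⟩ <;>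
    simp only [map_neg, v01, v02, v03, v12, v13, v23, w01, w02, w03, w12, w13, w23] <;> module

end K4

namespace K4

variable {F : Type*} [AddCommGroup F] [Module ℂ F]

lemma forward_core {D : VermaData F} (hD : IsVerma D) {τ c : ℂ} (ht : ∀ v, D.ρt v = τ • v)
    (hc : ∀ v, D.ρC v = c • v) {a0 a1 a2 a3 b0 b1 b2 b3 : F}
    (hS : IsSingular D (U a0 a1 a2 a3 b0 b1 b2 b3)) (hW : IsHW D (U a0 a1 a2 a3 b0 b1 b2 b3)) :
    ∃ s : ℂ, s * s = 1 ∧ τ = 5 / 2 ∧ c = -(s / 2) ∧ TwoMod D s b2 b0 ∧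
      U a0 a1 a2 a3 b0 b1 b2 b3 = V s b2 b0 := by
  have hI : Complex.I * Complex.I = -1 := Complex.I_mul_I
  obtain ⟨t0z, t001, t002, t003, t012, t013, t023⟩ :=
    split7 ((T0_U hD a0 a1 a2 a3 b0 b1 b2 b3).symm.trans (hS.2 1 {0} (by decide)))
  obtain ⟨t1z, t101, t102, t103, t112, t113, t123⟩ :=
    split7 ((T1_U hD a0 a1 a2 a3 b0 b1 b2 b3).symm.trans (hS.2 1 {1} (by decide)))
  obtain ⟨t2z, t201, t202, t203, t212, t213, t223⟩ :=
    split7 ((T2_U hD a0 a1 a2 a3 b0 b1 b2 b3).symm.trans (hS.2 1 {2} (by decide)))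
  obtain ⟨t3z, t301, t302, t303, t312, t313, t323⟩ :=
    split7 ((T3_U hD a0 a1 a2 a3 b0 b1 b2 b3).symm.trans (hS.2 1 {3} (by decide)))
  obtain ⟨y0z, y001, y002, y003, y012, y013, y023⟩ :=
    split7 ((Y0_U hD a0 a1 a2 a3 b0 b1 b2 b3).symm.trans (hS.2 0 {0}ᶜ (by decide)))
  obtain ⟨y1z, y101, y102, y103, y112, y113, y123⟩ :=
    split7 ((Y1_U hD a0 a1 a2 a3 b0 b1 b2 b3).symm.trans (hS.2 0 {1}ᶜ (by decide)))
  obtain ⟨y2z, y201, y202, y203, y212, y213, y223⟩ :=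
    split7 ((Y2_U hD a0 a1 a2 a3 b0 b1 b2 b3).symm.trans (hS.2 0 {2}ᶜ (by decide)))
  obtain ⟨y3z, y301, y302, y303, y312, y313, y323⟩ :=
    split7 ((Y3_U hD a0 a1 a2 a3 b0 b1 b2 b3).symm.trans (hS.2 0 {3}ᶜ (by decide)))
  obtain ⟨-, -, -, -, e10, -, -, e13⟩ :=
    split8 ((e1_U hD a0 a1 a2 a3 b0 b1 b2 b3).symm.trans hW.1)
  simp only [ht, hc] at *
  -- action of `𝔰𝔬(4)` on the `b`'s
  have x12b0 : D.ρξ 1 2 b0 = (-c) • b3 := by linear_combination (norm := module) -y012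
  have x13b0 : D.ρξ 1 3 b0 = (-c) • b2 := by linear_combination (norm := module) -y013
  have x23b0 : D.ρξ 2 3 b0 = (-c) • b1 := by linear_combination (norm := module) -y023
  have x23b1 : D.ρξ 2 3 b1 = c • b0 := by linear_combination (norm := module) -y123
  have x02b1 : D.ρξ 0 2 b1 = (-c) • b3 := by linear_combination (norm := module) -y102
  have x03b1 : D.ρξ 0 3 b1 = (-c) • b2 := by linear_combination (norm := module) -y103
  have x13b2 : D.ρξ 1 3 b2 = c • b0 := by linear_combination (norm := module) -y213
  have x03b2 : D.ρξ 0 3 b2 = c • b1 := by linear_combination (norm := module) -y203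
  have x01b2 : D.ρξ 0 1 b2 = (-c) • b3 := by linear_combination (norm := module) -y201
  have x12b3 : D.ρξ 1 2 b3 = c • b0 := by linear_combination (norm := module) -y312
  have x02b3 : D.ρξ 0 2 b3 = c • b1 := by linear_combination (norm := module) -y302
  have x01b3 : D.ρξ 0 1 b3 = c • b2 := by linear_combination (norm := module) -y301
  have x03b0 : D.ρξ 0 3 b0 = (2 - τ) • b3 := by linear_combination (norm := module) -t012
  have x02b0 : D.ρξ 0 2 b0 = (τ - 2) • b2 := by linear_combination (norm := module) t013
  have x01b0 : D.ρξ 0 1 b0 = (2 - τ) • b1 := by linear_combination (norm := module) -t023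
  have x01b1 : D.ρξ 0 1 b1 = (τ - 2) • b0 := by linear_combination (norm := module) t123
  have x02b2 : D.ρξ 0 2 b2 = (2 - τ) • b0 := by linear_combination (norm := module) t213
  have x03b3 : D.ρξ 0 3 b3 = (τ - 2) • b0 := by linear_combination (norm := module) t312
  have x13b1 : D.ρξ 1 3 b1 = (τ - 2) • b3 := by linear_combination (norm := module) -t102
  have x12b1 : D.ρξ 1 2 b1 = (2 - τ) • b2 := by linear_combination (norm := module) t103
  have x12b2 : D.ρξ 1 2 b2 = (τ - 2) • b1 := by linear_combination (norm := module) -t203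
  have x23b2 : D.ρξ 2 3 b2 = (2 - τ) • b3 := by linear_combination (norm := module) -t201
  have x23b3 : D.ρξ 2 3 b3 = (τ - 2) • b2 := by linear_combination (norm := module) t301
  have x13b3 : D.ρξ 1 3 b3 = (2 - τ) • b1 := by linear_combination (norm := module) -t302
  simp only [x12b0, x13b0, x23b0, x23b1, x02b1, x03b1, x13b2, x03b2, x01b2, x12b3, x02b3, x01b3,
    x03b0, x02b0, x01b0, x01b1, x02b2, x03b3, x13b1, x12b1, x12b2, x23b2, x23b3, x13b3]
    at t101 t001 t002 t003 y001 y101 y002 y003 e10 e13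
  have a0e : a0 = (-2 * c) • b0 := by linear_combination (norm := module) -t101
  have a1e : a1 = (2 * c) • b1 := by linear_combination (norm := module) t001
  have a2e : a2 = (-2 * c) • b2 := by linear_combination (norm := module) t002
  have a3e : a3 = (2 * c) • b3 := by linear_combination (norm := module) t003
  clear t0z t1z t2z t3z t001 t002 t003 t101
  rw [a0e, a1e, a2e, a3e] at y0z y1z y2z y3z
  simp only [map_smul, x12b0, x13b0, x23b0, x23b1, x02b1, x03b1, x13b2, x03b2, x01b2, x12b3,
    x02b3, x01b3] at y0z y1z y2z y3z
  have hb : ∀ k : ℂ, k • b0 = 0 → k • b1 = 0 → k • b2 = 0 → k • b3 = 0 → k = 0 := by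
    intro k k0 k1 k2 k3
    by_contra hk
    have z0 := (smul_eq_zero.1 k0).resolve_left hk
    have z1 := (smul_eq_zero.1 k1).resolve_left hk
    have z2 := (smul_eq_zero.1 k2).resolve_left hk
    have z3 := (smul_eq_zero.1 k3).resolve_left hk
    apply hS.1
    rw [a0e, a1e, a2e, a3e, z0, z1, z2, z3]
    simp [U, bv_zero]
  have hτ : 2 * τ - 5 = 0 := by
    apply hb
    · linear_combination (norm := module) y101
    · linear_combination (norm := module) -y001
    · linear_combination (norm := module) y002
    · linear_combination (norm := module) -y003
  have hcc : 1 - 4 * c * c = 0 := by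
    apply hb
    · linear_combination (norm := module) y0z
    · linear_combination (norm := module) y1z
    · linear_combination (norm := module) y2z
    · linear_combination (norm := module) y3z
  have hτ' : τ = 5 / 2 := by linear_combination hτ / 2
  have hs : (-2 * c) * (-2 * c) = 1 := by linear_combination -hcc
  have hcs : c = -((-2 * c) / 2) := by ring
  generalize -2 * c = s at *
  subst hcs hτ'
  have hs0 : s ≠ 0 := by rintro rfl; simp at hs
  have b1e : b1 = Complex.I • b0 := by
    linear_combination (norm := (match_scalars <;> grind)) (2 * s) • e13
  have b3e : b3 = (Complex.I * s) • b2 := by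
    linear_combination (norm := (match_scalars <;> grind)) (-2 * Complex.I * s) • e10
  subst b1e b3e
  refine ⟨s, hs, rfl, rfl, ?_, ?_⟩
  · refine ⟨?_, ?_, ?_, ?_, ?_, ?_, ?_, ?_, ?_, ?_, ?_, ?_⟩ <;>
    simp only [x12b0, x13b0, x23b0, x13b2, x03b2, x01b2,
      x03b0, x02b0, x01b0, x02b2, x12b2, x23b2] <;> match_scalars <;> grind
  · rw [a0e, a1e, a2e, a3e, V]
    congr 1 <;> match_scalars <;> grind

end K4

namespace K4

variable {F : Type*} [AddCommGroup F] [Module ℂ F]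

lemma xi_self {D : VermaData F} (hD : IsVerma D) (i : Fin 4) (v : F) : D.ρξ i i v = 0 := by
  have h2 := Xs_vac hD i i v
  apply bv_inj (k := 0) (L := ∅); rw [← h2, bv_zero]; simp [Xs]

lemma twoMod_hw {D : VermaData F} (hD : IsVerma D) (hirr : IsIrred D) {τ c : ℂ}
    (ht : ∀ v, D.ρt v = τ • v) (hc : ∀ v, D.ρC v = c • v) {s : ℂ} {p q : F}
    (h : TwoMod D s p q) (hp : p ≠ 0) {v : F} (e1 : e1F D v = 0) :
    ∃ β : ℂ, v = β • p := by
  have hI : Complex.I * Complex.I = -1 := Complex.I_mul_I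
  have key : ∀ i j, i < j → ∀ w ∈ Submodule.span ℂ {p, q}, D.ρξ i j w ∈ Submodule.span ℂ {p, q} := by
    intro i j hij w hw
    obtain ⟨a, b, rfl⟩ := Submodule.mem_span_pair.1 hw
    rw [Submodule.mem_span_pair]
    have gp : ∀ k : ℂ, ∃ a b : ℂ, a • p + b • q = k • p := fun k => ⟨k, 0, by simp⟩
    have gq : ∀ k : ℂ, ∃ a b : ℂ, a • p + b • q = k • q := fun k => ⟨0, k, by simp⟩
    have hcases : (i = 0 ∧ j = 1) ∨
        (i = 0 ∧ j = 2) ∨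
        (i = 0 ∧ j = 3) ∨
        (i = 1 ∧ j = 2) ∨
        (i = 1 ∧ j = 3) ∨
        (i = 2 ∧ j = 3) := by
      clear hw; revert i j; decide
    have hP : ∃ a b : ℂ, a • p + b • q = D.ρξ i j p := by
      rcases hcases with ⟨rfl, rfl⟩ | ⟨rfl, rfl⟩ | ⟨rfl, rfl⟩ | ⟨rfl, rfl⟩ | ⟨rfl, rfl⟩ | ⟨rfl, rfl⟩
      · rw [h.p01]; exact gp _
      · rw [h.p02]; exact gq _
      · rw [h.p03]; exact gq _
      · rw [h.p12]; exact gq _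
      · rw [h.p13]; exact gq _
      · rw [h.p23]; exact gp _
    have hQ : ∃ a b : ℂ, a • p + b • q = D.ρξ i j q := by
      rcases hcases with ⟨rfl, rfl⟩ | ⟨rfl, rfl⟩ | ⟨rfl, rfl⟩ | ⟨rfl, rfl⟩ | ⟨rfl, rfl⟩ | ⟨rfl, rfl⟩
      · rw [h.q01]; exact gq _
      · rw [h.q02]; exact gp _
      · rw [h.q03]; exact gp _
      · rw [h.q12]; exact gp _
      · rw [h.q13]; exact gp _
      · rw [h.q23]; exact gq _
    obtain ⟨a1, b1, h1⟩ := hP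
    obtain ⟨a2, b2, h2⟩ := hQ
    refine ⟨a * a1 + b * a2, a * b1 + b * b2, ?_⟩
    rw [map_add, map_smul, map_smul, ← h1, ← h2]
    module
  have htop := hirr.2 (Submodule.span ℂ {p, q}) (by
    intro w hw
    refine ⟨?_, ?_, ?_⟩
    · rw [ht]; exact Submodule.smul_mem _ _ hw
    · rw [hc]; exact Submodule.smul_mem _ _ hw
    · intro i j
      rcases lt_trichotomy i j with hij | hij | hij
      · exact key i j hij w hw
      · subst hij; rw [xi_self hD]; exact Submodule.zero_mem _
      · rw [hD.anti i j, LinearMap.neg_apply]; exact Submodule.neg_mem _ (key j i hij w hw))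
  have htop' : Submodule.span ℂ {p, q} = ⊤ := by
    refine htop.resolve_left fun hb => hp ?_
    have : p ∈ Submodule.span ℂ {p, q} := Submodule.subset_span (by simp)
    rwa [hb, Submodule.mem_bot] at this
  have hv : v ∈ Submodule.span ℂ {p, q} := by rw [htop']; trivial
  obtain ⟨β, α, rfl⟩ := Submodule.mem_span_pair.1 hv
  have hα : α • p = 0 := by
    simp only [e1F, LinearMap.add_apply, LinearMap.neg_apply, LinearMap.smul_apply, map_add,
      map_smul, h.p02, h.q02, h.p12, h.q12] at e1
    linear_combination (norm := (match_scalars <;> grind)) -e1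
  rw [(smul_eq_zero.1 hα).resolve_right hp]
  exact ⟨β, by simp⟩

lemma twoMod_ops {D : VermaData F} {s : ℂ} {p q : F} (h : TwoMod D s p q) (hs : s * s = 1) :
    hxF D p = (1 / 2 + s / 2) • p ∧ hyF D p = (1 / 2 - s / 2) • p ∧ fS D s p = -q := by
  have hI : Complex.I * Complex.I = -1 := Complex.I_mul_I
  simp only [hxF, hyF, fS, LinearMap.add_apply, LinearMap.sub_apply, LinearMap.neg_apply,
    LinearMap.smul_apply, h.p01, h.p23, h.p02, h.p13, h.p03, h.p12]
  refine ⟨?_, ?_, ?_⟩ <;> match_scalars <;> grind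

lemma fS_one (D : VermaData F) : fS D 1 = fxF D := by
  simp [fS, fxF]

lemma fS_neg_one (D : VermaData F) : fS D (-1) = fyF D := by
  simp [fS, fyF, sub_eq_add_neg]

lemma hS_one (D : VermaData F) : hS D 1 = hxF D := by
  simp [hS, hxF]

lemma hS_neg_one (D : VermaData F) : hS D (-1) = hyF D := by
  simp [hS, hyF, sub_eq_add_neg]

lemma forward_main {D : VermaData F} (hD : IsVerma D) (hirr : IsIrred D)
    {wa wb wt wc : ℂ} {v : F} (hμ : IsHWvec D (wa, wb, wt, wc) v) {u : VInd F}
    (h1 : IsSingular D u) (h2 : HomogDeg u 3) (h3 : IsHW D u) :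
    ∃ s γ : ℂ, s * s = 1 ∧ γ ≠ 0 ∧ wa = 1 / 2 + s / 2 ∧ wb = 1 / 2 - s / 2 ∧ wt = 5 / 2 ∧
      wc = -(s / 2) ∧ u = V s (γ • v) (-(γ • fS D s v)) := by
  obtain ⟨v0, e1, e2, hx, hy, ht, hc⟩ := hμ
  simp only at hx hy ht hc
  have ht := t_scalar hD hirr v0 ht
  have hc := C_scalar hD hirr v0 hc
  rw [homog_eq_U h2] at h1 h3
  obtain ⟨s, hs, hτ, hcs, hT, hV⟩ := forward_core hD ht hc h1 h3
  have hu := (homog_eq_U h2).trans hV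
  rw [← homog_eq_U h2] at h1
  generalize u (0, {0, 1, 3}) = p at *
  generalize u (0, {1, 2, 3}) = q at *
  have hp : p ≠ 0 := by
    rintro rfl
    have hq : q = 0 := by
      have := hT.p02
      simpa using this
    apply h1.1
    rw [hu, hq]
    simp [V, U, bv_zero]
  obtain ⟨β, rfl⟩ := twoMod_hw hD hirr ht hc hT hp e1
  obtain ⟨ox, oy, of⟩ := twoMod_ops hT hs
  have hβ : β ≠ 0 := by rintro rfl; simp at v0
  refine ⟨s, β⁻¹, hs, inv_ne_zero hβ, ?_, ?_, hτ, hcs, ?_⟩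
  · rw [map_smul, ox, smul_comm] at hx
    exact (smul_left_injective ℂ v0 hx).symm
  · rw [map_smul, oy, smul_comm] at hy
    exact (smul_left_injective ℂ v0 hy).symm
  · rw [hu, map_smul, of]
    simp [smul_smul, hβ]

end K4

/-- **Classification of singular vectors of degree 3** (Theorem `sing3`).
Let `F` be an irreducible finite-dimensional `𝔤₀`-module with highest weight
`μ = (wa, wb, wt, wc)` and highest weight vector `vμ` (in the polynomial realization
`vμ = x₁` resp. `y₁`, and `fxF D vμ = x₂`, resp. `fyF D vμ = y₂`).
A vector `u ∈ Ind F` is a nontrivial highest weight singular vector of degree 3 if and only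
if, up to a scalar, it is one of:
* (a) `μ = (1, 0, 5/2, -1/2)` and `u = w₁₁w₂₂w₂₁ ⊗ x₁ + w₂₁w₁₂w₁₁ ⊗ x₂`;
* (b) `μ = (0, 1, 5/2, 1/2)` and `u = w₁₁w₂₂w₁₂ ⊗ y₁ + w₁₂w₂₁w₁₁ ⊗ y₂`. -/
theorem degree_three_singular_vectors
    (F : Type*) [AddCommGroup F] [Module ℂ F] [FiniteDimensional ℂ F]
    (D : VermaData F) (hD : IsVerma D) (hirr : IsIrred D)
    (wa wb wt wc : ℂ) (vμ : F) (hμ : IsHWvec D (wa, wb, wt, wc) vμ)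
    (u : VInd F) :
    (IsSingular D u ∧ HomogDeg u 3 ∧ IsHW D u) ↔
      ∃ c : ℂ, c ≠ 0 ∧
        ((wa = 1 ∧ wb = 0 ∧ wt = 5 / 2 ∧ wc = -(1 / 2) ∧
            u = c • (tens (cmul (cmul w11 w22) w21) vμ
                  + tens (cmul (cmul w21 w12) w11) (fxF D vμ))) ∨
         (wa = 0 ∧ wb = 1 ∧ wt = 5 / 2 ∧ wc = 1 / 2 ∧
            u = c • (tens (cmul (cmul w11 w22) w12) vμ
                  + tens (cmul (cmul w12 w21) w11) (fyF D vμ)))) := by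
  have hI : Complex.I * Complex.I = -1 := Complex.I_mul_I
  have hI0 : Complex.I ≠ 0 := Complex.I_ne_zero
  constructor
  · rintro ⟨h1, h2, h3⟩
    obtain ⟨s, γ, hs, hγ, ha, hb, ht, hc, hu⟩ := K4.forward_main hD hirr hμ h1 h2 h3
    rcases mul_self_eq_one_iff.1 hs with rfl | rfl
    · refine ⟨γ * (2 * Complex.I)⁻¹, by simp [hγ], Or.inl ⟨?_, ?_, ht, ?_, ?_⟩⟩
      · rw [ha]; norm_num
      · rw [hb]; norm_num
      · rw [hc]
      · rw [K4.tensA, K4.V_smul, hu, K4.fS_one]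
        congr 1 <;> match_scalars <;> field_simp
    · refine ⟨γ * (-(2 * Complex.I))⁻¹, by simp [hγ], Or.inr ⟨?_, ?_, ht, ?_, ?_⟩⟩
      · rw [ha]; norm_num
      · rw [hb]; norm_num
      · rw [hc]; norm_num
      · rw [K4.tensB, K4.V_smul, hu, K4.fS_neg_one]
        congr 1 <;> match_scalars <;> field_simp
  · obtain ⟨v0, e1, e2, hx, hy, ht, hc⟩ := hμ
    simp only at hx hy ht hc
    have ht := K4.t_scalar hD hirr v0 ht
    have hc := K4.C_scalar hD hirr v0 hc
    have scale : ∀ (s k : ℂ) (p q : F), K4.TwoMod D s p q → K4.TwoMod D s (k • p) (k • q) := by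
      intro s k p q h
      constructor <;> rw [map_smul]
      · rw [h.q01, smul_comm]
      · rw [h.p01, smul_comm]
      · rw [h.q02, smul_comm]
      · rw [h.p02, smul_comm]
      · rw [h.q03, smul_comm]
      · rw [h.p03, smul_comm]
      · rw [h.q12, smul_comm]
      · rw [h.p12, smul_comm]
      · rw [h.q13, smul_comm]
      · rw [h.p13, smul_comm]
      · rw [h.q23, smul_comm]
      · rw [h.p23, smul_comm]
    rintro ⟨c, hc0, ⟨rfl, rfl, rfl, rfl, rfl⟩ | ⟨rfl, rfl, rfl, rfl, rfl⟩⟩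
    · have hT := K4.twoMod_of hD (s := 1) (by norm_num) v0 e1 e2
        (by rw [K4.hS_one, hx, one_smul]) (by rw [K4.hS_neg_one, hy, zero_smul])
      rw [K4.fS_one] at hT
      have hT := scale _ (c * (2 * Complex.I)) _ _ hT
      have hE : c • (tens (cmul (cmul w11 w22) w21) vμ
          + tens (cmul (cmul w21 w12) w11) (fxF D vμ)) =
          K4.V 1 ((c * (2 * Complex.I)) • vμ) ((c * (2 * Complex.I)) • -(fxF D vμ)) := by
        rw [K4.tensA, K4.V_smul]
        congr 1 <;> module
      rw [hE]
      refine K4.V_singular hD (by norm_num) hT ?_ (ht _) (ht _) (hc _) (hc _)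
      simp [hc0, v0]
    · have hT := K4.twoMod_of hD (s := -1) (by norm_num) v0 e1 e2
        (by rw [K4.hS_neg_one, hy, one_smul]) (by rw [neg_neg, K4.hS_one, hx, zero_smul])
      rw [K4.fS_neg_one] at hT
      have hT := scale _ (c * (-(2 * Complex.I))) _ _ hT
      have hE : c • (tens (cmul (cmul w11 w22) w12) vμ
          + tens (cmul (cmul w12 w21) w11) (fyF D vμ)) =
          K4.V (-1) ((c * (-(2 * Complex.I))) • vμ) ((c * (-(2 * Complex.I))) • -(fyF D vμ)) := by
        rw [K4.tensB, K4.V_smul]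
        congr 1 <;> module
      rw [hE]
      have hcc : ∀ v, D.ρC v = (-((-1 : ℂ) / 2)) • v := by
        intro v; rw [hc]; congr 1; norm_num
      refine K4.V_singular hD (by norm_num) hT ?_ (ht _) (ht _) (hcc _) (hcc _)
      simp [hc0, v0]
end

section
/- The Verma module M(0,0,2,0) over A(K'_4) is irreducible, and it is isomorphic to the coadjoint representation of K(1,4)_+ on its restricted dual K(1,4)_+^* = ⊕_{j∈ℤ}((K(1,4)_+)_j)^*, where (x.f)(y) = −(−1)^{p(x)p(f)} f([x,y]); in particular the restricted dual K(1,4)_+^* is an irreducible K(1,4)_+-module. -/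
/-!
Core definitions modelling the annihilation superalgebra `𝔤 = 𝒜(K'₄) = K(1,4)₊ ⊕ ℂC`
and generalized Verma modules `Ind F ≅ ℂ[Θ] ⊗ Λ(η₁,…,η₄) ⊗ F` over it.

Grassmann monomials `ξ_I`/`η_I` (with `I` in increasing order) are indexed by
`Idx = Finset (Fin 4)`.
-/

open Finset

noncomputable section
open Finset

/-! ### The restricted dual of `K(1,4)₊` and its coadjoint action -/

/-- `K(1,4)₊ = ℂ[t] ⊗ Λ(4)`, with basis `t^m ξ_I`.  Its restricted dual
`K(1,4)₊* = ⊕ⱼ ((K(1,4)₊)ⱼ)*` is spanned by the dual basis `(t^m ξ_I)*` and is therefore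
encoded by the same type. -/
abbrev Kp : Type := (ℕ × Idx) →₀ ℂ

/-- The basis monomial `t^m ξ_I` of `K(1,4)₊` (or the dual basis vector `(t^m ξ_I)*` of
the restricted dual). -/
def bp (m : ℕ) (I : Idx) : Kp := Finsupp.single (m, I) 1

/-- `t^m ξ_I ξ_J` in `K(1,4)₊`. -/
def xiMulp (m : ℕ) (I J : Idx) : Kp :=
  if Disjoint I J then ((msign I J : ℤ) : ℂ) • bp m (I ∪ J) else 0

/-- `t^m ∑ᵢ ∂ᵢξ_I ∂ᵢξ_J` in `K(1,4)₊`. -/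
def ddp (m : ℕ) (I J : Idx) : Kp :=
  ∑ i : Fin 4,
    if i ∈ I ∧ i ∈ J then
      ((dsign i I * dsign i J : ℤ) : ℂ) • xiMulp m (I.erase i) (J.erase i)
    else 0

/-- The contact bracket `[t^m ξ_I, t^n ξ_J]` of `K(1,4)₊`:
`(2n-2m-n|I|+m|J|) t^{m+n-1} ξ_{IJ} + (-1)^{|I|} t^{m+n} ∑ᵢ ∂ᵢξ_I ∂ᵢξ_J`. -/
def kbrkp (m : ℕ) (I : Idx) (n : ℕ) (J : Idx) : Kp :=
  ((2 * (n : ℤ) - 2 * (m : ℤ) - (n : ℤ) * (I.card : ℤ) + (m : ℤ) * (J.card : ℤ) : ℤ) : ℂ) •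
      xiMulp (m + n - 1) I J
  + ((-1 : ℂ) ^ I.card) • ddp (m + n) I J

/-- Sign coefficient of `ξ_I ξ_J`, zero unless disjoint. -/
def pp (I J : Idx) : ℤ := if Disjoint I J then msign I J else 0

/-- Sign coefficient of `∑ᵢ ∂ᵢξ_I ∂ᵢξ_J`. -/
def qq (I J : Idx) : ℤ := ∑ i : Fin 4,
  if i ∈ I ∧ i ∈ J ∧ Disjoint (I.erase i) (J.erase i) then
    dsign i I * dsign i J * msign (I.erase i) (J.erase i) else 0

/-- Parity sign of an index set. -/
def par (I : Idx) : ℤ := (-1) ^ I.card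

/-- Koszul sign. -/
def sg (I J : Idx) : ℤ := (-1) ^ (I.card * J.card)

/-! Bit-mask versions of the sign functions, for fast kernel evaluation. -/

/-- Bit mask of an index set. -/
def code (I : Idx) : ℕ := ∑ i ∈ I, 2 ^ (i : ℕ)

/-- Parity of the number of binary digits one of `x < 16`. -/
def pb (x : ℕ) : ℕ := (27030 >>> x) % 2

/-- Sign attached to a parity. -/
def sb (x : ℕ) : ℤ := bif Nat.beq (x % 2) 0 then 1 else -1

/-- Number of inversions modulo two. -/
def inv2 (a b : ℕ) : ℕ := pb ((a >>> 1) &&& b) + pb ((a >>> 2) &&& b) + pb ((a >>> 3) &&& b)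

/-- Bit mask version of `pp`. -/
def ppN (a b : ℕ) : ℤ := bif Nat.beq (a &&& b) 0 then sb (inv2 a b) else 0

/-- Auxiliary function for the bit mask version of `qq`. -/
def qqAux (a b x : ℕ) : ℤ :=
  bif Nat.beq x 0 then 0 else bif Nat.beq (x &&& (x - 1)) 0 then
    sb (pb ((x - 1) &&& a) + pb ((x - 1) &&& b) + inv2 (a ^^^ x) (b ^^^ x)) else 0

/-- Bit mask version of `qq`. -/
def qqN (a b : ℕ) : ℤ := qqAux a b (a &&& b)

/-- Bit mask version of the cardinality. -/
def cdN (a : ℕ) : ℤ := Int.ofNat (a % 2 + (a >>> 1) % 2 + (a >>> 2) % 2 + (a >>> 3) % 2)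

/-- Bit mask version of `par`. -/
def parN (a : ℕ) : ℤ := sb (pb a)

lemma pp_code : ∀ I J : Idx, pp I J = ppN (code I) (code J) := by decide +kernel
lemma qq_code : ∀ I J : Idx, qq I J = qqN (code I) (code J) := by decide +kernel
lemma code_sd : ∀ I J : Idx, code (symmDiff I J) = (code I) ^^^ (code J) := by decide +kernel
lemma code_lt : ∀ I : Idx, code I < 16 := by decide +kernel
lemma card_code : ∀ I : Idx, (I.card : ℤ) = cdN (code I) := by decide +kernel
lemma par_code : ∀ I : Idx, par I = parN (code I) := by decide +kernel

lemma jac_aN : ∀ i < 4, ∀ a < 16, ∀ b < 16,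
    (ppN (2 ^ i) b * ppN a ((2 ^ i) ^^^ b) = ppN a (2 ^ i) * ppN (a ^^^ 2 ^ i) b ∧
     ppN (2 ^ i) b * ppN a ((2 ^ i) ^^^ b) = parN a * (ppN (2 ^ i) (a ^^^ b) * ppN a b)) := by
  decide +kernel

lemma jac_bnN : ∀ i < 4, ∀ a < 16, ∀ b < 16,
    ppN (2 ^ i) b * (parN a * qqN a ((2 ^ i) ^^^ b)) -
      qqN (2 ^ i) b * (2 - cdN a) * ppN a ((2 ^ i) ^^^ b) =
    parN a * qqN a (2 ^ i) * (2 - cdN (a ^^^ 2 ^ i)) * ppN (a ^^^ 2 ^ i) b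
    + parN a * (ppN (2 ^ i) (a ^^^ b) * (parN a * qqN a b)
       - qqN (2 ^ i) (a ^^^ b) * (2 - cdN a) * ppN a b) := by
  decide +kernel

lemma jac_bmN : ∀ i < 4, ∀ a < 16, ∀ b < 16,
    - qqN (2 ^ i) b * (- 2 + cdN ((2 ^ i) ^^^ b)) * ppN a ((2 ^ i) ^^^ b) =
    - (ppN a (2 ^ i) * (parN (a ^^^ 2 ^ i) * qqN (a ^^^ 2 ^ i) b))
    + parN a * qqN a (2 ^ i) * (- 2 + cdN b) * ppN (a ^^^ 2 ^ i) b
    + parN a * (ppN (2 ^ i) (a ^^^ b) * (parN a * qqN a b)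
       - qqN (2 ^ i) (a ^^^ b) * (- 2 + cdN b) * ppN a b) := by
  decide +kernel

lemma jac_eN : ∀ i < 4, ∀ a < 16, ∀ b < 16,
    - qqN (2 ^ i) b * (parN a * qqN a ((2 ^ i) ^^^ b)) =
    parN a * qqN a (2 ^ i) * (parN (a ^^^ 2 ^ i) * qqN (a ^^^ 2 ^ i) b)
    - parN a * (qqN (2 ^ i) (a ^^^ b) * (parN a * qqN a b)) := by
  decide +kernel

lemma code_single : ∀ i : Fin 4, code {i} = 2 ^ (i : ℕ) := by decide +kernel

lemma jac_a1 (i : Fin 4) (I J : Idx) :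
    pp {i} J * pp I (symmDiff {i} J) = pp I {i} * pp (symmDiff I {i}) J := by
  simp only [pp_code, code_sd, code_single]
  exact (jac_aN _ i.2 _ (code_lt _) _ (code_lt _)).1

lemma jac_a2 (i : Fin 4) (I J : Idx) :
     pp {i} J * pp I (symmDiff {i} J) = par I * (pp {i} (symmDiff I J) * pp I J) := by
  simp only [pp_code, code_sd, par_code, code_single]
  exact (jac_aN _ i.2 _ (code_lt _) _ (code_lt _)).2

lemma pp_card : ∀ (I J : Idx), pp I J = 0 ∨ (symmDiff I J).card = I.card + J.card := by
  decide +kernel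

lemma qq_card : ∀ (I J : Idx), qq I J = 0 ∨ (symmDiff I J).card + 2 = I.card + J.card := by
  decide +kernel

lemma jac_bn (i : Fin 4) (I J : Idx) :
    pp {i} J * (par I * qq I (symmDiff {i} J)) -
      qq {i} J * (2 - (I.card : ℤ)) * pp I (symmDiff {i} J) =
    par I * qq I {i} * (2 - ((symmDiff I {i}).card : ℤ)) * pp (symmDiff I {i}) J
    + par I * (pp {i} (symmDiff I J) * (par I * qq I J)
       - qq {i} (symmDiff I J) * (2 - (I.card : ℤ)) * pp I J) := by
  simp only [pp_code, qq_code, code_sd, par_code, card_code, code_single]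
  exact jac_bnN _ i.2 _ (code_lt _) _ (code_lt _)

lemma jac_bm (i : Fin 4) (I J : Idx) :
    - qq {i} J * (- 2 + ((symmDiff {i} J).card : ℤ)) * pp I (symmDiff {i} J) =
    - (pp I {i} * (par (symmDiff I {i}) * qq (symmDiff I {i}) J))
    + par I * qq I {i} * (- 2 + (J.card : ℤ)) * pp (symmDiff I {i}) J
    + par I * (pp {i} (symmDiff I J) * (par I * qq I J)
       - qq {i} (symmDiff I J) * (- 2 + (J.card : ℤ)) * pp I J) := by
  simp only [pp_code, qq_code, code_sd, par_code, card_code, code_single]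
  exact jac_bmN _ i.2 _ (code_lt _) _ (code_lt _)

lemma jac_e (i : Fin 4) (I J : Idx) :
    - qq {i} J * (par I * qq I (symmDiff {i} J)) =
    par I * qq I {i} * (par (symmDiff I {i}) * qq (symmDiff I {i}) J)
    - par I * (qq {i} (symmDiff I J) * (par I * qq I J)) := by
  simp only [qq_code, code_sd, par_code, code_single]
  exact jac_eN _ i.2 _ (code_lt _) _ (code_lt _)

/-- The coefficient `2n-2m-n|I|+m|J|`. -/
def lin (m : ℕ) (I : Idx) (n : ℕ) (J : Idx) : ℤ :=
  2 * (n : ℤ) - 2 * (m : ℤ) - (n : ℤ) * (I.card : ℤ) + (m : ℤ) * (J.card : ℤ)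

lemma union_eq_sd {I J : Idx} (h : Disjoint I J) : I ∪ J = symmDiff I J := by
  simpa using h.symmDiff_eq_sup.symm

lemma erase_union_eq_sd : ∀ (i : Fin 4) (I J : Idx),
    (i ∈ I ∧ i ∈ J ∧ Disjoint (I.erase i) (J.erase i)) →
    I.erase i ∪ J.erase i = symmDiff I J := by
  decide +kernel

lemma xiMulp_eq (m : ℕ) (I J : Idx) :
    xiMulp m I J = ((pp I J : ℤ) : ℂ) • bp m (symmDiff I J) := by
  unfold xiMulp pp
  split_ifs with h
  · rw [union_eq_sd h]
  · simp

lemma ddp_eq (m : ℕ) (I J : Idx) :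
    ddp m I J = ((qq I J : ℤ) : ℂ) • bp m (symmDiff I J) := by
  unfold ddp qq
  rw [Int.cast_sum, Finset.sum_smul]
  refine Finset.sum_congr rfl fun i _ => ?_
  by_cases h : i ∈ I ∧ i ∈ J ∧ Disjoint (I.erase i) (J.erase i)
  · rw [if_pos h, if_pos ⟨h.1, h.2.1⟩, xiMulp, if_pos h.2.2, erase_union_eq_sd i I J h, smul_smul]
    push_cast
    rfl
  · rw [if_neg h]
    split_ifs with h2
    · rw [xiMulp, if_neg (fun h3 => h ⟨h2.1, h2.2, h3⟩)]
      simp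
    · simp

lemma kbrkp_eq (m : ℕ) (I : Idx) (n : ℕ) (J : Idx) :
    kbrkp m I n J = ((lin m I n J * pp I J : ℤ) : ℂ) • bp (m + n - 1) (symmDiff I J)
      + ((par I * qq I J : ℤ) : ℂ) • bp (m + n) (symmDiff I J) := by
  unfold kbrkp
  rw [xiMulp_eq, ddp_eq, smul_smul, smul_smul]
  unfold lin par
  push_cast
  rfl

lemma brkAct_eq (act : ℕ → Idx → (VInd ℂ →ₗ[ℂ] VInd ℂ))
    (m : ℕ) (I : Idx) (n : ℕ) (J : Idx) :
    brkAct 0 act m I n J = ((lin m I n J * pp I J : ℤ) : ℂ) • act (m + n - 1) (symmDiff I J)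
      + ((par I * qq I J : ℤ) : ℂ) • act (m + n) (symmDiff I J) := by
  have hC : Cop (0 : ℂ →ₗ[ℂ] ℂ) = 0 := by
    ext; simp [Cop]
  unfold brkAct
  rw [hC, smul_zero, add_zero]
  congr 1
  · unfold lin pp
    split_ifs with h
    · rw [union_eq_sd h, smul_smul]
      push_cast
      rfl
    · simp
  · rw [Int.cast_mul, mul_smul]
    unfold par qq
    push_cast
    rw [Finset.sum_smul]
    congr 1
    refine Finset.sum_congr rfl fun i _ => ?_
    by_cases h : i ∈ I ∧ i ∈ J ∧ Disjoint (I.erase i) (J.erase i)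
    · rw [if_pos h, if_pos h, erase_union_eq_sd i I J h]
    · rw [if_neg h, if_neg h, zero_smul]

/-- The hypothesis on the coadjoint action. -/
def IsCoad (coad : ℕ → Idx → (Kp →ₗ[ℂ] Kp)) : Prop :=
  ∀ (m : ℕ) (I : Idx) (s : ℕ) (K : Idx) (n : ℕ) (J : Idx),
      (coad m I (bp s K)) (n, J) = -((-1 : ℂ) ^ (I.card * K.card)) * (kbrkp m I n J) (s, K)

lemma bp_apply (m : ℕ) (I : Idx) (s : ℕ) (K : Idx) :
    bp m I (s, K) = if m = s ∧ I = K then 1 else 0 := by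
  simp [bp, Finsupp.single_apply]

lemma coad_apply {coad : ℕ → Idx → (Kp →ₗ[ℂ] Kp)} (h : IsCoad coad)
    (m : ℕ) (I : Idx) (f : Kp) (n : ℕ) (J : Idx) :
    (coad m I f) (n, J) = -((sg I (symmDiff I J) : ℤ) : ℂ) *
      ((lin m I n J * pp I J : ℤ) * f (m + n - 1, symmDiff I J)
        + (par I * qq I J : ℤ) * f (m + n, symmDiff I J)) := by
  induction f using Finsupp.induction_linear with
  | zero => simp
  | add f g hf hg => rw [map_add, Finsupp.add_apply, hf, hg, Finsupp.add_apply, Finsupp.add_apply]; ring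
  | single p c =>
    obtain ⟨s, K⟩ := p
    have : (Finsupp.single (s, K) c : Kp) = c • bp s K := by simp [bp]
    rw [this, map_smul, Finsupp.smul_apply, h, kbrkp_eq]
    simp only [Finsupp.add_apply, Finsupp.smul_apply, bp_apply, smul_eq_mul]
    by_cases hK : symmDiff I J = K
    · subst hK
      simp only [and_true, sg, eq_comm (a := s)]
      push_cast
      ring
    · simp [hK, Ne.symm hK]

lemma coad_eta {coad : ℕ → Idx → (Kp →ₗ[ℂ] Kp)} (h : IsCoad coad)
    (i : Fin 4) (f : Kp) (n : ℕ) (J : Idx) :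
    (coad 0 {i} f) (n, J) = ((par J : ℤ) : ℂ) *
      (n * (pp {i} J : ℤ) * f (n - 1, symmDiff {i} J)
        - (qq {i} J : ℤ) * f (n, symmDiff {i} J)) := by
  have h1 : ∀ (i : Fin 4) (J : Idx), sg {i} (symmDiff {i} J) = - par J := by decide +kernel
  have h2 : par {i} = -1 := by simp [par]
  rw [coad_apply h, h1, h2]
  simp only [lin, zero_add, card_singleton]
  push_cast
  ring

lemma sg1 : ∀ (i : Fin 4) (I J : Idx),
    sg I (symmDiff I (symmDiff {i} J)) = par I * sg I (symmDiff I J) := by decide +kernel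
lemma sg2 : ∀ (i : Fin 4) (I J : Idx),
    sg (symmDiff I {i}) (symmDiff I (symmDiff {i} J)) = - (par J * sg I (symmDiff I J)) := by
  decide +kernel
lemma par_sd : ∀ (I J : Idx), par (symmDiff I J) = par I * par J := by decide +kernel
lemma par_sq : ∀ (I : Idx), par I * par I = 1 := by decide +kernel

lemma coad_lie {coad : ℕ → Idx → (Kp →ₗ[ℂ] Kp)} (h : IsCoad coad)
    (m : ℕ) (I : Idx) (i : Fin 4) (f : Kp) :
    coad m I (coad 0 {i} f) = ((par I : ℤ) : ℂ) • coad 0 {i} (coad m I f)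
      + (((lin m I 0 {i} * pp I {i} : ℤ) : ℂ) • coad (m - 1) (symmDiff I {i}) f
      + ((par I * qq I {i} : ℤ) : ℂ) • coad m (symmDiff I {i}) f) := by
  ext ⟨n, J⟩
  simp only [Finsupp.add_apply, Finsupp.smul_apply, smul_eq_mul]
  have e1 : symmDiff {i} (symmDiff I J) = symmDiff I (symmDiff {i} J) := symmDiff_left_comm _ _ _
  have e2 : symmDiff (symmDiff I {i}) J = symmDiff I (symmDiff {i} J) := symmDiff_assoc _ _ _
  rw [coad_apply h m I, coad_eta h i (coad m I f), coad_eta h, coad_eta h, coad_apply h, coad_apply h,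
    coad_apply h, coad_apply h]
  have hpi : par {i} = -1 := by simp [par]
  have ha1 := congrArg (Int.cast : ℤ → ℂ) (jac_a1 i I J)
  have ha2 := congrArg (Int.cast : ℤ → ℂ) (jac_a2 i I J)
  have hbn := congrArg (Int.cast : ℤ → ℂ) (jac_bn i I J)
  have hbm := congrArg (Int.cast : ℤ → ℂ) (jac_bm i I J)
  have he := congrArg (Int.cast : ℤ → ℂ) (jac_e i I J)
  have hc1 : ((pp {i} J : ℤ) : ℂ) * (((symmDiff {i} J).card : ℂ) - (1 + (J.card : ℂ))) = 0 := by
    rcases pp_card {i} J with h | h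
    · simp [h]
    · simp [h]
  have hc2 : ((pp I {i} : ℤ) : ℂ) * (((symmDiff I {i}).card : ℂ) - ((I.card : ℂ) + 1)) = 0 := by
    rcases pp_card I {i} with h | h
    · simp [h]
    · simp [h]
  simp only [e1, e2, sg1, sg2, par_sd, hpi, lin, card_singleton] at ha1 ha2 hbn hbm he ⊢
  push_cast at ha1 ha2 hbn hbm he ⊢
  have hA : ((par I : ℤ) : ℂ) = 1 ∨ ((par I : ℤ) : ℂ) = -1 := by
    have := congrArg (Int.cast : ℤ → ℂ) (par_sq I)
    push_cast at this
    exact mul_self_eq_one_iff.1 this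
  generalize ((symmDiff {i} J).card : ℂ) = cJ at *
  generalize ((symmDiff I {i}).card : ℂ) = cI at *
  generalize (I.card : ℂ) = dI at *
  generalize (J.card : ℂ) = dJ at *
  generalize ((par I : ℤ) : ℂ) = A at *
  generalize ((par J : ℤ) : ℂ) = B at *
  generalize ((sg I (symmDiff I J) : ℤ) : ℂ) = S at *
  generalize ((pp {i} J : ℤ) : ℂ) = p1 at *
  generalize ((pp I (symmDiff {i} J) : ℤ) : ℂ) = p2 at *
  generalize ((pp I {i} : ℤ) : ℂ) = p3 at *
  generalize ((pp (symmDiff I {i}) J : ℤ) : ℂ) = p4 at *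
  generalize ((pp {i} (symmDiff I J) : ℤ) : ℂ) = p5 at *
  generalize ((pp I J : ℤ) : ℂ) = p6 at *
  generalize ((qq {i} J : ℤ) : ℂ) = q1 at *
  generalize ((qq I (symmDiff {i} J) : ℤ) : ℂ) = q2 at *
  generalize ((qq I {i} : ℤ) : ℂ) = q3 at *
  generalize ((qq (symmDiff I {i}) J : ℤ) : ℂ) = q4 at *
  generalize ((qq {i} (symmDiff I J) : ℤ) : ℂ) = q5 at *
  generalize ((qq I J : ℤ) : ℂ) = q6 at *
  generalize symmDiff I (symmDiff {i} J) = K at *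
  rcases m with _ | m <;> rcases n with _ | n
  · simp
    rcases hA with hA | hA <;> subst hA <;>
      linear_combination S * B * f (0, K) * he
  · simp
    rcases hA with hA | hA <;> subst hA <;>
      linear_combination S * B * (f (n + 1, K) * he + (n + 1) * f (n, K) * hbn
        + (n + 1) * n * (2 - dI) * f (n - 1, K) * ha2)
  · simp
    rcases hA with hA | hA <;> subst hA <;>
      linear_combination S * B * (f (m + 1, K) * he + (m + 1) * f (m, K) * hbm
        + f (m - 1, K) * ((m + 1) * m * (dJ - 2) * (ha2 - ha1)))
  · have i2 : m + (n + 1) = m + n + 1 := by omega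
    have i3 : m + 1 + n = m + n + 1 := by omega
    have i4 : m + 1 + (n + 1) = m + n + 2 := by omega
    simp [i2, i3, i4]
    rcases hA with hA | hA <;> subst hA <;>
      linear_combination S * B * (f (m + n + 2, K) * he +
        f (m + n + 1, K) * ((m + 1) * hbm + (n + 1) * hbn)
        + f (m + n, K) * ((n + 1) * p2 * (m + 1) * hc1 - (n + 1) * p4 * (m + 1) * hc2
          - (m + 1) * (2 * (n + 1) - 2 * m - (n + 1) * (dI + 1) + m * dJ) * ha1
          + (m + n + 1) * (2 * (n + 1) - 2 * (m + 1) - (n + 1) * dI + (m + 1) * dJ) * ha2))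

/-- The sign `(-1)^{|L|(|L|-1)/2}`. -/
def sig (L : Idx) : ℤ := (-1) ^ (L.card * (L.card - 1) / 2)

lemma sig_sq : ∀ L : Idx, sig L * sig L = 1 := by decide +kernel

/-- The weights of the diagonal isomorphism. -/
def wt (p : ℕ × Idx) : ℂ := ((sig p.2 : ℤ) : ℂ) * (p.1.factorial : ℂ)

lemma wt_ne (p : ℕ × Idx) : wt p ≠ 0 := by
  unfold wt
  refine mul_ne_zero ?_ (by exact_mod_cast Nat.factorial_ne_zero _)
  intro h
  have := congrArg (Int.cast : ℤ → ℂ) (sig_sq p.2)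
  push_cast at this
  rw [h] at this
  simp at this

/-- Diagonal map with the given weights. -/
def diagMap (w : ℕ × Idx → ℂ) : ((ℕ × Idx) →₀ ℂ) →ₗ[ℂ] ((ℕ × Idx) →₀ ℂ) :=
  Finsupp.lsum ℂ (fun p => (w p) • Finsupp.lsingle p)

lemma diagMap_single (w : ℕ × Idx → ℂ) (p : ℕ × Idx) (c : ℂ) :
    diagMap w (Finsupp.single p c) = Finsupp.single p (w p * c) := by
  simp [diagMap]

/-- The isomorphism between the Verma module and the coadjoint module. -/
def phi : VInd ℂ ≃ₗ[ℂ] Kp :=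
  LinearEquiv.ofLinearMap (diagMap wt) (diagMap fun p => (wt p)⁻¹)
    (by
      refine Finsupp.lhom_ext fun p c => ?_
      rw [LinearMap.comp_apply, diagMap_single, diagMap_single, mul_inv_cancel_left₀ (wt_ne p)]
      rfl)
    (by
      refine Finsupp.lhom_ext fun p c => ?_
      rw [LinearMap.comp_apply, diagMap_single, diagMap_single, inv_mul_cancel_left₀ (wt_ne p)]
      rfl)

lemma phi_bv (k : ℕ) (L : Idx) (c : ℂ) : phi (bv k L c) = (wt (k, L) * c) • bp k L := by
  change diagMap wt (Finsupp.single (k, L) c) = _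
  rw [diagMap_single]
  simp [bp]

lemma coad_eta_bp {coad : ℕ → Idx → (Kp →ₗ[ℂ] Kp)} (h : IsCoad coad)
    (i : Fin 4) (s : ℕ) (K : Idx) :
    coad 0 {i} (bp s K) = if i ∈ K then
        (-((par K * pp {i} (K.erase i) : ℤ) : ℂ) * (s + 1)) • bp (s + 1) (K.erase i)
      else ((par K * qq {i} (insert i K) : ℤ) : ℂ) • bp s (insert i K) := by
  have h1 : ∀ (i : Fin 4) (K J : Idx), i ∈ K → K = symmDiff {i} J → J = K.erase i ∧ qq {i} J = 0
      ∧ par J = - par K := by decide +kernel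
  have h2 : ∀ (i : Fin 4) (K J : Idx), i ∉ K → K = symmDiff {i} J → J = insert i K ∧ pp {i} J = 0
      ∧ par J = - par K := by decide +kernel
  have h3 : ∀ (i : Fin 4) (K : Idx), i ∈ K → symmDiff {i} (K.erase i) = K := by decide +kernel
  have h4 : ∀ (i : Fin 4) (K : Idx), i ∉ K → symmDiff {i} (insert i K) = K := by decide +kernel
  ext ⟨n, J⟩
  rw [coad_eta h]
  by_cases hi : i ∈ K
  · rw [if_pos hi]
    simp only [Finsupp.smul_apply, bp_apply, smul_eq_mul]
    by_cases hJ : K = symmDiff {i} J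
    · obtain ⟨hJe, hq, hp⟩ := h1 i K J hi hJ
      rw [hq, hp, ← hJe, ← hJ]
      rcases n with _ | n
      · simp
      · by_cases hs : s = n
        · subst hs
          simp
          ring
        · simp [hs]
    · have hJ2 : K.erase i ≠ J := by
        rintro rfl
        exact hJ (h3 i K hi).symm
      simp [hJ, hJ2]
  · rw [if_neg hi]
    simp only [Finsupp.smul_apply, bp_apply, smul_eq_mul]
    by_cases hJ : K = symmDiff {i} J
    · obtain ⟨hJe, hq, hp⟩ := h2 i K J hi hJ
      rw [hq, hp, ← hJe, ← hJ]
      by_cases hs : s = n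
      · subst hs
        simp
      · simp [hs]
    · have hJ2 : insert i K ≠ J := by
        rintro rfl
        exact hJ (h4 i K hi).symm
      simp [hJ, hJ2]

lemma eta_intertwine {D : VermaData ℂ} (hD : IsVerma D)
    {coad : ℕ → Idx → (Kp →ₗ[ℂ] Kp)} (h : IsCoad coad) (i : Fin 4) (x : VInd ℂ) :
    phi (D.act 0 {i} x) = coad 0 {i} (phi x) := by
  have s1 : ∀ (i : Fin 4) (L : Idx), i ∈ L →
      dsign i L * sig (L.erase i) = - (sig L * (par L * pp {i} (L.erase i))) := by decide +kernel
  have s2 : ∀ (i : Fin 4) (L : Idx), i ∉ L →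
      msign {i} L * sig (insert i L) = sig L * (par L * qq {i} (insert i L)) := by decide +kernel
  induction x using Finsupp.induction_linear with
  | zero => simp
  | add f g hf hg => simp only [map_add, hf, hg]
  | single p c =>
    obtain ⟨k, L⟩ := p
    change phi (D.act 0 {i} (bv k L c)) = coad 0 {i} (phi (bv k L c))
    rw [hD.low_eta, phi_bv, map_smul, coad_eta_bp h]
    split_ifs with hi
    · rw [map_smul, phi_bv, smul_smul, smul_smul]
      congr 1
      have := congrArg (Int.cast : ℤ → ℂ) (s1 i L hi)
      push_cast at this
      simp only [wt, Nat.factorial_succ]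
      push_cast
      linear_combination ((k : ℂ) + 1) * (k.factorial : ℂ) * c * this
    · rw [map_smul, phi_bv, smul_smul, smul_smul]
      congr 1
      have := congrArg (Int.cast : ℤ → ℂ) (s2 i L hi)
      push_cast at this
      simp only [wt]
      push_cast
      linear_combination (k.factorial : ℂ) * c * this

lemma exists_eta {D : VermaData ℂ} (hD : IsVerma D) (k : ℕ) (L : Idx) (hpos : 2 * k + L.card ≠ 0) :
    ∃ (i : Fin 4) (k' : ℕ) (L' : Idx) (c : ℂ), 2 * k' + L'.card < 2 * k + L.card ∧
      bv k L (1 : ℂ) = c • D.act 0 {i} (bv k' L' 1) := by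
  have s1 : ∀ (i : Fin 4) (L : Idx), msign {i} L * msign {i} L = 1 := by decide +kernel
  have s2 : ∀ (i : Fin 4) (L : Idx), dsign i L * dsign i L = 1 := by decide +kernel
  by_cases hL : L = ∅
  · subst hL
    obtain ⟨k, rfl⟩ : ∃ k', k = k' + 1 := ⟨k - 1, by simp at hpos; omega⟩
    refine ⟨0, k, {0}, ((dsign 0 {0} : ℤ) : ℂ), by simp; omega, ?_⟩
    rw [hD.low_eta, if_pos (by simp), smul_smul]
    have := congrArg (Int.cast : ℤ → ℂ) (s2 0 {0})
    push_cast at this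
    rw [this, one_smul]
    rfl
  · obtain ⟨i, hi⟩ := Finset.nonempty_iff_ne_empty.2 hL
    refine ⟨i, k, L.erase i, ((msign {i} (L.erase i) : ℤ) : ℂ), ?_, ?_⟩
    · have := Finset.card_erase_lt_of_mem hi
      omega
    · rw [hD.low_eta, if_neg (by simp), smul_smul, Finset.insert_erase hi]
      have := congrArg (Int.cast : ℤ → ℂ) (s1 i (L.erase i))
      push_cast at this
      rw [this, one_smul]

lemma act_lie {D : VermaData ℂ} (hD : IsVerma D) (hρC : D.ρC = 0)
    (m : ℕ) (I : Idx) (i : Fin 4) (f : VInd ℂ) :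
    D.act m I (D.act 0 {i} f) = ((par I : ℤ) : ℂ) • D.act 0 {i} (D.act m I f)
      + (((lin m I 0 {i} * pp I {i} : ℤ) : ℂ) • D.act (m - 1) (symmDiff I {i}) f
      + ((par I * qq I {i} : ℤ) : ℂ) • D.act m (symmDiff I {i}) f) := by
  have := congrArg (fun T => T f) (hD.lie m I 0 {i})
  rw [hρC, brkAct_eq] at this
  simp only [LinearMap.sub_apply, LinearMap.comp_apply, LinearMap.smul_apply, LinearMap.add_apply,
    card_singleton, mul_one, add_zero] at this
  rw [sub_eq_iff_eq_add'] at this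
  rw [this]
  simp [par]

lemma coad_vac {coad : ℕ → Idx → (Kp →ₗ[ℂ] Kp)} (h : IsCoad coad) (m : ℕ) (I : Idx)
    (hI : I.card ≠ 1) (h0 : 2 * m + I.card ≠ 0) :
    coad m I (bp 0 ∅) = if m = 1 ∧ I = ∅ then (2 : ℂ) • bp 0 ∅ else 0 := by
  have q0 : ∀ I : Idx, I.card ≠ 1 → qq I I = 0 := by decide +kernel
  have p0 : ∀ I : Idx, I ≠ ∅ → pp I I = 0 := by decide +kernel
  ext ⟨n, J⟩
  rw [coad_apply h]
  simp only [bp_apply]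
  by_cases hJ : I = J
  · subst hJ
    rw [q0 I hI]
    by_cases hI0 : I = ∅
    · subst hI0
      have hm : m ≠ 0 := by simpa using h0
      by_cases hm1 : m = 1
      · subst hm1
        by_cases hn : n = 0
        · subst hn
          simp [sg, lin, pp, msign, bp_apply]
        · simp [bp_apply, Ne.symm hn]
      · rw [if_neg (by omega)]
        simp [hm1]
    · rw [p0 I hI0]
      simp [hI0]
  · have : (∅ : Idx) ≠ symmDiff I J := by
      intro h'
      exact hJ (symmDiff_eq_bot.1 h'.symm)
    simp only [this, and_false, if_false]
    split_ifs with hh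
    · have : (∅ : Idx) ≠ J := by rw [← hh.2]; exact hJ
      simp [bp_apply, this]
    · simp

lemma vac_intertwine {D : VermaData ℂ} (hD : IsVerma D)
    (hρt : D.ρt = (2 : ℂ) • LinearMap.id) (hρξ : ∀ i j, D.ρξ i j = 0)
    {coad : ℕ → Idx → (Kp →ₗ[ℂ] Kp)} (h : IsCoad coad) (m : ℕ) (I : Idx) :
    phi (D.act m I (bv 0 ∅ 1)) = coad m I (phi (bv 0 ∅ 1)) := by
  have hv : phi (bv 0 ∅ 1) = bp 0 ∅ := by simp [phi_bv, wt, sig]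
  by_cases hI : I.card = 1
  · by_cases hm : m = 0
    · subst hm
      obtain ⟨i, rfl⟩ := Finset.card_eq_one.1 hI
      exact eta_intertwine hD h i _
    · rw [hD.vac_pos _ _ _ (by omega), map_zero, hv]
      obtain ⟨i, rfl⟩ := Finset.card_eq_one.1 hI
      ext ⟨n, J⟩
      rw [coad_apply h]
      simp only [bp_apply]
      have hmn : ¬ (0 = m + n) := by omega
      by_cases hJ : {i} = J
      · subst hJ
        have : pp {i} {i} = 0 := by simp [pp]
        simp [this, hmn]
      · have : (∅ : Idx) ≠ symmDiff {i} J := by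
          intro h'
          exact hJ (symmDiff_eq_bot.1 h'.symm)
        simp [this]
  · by_cases h0 : 2 * m + I.card = 0
    · obtain ⟨rfl, hI0⟩ : m = 0 ∧ I.card = 0 := by omega
      rw [Finset.card_eq_zero] at hI0
      subst hI0
      rw [hD.low_one, map_smul, phi_bv, hv]
      ext ⟨n, J⟩
      rw [coad_apply h]
      have e : symmDiff ∅ J = J := bot_symmDiff J
      have q0 : qq ∅ J = 0 := by simp [qq]
      have p0 : pp ∅ J = 1 := by simp [pp, msign]
      rw [e, q0, p0]
      simp only [Finsupp.smul_apply, bp_apply, smul_eq_mul]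
      rcases n with _ | n
      · simp [lin]
      · by_cases hn : 0 = n ∧ ∅ = J
        · obtain ⟨rfl, rfl⟩ := hn
          simp [lin, sg, wt, sig]
        · have hn2 : ¬ (0 + 1 = n + 1 ∧ ∅ = J) := by
            rintro ⟨h1, h2⟩
            exact hn ⟨by omega, h2⟩
          have hn3 : ¬ (0 = 0 + (n + 1) - 1 ∧ ∅ = J) := by
            rintro ⟨h1, h2⟩
            exact hn ⟨by omega, h2⟩
          rw [if_neg hn2, if_neg hn3]
          simp
    · rw [hv, coad_vac h m I hI h0]
      split_ifs with hh
      · obtain ⟨rfl, rfl⟩ := hh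
        rw [hD.vac_t, hρt, phi_bv]
        simp [wt, sig]
      · by_cases h2 : 2 < 2 * m + I.card
        · rw [hD.vac_pos _ _ _ h2, map_zero]
        · have hm : m = 0 := by
            by_contra hm
            refine hh ⟨by omega, Finset.card_eq_zero.1 (by omega)⟩
          subst hm
          have hc : I.card = 2 := by omega
          have e : ∀ I : Idx, I.card = 2 → ∃ i j : Fin 4, i < j ∧ I = {i, j} := by decide +kernel
          obtain ⟨i, j, hij, rfl⟩ := e I hc
          rw [hD.vac_xi _ _ _ hij, hρξ, phi_bv]
          simp

lemma intertwine {D : VermaData ℂ} (hD : IsVerma D)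
    (hρt : D.ρt = (2 : ℂ) • LinearMap.id) (hρC : D.ρC = 0) (hρξ : ∀ i j, D.ρξ i j = 0)
    {coad : ℕ → Idx → (Kp →ₗ[ℂ] Kp)} (h : IsCoad coad) (m : ℕ) (I : Idx) (x : VInd ℂ) :
    phi (D.act m I x) = coad m I (phi x) := by
  have key : ∀ (N k : ℕ) (L : Idx), 2 * k + L.card = N → ∀ (m : ℕ) (I : Idx),
      phi (D.act m I (bv k L 1)) = coad m I (phi (bv k L 1)) := by
    intro N
    induction N using Nat.strong_induction_on with
    | _ N ih =>
      intro k L hN m I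
      by_cases h0 : 2 * k + L.card = 0
      · obtain ⟨rfl, hL⟩ : k = 0 ∧ L.card = 0 := by omega
        rw [Finset.card_eq_zero] at hL
        subst hL
        exact vac_intertwine hD hρt hρξ h m I
      · obtain ⟨i, k', L', c, hlt, he⟩ := exists_eta hD k L h0
        have ih' := ih _ (hN ▸ hlt) k' L' rfl
        rw [he]
        simp only [map_smul]
        rw [act_lie hD hρC, eta_intertwine hD h, coad_lie h]
        simp only [map_add, map_smul, eta_intertwine hD h, ih']
  induction x using Finsupp.induction_linear with
  | zero => simp
  | add f g hf hg => simp only [map_add, hf, hg]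
  | single p c =>
    obtain ⟨k, L⟩ := p
    have : (Finsupp.single (k, L) c : VInd ℂ) = c • bv k L 1 := by simp [bv]
    rw [this]
    simp only [map_smul, key _ k L rfl]

lemma top_of_vac {D : VermaData ℂ} (hD : IsVerma D) (p : Submodule ℂ (VInd ℂ))
    (hp : ∀ v ∈ p, ∀ (m : ℕ) (I : Idx), D.act m I v ∈ p) (hv : bv 0 ∅ 1 ∈ p) : p = ⊤ := by
  have key : ∀ (N k : ℕ) (L : Idx), 2 * k + L.card = N → bv k L 1 ∈ p := by
    intro N
    induction N using Nat.strong_induction_on with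
    | _ N ih =>
      intro k L hN
      by_cases h0 : 2 * k + L.card = 0
      · obtain ⟨rfl, hL⟩ : k = 0 ∧ L.card = 0 := by omega
        rw [Finset.card_eq_zero] at hL
        subst hL
        exact hv
      · obtain ⟨i, k', L', c, hlt, he⟩ := exists_eta hD k L h0
        rw [he]
        exact p.smul_mem _ (hp _ (ih _ (hN ▸ hlt) k' L' rfl) _ _)
  rw [eq_top_iff]
  rintro x -
  induction x using Finsupp.induction_linear with
  | zero => exact p.zero_mem
  | add f g hf hg => exact p.add_mem hf hg
  | single q c =>
    obtain ⟨k, L⟩ := q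
    have : (Finsupp.single (k, L) c : VInd ℂ) = c • bv k L 1 := by simp [bv]
    rw [this]
    exact p.smul_mem _ (key _ k L rfl)

lemma coad_vac_mem {coad : ℕ → Idx → (Kp →ₗ[ℂ] Kp)} (h : IsCoad coad) (q : Submodule ℂ Kp)
    (hq : ∀ f ∈ q, ∀ (m : ℕ) (I : Idx), coad m I f ∈ q) (hne : q ≠ ⊥) : bp 0 ∅ ∈ q := by
  obtain ⟨f, hf, hf0⟩ := q.ne_bot_iff.1 hne
  obtain ⟨⟨s, K⟩, hs, hmax⟩ := Finset.exists_max_image f.support (fun p => 2 * p.1 + p.2.card)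
    (Finsupp.support_nonempty_iff.2 hf0)
  have hz : ∀ s' K', 2 * s + K.card < 2 * s' + K'.card → f (s', K') = 0 := by
    intro s' K' hlt
    by_contra hc
    have := hmax (s', K') (by simpa using hc)
    simp only at this
    omega
  have hqe : ∀ K : Idx, qq K ∅ = 0 := by decide +kernel
  have hpe : ∀ K : Idx, pp K ∅ = 1 := by decide +kernel
  have he : coad (s + 1) K f =
      (((sg K K : ℤ) : ℂ) * (2 * (s + 1)) * f (s, K)) • bp 0 ∅ := by
    ext ⟨n, J⟩
    rw [coad_apply h]
    simp only [Finsupp.smul_apply, smul_eq_mul, bp_apply]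
    by_cases h0 : 2 * n + J.card = 0
    · obtain ⟨rfl, hL⟩ : n = 0 ∧ J.card = 0 := by omega
      rw [Finset.card_eq_zero] at hL
      subst hL
      have e : symmDiff K ∅ = K := symmDiff_bot K
      rw [hqe, hpe, e]
      simp [lin]
      ring
    · have hnJ : ¬ (0 = n ∧ ∅ = J) := by
        rintro ⟨rfl, rfl⟩
        simp at h0
      rw [if_neg hnJ, mul_zero]
      have t1 : ((lin (s + 1) K n J * pp K J : ℤ) : ℂ) * f (s + 1 + n - 1, symmDiff K J) = 0 := by
        rcases pp_card K J with hp | hp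
        · simp [hp]
        · rw [hz _ _ (by rw [hp]; omega), mul_zero]
      have t2 : ((par K * qq K J : ℤ) : ℂ) * f (s + 1 + n, symmDiff K J) = 0 := by
        rcases qq_card K J with hp | hp
        · simp [hp]
        · rw [hz _ _ (by omega), mul_zero]
      rw [t1, t2]
      simp
  have hc : ((sg K K : ℤ) : ℂ) * (2 * (s + 1)) * f (s, K) ≠ 0 := by
    refine mul_ne_zero (mul_ne_zero ?_ ?_) (by simpa using hs)
    · simp [sg]
    · exact mul_ne_zero two_ne_zero (by exact_mod_cast Nat.succ_ne_zero s)
  have := hq f hf (s + 1) K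
  rw [he] at this
  exact (q.smul_mem_iff hc).1 this

/-- **The Verma module `M(0,0,2,0)` is irreducible and isomorphic to the coadjoint
representation of `K(1,4)₊` on its restricted dual.**
Here `M(0,0,2,0) = Ind F(0,0,2,0)` with `F(0,0,2,0) = ℂ` of highest weight `(0,0,2,0)`
with respect to `(h_x, h_y, t, C)` (so `ρξ = 0`, `ρt = 2`, `ρC = 0`on `F`), and the
coadjoint action on the restricted dual `K(1,4)₊* = ⊕ⱼ ((K(1,4)₊)ⱼ)*` is
`(x.f)(y) = -(-1)^{p(x)p(f)} f([x,y])`, encoded on the dual basis by `coad`. -/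
theorem verma_0020_irreducible_coadjoint
    (D : VermaData ℂ) (hD : IsVerma D)
    (hρt : D.ρt = (2 : ℂ) • LinearMap.id) (hρC : D.ρC = 0) (hρξ : ∀ i j, D.ρξ i j = 0)
    (coad : ℕ → Idx → (Kp →ₗ[ℂ] Kp))
    (hcoad : ∀ (m : ℕ) (I : Idx) (s : ℕ) (K : Idx) (n : ℕ) (J : Idx),
      (coad m I (bp s K)) (n, J) = -((-1 : ℂ) ^ (I.card * K.card)) * (kbrkp m I n J) (s, K)) :
    (∀ p : Submodule ℂ (VInd ℂ),
        (∀ v ∈ p, ∀ (m : ℕ) (I : Idx), D.act m I v ∈ p) → p = ⊥ ∨ p = ⊤) ∧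
    (∀ q : Submodule ℂ Kp,
        (∀ f ∈ q, ∀ (m : ℕ) (I : Idx), coad m I f ∈ q) → q = ⊥ ∨ q = ⊤) ∧
    (∃ φ : VInd ℂ ≃ₗ[ℂ] Kp,
        ∀ (m : ℕ) (I : Idx) (x : VInd ℂ), φ (D.act m I x) = coad m I (φ x)) := by
  have h : IsCoad coad := hcoad
  have hI := fun m I x => intertwine hD hρt hρC hρξ h m I x
  have hv : phi (bv 0 ∅ 1) = bp 0 ∅ := by simp [phi_bv, wt, sig]
  refine ⟨?_, ?_, phi, hI⟩
  · intro p hp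
    by_cases hb : p = ⊥
    · exact Or.inl hb
    · right
      refine top_of_vac hD p hp ?_
      have hm : bp 0 ∅ ∈ p.map (phi : VInd ℂ →ₗ[ℂ] Kp) := by
        refine coad_vac_mem h _ ?_ ?_
        · rintro _ ⟨x, hx, rfl⟩ m I
          exact ⟨D.act m I x, hp x hx m I, hI m I x⟩
        · intro hbot
          exact hb (Submodule.map_eq_bot_iff.1 hbot)
      obtain ⟨x, hx, hxe⟩ := hm
      have : x = bv 0 ∅ 1 := phi.injective (hxe.trans hv.symm)
      exact this ▸ hx
  · intro q hq
    by_cases hb : q = ⊥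
    · exact Or.inl hb
    · right
      have ht : q.comap (phi : VInd ℂ →ₗ[ℂ] Kp) = ⊤ := by
        refine top_of_vac hD _ ?_ ?_
        · intro v hv m I
          change phi (D.act m I v) ∈ q
          rw [hI]
          exact hq _ hv m I
        · change phi (bv 0 ∅ 1) ∈ q
          rw [hv]
          exact coad_vac_mem h q hq hb
      rw [eq_top_iff]
      rintro y -
      have hy : phi.symm y ∈ q.comap (phi : VInd ℂ →ₗ[ℂ] Kp) := by rw [ht]; trivial
      have hy' : phi (phi.symm y) ∈ q := hy
      rwa [phi.apply_symm_apply] at hy'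

end
end

section
/- For g = A(K'_4): the subalgebra g_{>0} is generated by g_1 (that is, g_i = g_1^i for all i ≥ 2), and as a g_0-module g_1 decomposes as the direct sum of the two irreducible g_0-submodules ⟨tξ_i : 1≤i≤4⟩ and ⟨ξ_I : I strictly increasing, |I|=3⟩, whose lowest weight vectors are t(ξ_1+iξ_2) and (ξ_1+iξ_2)ξ_3ξ_4 respectively. -/
/-!
The structure of the annihilation superalgebra `𝔤 = 𝒜(K'₄) = K(1,4)₊ ⊕ ℂC`:
`𝔤_{>0}` is generated by `𝔤₁`, and `𝔤₁` splits into two irreducible `𝔤₀`-modules.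

`𝔤` is encoded as `Kp × ℂ`, with `Kp = ℂ[t] ⊗ Λ(4)` (basis `t^m ξ_I`) and second component
the central element `C`; the grading is `deg (t^m ξ_I) = 2m + |I| - 2`, `deg C = 0`.
-/

open Finset

noncomputable section

/-- The 2-cocycle of the central extension `𝒜(K'₄) = K(1,4)₊ ⊕ ℂC`, on basis monomials. -/
def psiC (m : ℕ) (I : Idx) (n : ℕ) (J : Idx) : ℂ :=
  if m = 0 ∧ n = 0 then
    (if I = (∅ : Idx) ∧ J = (Finset.univ : Idx) then (-2 : ℂ) else 0)
    + (if I = (Finset.univ : Idx) ∧ J = (∅ : Idx) then (2 : ℂ) else 0)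
    + ∑ i : Fin 4,
        (if I = ({i} : Idx) ∧ J = ({i}ᶜ : Idx) then (-(dsign i Finset.univ) : ℂ) else 0)
    + ∑ i : Fin 4,
        (if I = ({i}ᶜ : Idx) ∧ J = ({i} : Idx) then (-(dsign i Finset.univ) : ℂ) else 0)
  else 0

/-- The graded piece `𝔤_d` of `𝔤 = 𝒜(K'₄)`: spanned by the `t^m ξ_I` with
`2m + |I| - 2 = d`, together with `C` in degree `0`. -/
def gdeg (d : ℤ) : Submodule ℂ (Kp × ℂ) :=
  Submodule.span ℂ {z : Kp × ℂ |
    (∃ (m : ℕ) (I : Idx), 2 * (m : ℤ) + (I.card : ℤ) - 2 = d ∧ z = (bp m I, 0)) ∨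
    (d = 0 ∧ z = (0, 1))}

/-- The `𝔤₀`-submodule `⟨tξᵢ : 1 ≤ i ≤ 4⟩` of `𝔤₁`. -/
def V1 : Submodule ℂ (Kp × ℂ) :=
  Submodule.span ℂ {z : Kp × ℂ | ∃ i : Fin 4, z = (bp 1 {i}, 0)}

/-- The `𝔤₀`-submodule `⟨ξ_I : |I| = 3⟩` of `𝔤₁`. -/
def V2 : Submodule ℂ (Kp × ℂ) :=
  Submodule.span ℂ {z : Kp × ℂ | ∃ I : Idx, I.card = 3 ∧ z = (bp 0 I, 0)}

/-- The negative root vector `f_x = (ξ₁₃ + ξ₂₄ - iξ₁₄ + iξ₂₃)/2 ∈ 𝔤₀` (0-indexed). -/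
def fxG : Kp × ℂ :=
  ((2 : ℂ)⁻¹ • (bp 0 {0, 2} + bp 0 {1, 3} - Complex.I • bp 0 {0, 3}
      + Complex.I • bp 0 {1, 2}), 0)

/-- The negative root vector `f_y = (ξ₁₃ - ξ₂₄ + iξ₁₄ + iξ₂₃)/2 ∈ 𝔤₀` (0-indexed). -/
def fyG : Kp × ℂ :=
  ((2 : ℂ)⁻¹ • (bp 0 {0, 2} - bp 0 {1, 3} + Complex.I • bp 0 {0, 3}
      + Complex.I • bp 0 {1, 2}), 0)

/-- `t(ξ₁ + iξ₂)` (0-indexed). -/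
def lw1 : Kp × ℂ := (bp 1 {0} + Complex.I • bp 1 {1}, 0)

/-- `(ξ₁ + iξ₂)ξ₃ξ₄` (0-indexed). -/
def lw2 : Kp × ℂ := (bp 0 {0, 2, 3} + Complex.I • bp 0 {1, 2, 3}, 0)

/-- Integer coefficient of `ξ_K` in `∑ᵢ ∂ᵢξ_I ∂ᵢξ_J`. -/
def dz (I J K : Idx) : ℤ :=
  ∑ i : Fin 4,
    if i ∈ I ∧ i ∈ J ∧ Disjoint (I.erase i) (J.erase i) ∧ I.erase i ∪ J.erase i = K then
      dsign i I * dsign i J * msign (I.erase i) (J.erase i) else 0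

theorem ddp_eq_of_dz (m : ℕ) (I J L : Idx) (c : ℤ)
    (h : ∀ K, dz I J K = if K = L then c else 0) :
    ddp m I J = (c : ℂ) • bp m L := by
  have key : ∀ K, ddp m I J (m, K) = (dz I J K : ℂ) := by
    intro K
    unfold ddp dz
    rw [Finsupp.finsetSum_apply]
    push_cast
    refine Finset.sum_congr rfl fun i _ => ?_
    by_cases h1 : i ∈ I ∧ i ∈ J
    · by_cases h2 : Disjoint (I.erase i) (J.erase i)
      · by_cases h3 : I.erase i ∪ J.erase i = K
        · simp [h1, xiMulp, h2, h3, bp]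
        · simp [h1, xiMulp, h2, h3, bp, Finsupp.single_apply]
      · simp [h1, xiMulp, h2]
    · rw [if_neg h1, if_neg (by tauto)]
      simp
  have key2 : ∀ n K, n ≠ m → ddp m I J (n, K) = 0 := by
    intro n K hn
    unfold ddp
    rw [Finsupp.finsetSum_apply]
    refine Finset.sum_eq_zero fun i _ => ?_
    split_ifs
    · unfold xiMulp
      split_ifs <;> simp [bp, Finsupp.single_apply, Ne.symm hn]
    · simp
  ext ⟨n, K⟩
  by_cases hn : n = m
  · subst hn
    rw [key, h]
    by_cases hK : K = L
    · simp [hK, bp]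
    · simp [hK, bp, Finsupp.single_apply, Ne.symm hK]
  · rw [key2 n K hn]
    simp [bp, Finsupp.single_apply, Ne.symm hn]

theorem psiC_zero (m n : ℕ) (I J : Idx)
    (h : 2 * (m : ℤ) + (I.card : ℤ) - 2 + (2 * (n : ℤ) + (J.card : ℤ) - 2) ≠ 0) :
    psiC m I n J = 0 := by
  unfold psiC
  by_cases hmn : m = 0 ∧ n = 0
  · rw [if_pos hmn]
    obtain ⟨rfl, rfl⟩ := hmn
    have h4 : I.card + J.card ≠ 4 := by omega
    have h1 : ¬ (I = (∅ : Idx) ∧ J = (Finset.univ : Idx)) := by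
      rintro ⟨rfl, rfl⟩; simp at h4
    have h2 : ¬ (I = (Finset.univ : Idx) ∧ J = (∅ : Idx)) := by
      rintro ⟨rfl, rfl⟩; simp at h4
    have h3 : ∀ i : Fin 4, ¬ (I = ({i} : Idx) ∧ J = ({i}ᶜ : Idx)) := by
      rintro i ⟨rfl, rfl⟩; simp [Finset.card_compl] at h4
    have h5 : ∀ i : Fin 4, ¬ (I = ({i}ᶜ : Idx) ∧ J = ({i} : Idx)) := by
      rintro i ⟨rfl, rfl⟩; simp [Finset.card_compl] at h4
    simp only [h1, h2, h3, h5, if_false, Finset.sum_const_zero, add_zero]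
  · rw [if_neg hmn]

theorem bp_mem_gdeg (d : ℤ) (m : ℕ) (I : Idx) (h : 2 * (m : ℤ) + (I.card : ℤ) - 2 = d) :
    ((bp m I, 0) : Kp × ℂ) ∈ gdeg d :=
  Submodule.subset_span (Or.inl ⟨m, I, h, rfl⟩)

theorem fst_xiMulp_mem (d : ℤ) (m : ℕ) (I J : Idx)
    (h : 2 * (m : ℤ) + (I.card : ℤ) + (J.card : ℤ) - 2 = d) :
    ((xiMulp m I J, 0) : Kp × ℂ) ∈ gdeg d := by
  unfold xiMulp
  split_ifs with hd
  · have := bp_mem_gdeg d m (I ∪ J) (by rw [Finset.card_union_of_disjoint hd]; push_cast; omega)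
    simpa using (gdeg d).smul_mem ((msign I J : ℤ) : ℂ) this
  · exact (gdeg d).zero_mem

theorem fst_ddp_mem (d : ℤ) (m : ℕ) (I J : Idx)
    (h : 2 * (m : ℤ) + (I.card : ℤ) + (J.card : ℤ) - 4 = d) :
    ((ddp m I J, 0) : Kp × ℂ) ∈ gdeg d := by
  suffices H : ddp m I J ∈ (gdeg d).comap (LinearMap.inl ℂ Kp ℂ) by simpa using H
  unfold ddp
  refine Submodule.sum_mem _ fun i _ => ?_
  split_ifs with hi
  · refine Submodule.smul_mem _ _ ?_
    have h1 := Finset.card_erase_add_one hi.1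
    have h2 := Finset.card_erase_add_one hi.2
    have := fst_xiMulp_mem d m (I.erase i) (J.erase i) (by omega)
    simpa using this
  · exact Submodule.zero_mem _

theorem brk_mem (a b : ℤ) (hab : a + b ≠ 0) (m n : ℕ) (I J : Idx)
    (hI : 2 * (m : ℤ) + (I.card : ℤ) - 2 = a) (hJ : 2 * (n : ℤ) + (J.card : ℤ) - 2 = b) :
    ((kbrkp m I n J, psiC m I n J) : Kp × ℂ) ∈ gdeg (a + b) := by
  rw [psiC_zero m n I J (by omega)]
  suffices H : kbrkp m I n J ∈ (gdeg (a + b)).comap (LinearMap.inl ℂ Kp ℂ) by simpa using H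
  unfold kbrkp
  refine Submodule.add_mem _ ?_ (Submodule.smul_mem _ _ ?_)
  · by_cases h0 : m = 0 ∧ n = 0
    · obtain ⟨rfl, rfl⟩ := h0
      simp
    · refine Submodule.smul_mem _ _ ?_
      simpa using fst_xiMulp_mem (a + b) (m + n - 1) I J (by omega)
  · simpa using fst_ddp_mem (a + b) (m + n) I J (by push_cast; omega)

theorem bilin_mem {M : Type*} [AddCommGroup M] [Module ℂ M] (B : M →ₗ[ℂ] M →ₗ[ℂ] M)
    (S T : Set M) (P : Submodule ℂ M) (h : ∀ x ∈ S, ∀ y ∈ T, B x y ∈ P) :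
    ∀ x ∈ Submodule.span ℂ S, ∀ y ∈ Submodule.span ℂ T, B x y ∈ P := by
  intro x hx y hy
  have h1 : ∀ x ∈ S, B x y ∈ P := by
    intro x hx
    have : Submodule.span ℂ T ≤ P.comap (B x) := Submodule.span_le.2 fun y hy => h x hx y hy
    exact this hy
  have : Submodule.span ℂ S ≤ P.comap (B.flip y) := Submodule.span_le.2 fun x hx => h1 x hx
  exact this hx

/-- Irreducibility of the vector representation of `so(4)`. -/
theorem irred {M : Type*} [AddCommGroup M] [Module ℂ M]
    (R : Fin 4 → Fin 4 → M →ₗ[ℂ] M) (e : Fin 4 → M)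
    (hs : ∀ i j, R i j = R j i)
    (h1 : ∀ i j, i ≠ j → ∃ c : ℂ, c ≠ 0 ∧ R i j (e i) = c • e j)
    (h0 : ∀ i j k, i ≠ j → k ≠ i → k ≠ j → R i j (e k) = 0)
    (W : Submodule ℂ M) (hW : W ≤ Submodule.span ℂ (Set.range e))
    (hst : ∀ i j, i ≠ j → ∀ v ∈ W, R i j v ∈ W) :
    W = ⊥ ∨ W = Submodule.span ℂ (Set.range e) := by
  by_cases hb : W = ⊥
  · exact Or.inl hb
  right
  refine le_antisymm hW ?_
  obtain ⟨v, hv, hv0⟩ := Submodule.exists_mem_ne_zero_of_ne_bot hb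
  obtain ⟨a, ha⟩ := (Submodule.mem_span_range_iff_exists_fun ℂ).1 (hW hv)
  obtain ⟨k, hk⟩ : ∃ k, a k ≠ 0 := by
    by_contra! h
    exact hv0 (by rw [← ha]; simp [h])
  obtain ⟨l, m, hkl, hkm, hlm⟩ : ∃ l m : Fin 4, k ≠ l ∧ k ≠ m ∧ l ≠ m := by
    clear hk; revert k; decide
  obtain ⟨c, hc, hce⟩ := h1 k l hkl
  obtain ⟨c', hc', hce'⟩ := h1 l m hlm
  have comp : ∀ q, R l m (R k l (a q • e q)) = if q = k then (a k * c * c') • e m else 0 := by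
    intro q
    rw [map_smul]
    by_cases hqk : q = k
    · subst hqk
      rw [hce, map_smul, map_smul, hce', if_pos rfl, smul_smul, smul_smul]
    · rw [if_neg hqk]
      by_cases hql : q = l
      · subst hql
        obtain ⟨d, hd, hde⟩ := h1 q k (Ne.symm hkl)
        rw [hs k q, hde, map_smul, map_smul, h0 q m k hlm hkl hkm, smul_zero, smul_zero]
      · rw [h0 k l q hkl hqk hql, smul_zero, map_zero]
  have hm : (a k * c * c') • e m ∈ W := by
    have := hst l m hlm _ (hst k l hkl v hv)
    rw [← ha, map_sum, map_sum, Finset.sum_congr rfl fun q _ => comp q] at this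
    simpa using this
  have hem : e m ∈ W := by
    have hne : a k * c * c' ≠ 0 := mul_ne_zero (mul_ne_zero hk hc) hc'
    exact (Submodule.smul_mem_iff W hne).1 hm
  rw [Submodule.span_le]
  rintro _ ⟨p, rfl⟩
  by_cases hp : m = p
  · exact hp ▸ hem
  obtain ⟨d, hd, hde⟩ := h1 m p hp
  have := hst m p hp _ hem
  rw [hde] at this
  exact (Submodule.smul_mem_iff W hd).1 this

theorem dz_one : ∀ i j K, i ≠ j → dz {i, j} {i} K = if K = {j} then
    (if i < j then 1 else -1) else 0 := by
  decide +kernel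

theorem dz_one_zero : ∀ i j k K, i ≠ j → k ≠ i → k ≠ j → dz {i, j} {k} K = 0 := by
  decide +kernel

/-- Sign of the action on the cubic monomials. -/
def sg3 (i j : Fin 4) : ℤ := dz {i, j} {i}ᶜ {j}ᶜ

theorem dz_three : ∀ i j K, i ≠ j → dz {i, j} {i}ᶜ K = if K = {j}ᶜ then sg3 i j else 0 := by
  decide +kernel

theorem sg3_ne : ∀ i j, i ≠ j → sg3 i j ≠ 0 := by
  decide +kernel

theorem dz_three_zero : ∀ i j k K, i ≠ j → k ≠ i → k ≠ j → dz {i, j} {k}ᶜ K = 0 := by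
  decide +kernel

theorem kbrkp_quad_one (I J : Idx) (hI : I.card = 2) :
    kbrkp 0 I 1 J = ddp 1 I J := by
  simp [kbrkp, hI]

theorem kbrkp_quad_three (I J : Idx) (hI : I.card = 2) :
    kbrkp 0 I 0 J = ddp 0 I J := by
  simp [kbrkp, hI]

theorem V1_eq : V1 = Submodule.span ℂ (Set.range fun i : Fin 4 => ((bp 1 {i}, 0) : Kp × ℂ)) := by
  unfold V1
  congr 1
  ext z
  simp [eq_comm]

theorem card3 : ∀ I : Idx, I.card = 3 → ∃ k, I = {k}ᶜ := by decide +kernel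

theorem V2_eq : V2 = Submodule.span ℂ (Set.range fun i : Fin 4 => ((bp 0 {i}ᶜ, 0) : Kp × ℂ)) := by
  unfold V2
  congr 1
  ext z
  constructor
  · rintro ⟨I, hI, rfl⟩
    obtain ⟨k, rfl⟩ := card3 I hI
    exact ⟨k, rfl⟩
  · rintro ⟨k, rfl⟩
    exact ⟨{k}ᶜ, by simp [Finset.card_compl], rfl⟩

/-- Bracket with a generator `tξ_j`, `j ∈ J`. -/
theorem ddp_singleton (m : ℕ) (j : Fin 4) (J : Idx) (hj : j ∈ J) :
    ddp m {j} J = ((dsign j J : ℤ) : ℂ) • bp m (J.erase j) := by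
  apply ddp_eq_of_dz
  revert j J
  decide +kernel

theorem ddp_singleton_zero (m : ℕ) (j : Fin 4) (J : Idx) (hj : j ∉ J) :
    ddp m {j} J = 0 := by
  unfold ddp
  refine Finset.sum_eq_zero fun i _ => if_neg ?_
  rintro ⟨h1, h2⟩
  simp at h1
  exact hj (h1 ▸ h2)

theorem dsign_ne (j : Fin 4) (J : Idx) : ((dsign j J : ℤ) : ℂ) ≠ 0 := by
  simp [dsign]

theorem msign_ne (I J : Idx) : ((msign I J : ℤ) : ℂ) ≠ 0 := by
  simp [msign]

/-- Every monomial of degree at least two lies in `[𝔤₁, 𝔤_{i-1}]`. -/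
theorem gen_step (i : ℤ) (hi : 2 ≤ i) (m : ℕ) (I : Idx)
    (h : 2 * (m : ℤ) + (I.card : ℤ) - 2 = i) :
    ∃ (j : Fin 4) (n : ℕ) (J : Idx) (c : ℂ), c ≠ 0 ∧ 2 * (n : ℤ) + (J.card : ℤ) - 2 = i - 1 ∧
      ((kbrkp 1 {j} n J, psiC 1 {j} n J) : Kp × ℂ) = c • (bp m I, 0) := by
  by_cases hU : I = Finset.univ
  · subst hU
    refine ⟨0, m, {1, 2, 3}, ((m : ℂ) + 1) * ((msign {0} {1, 2, 3} : ℤ) : ℂ),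
      mul_ne_zero (by exact_mod_cast Nat.succ_ne_zero m) (msign_ne _ _), ?_, ?_⟩
    · have h3 : ({1, 2, 3} : Idx).card = 3 := rfl
      have h4 : (Finset.univ : Idx).card = 4 := rfl
      rw [h3]; rw [h4] at h; push_cast at *; omega
    · have h3 : ({1, 2, 3} : Idx).card = 3 := rfl
      have hu : ({0} ∪ {1, 2, 3} : Idx) = Finset.univ := by decide
      have hd : Disjoint ({0} : Idx) {1, 2, 3} := by decide
      rw [kbrkp, ddp_singleton_zero _ _ _ (by decide), xiMulp, if_pos hd, hu, h3]
      rw [show psiC 1 {0} m {1, 2, 3} = 0 by simp [psiC]]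
      rw [show 1 + m - 1 = m by omega, smul_zero, add_zero, smul_smul]
      ext1
      · simp only [Finset.card_singleton, Prod.smul_fst]
        congr 1
        push_cast
        ring
      · simp
  · obtain ⟨j, hj⟩ : ∃ j, j ∉ I := by
      by_contra! hh
      exact hU (Finset.eq_univ_iff_forall.2 hh)
    have hcard : I.card ≤ 3 := by
      have := Finset.card_lt_univ_of_notMem hj
      simp at this
      omega
    obtain ⟨n, rfl⟩ : ∃ n, m = n + 1 := ⟨m - 1, by omega⟩
    refine ⟨j, n, insert j I, -((dsign j (insert j I) : ℤ) : ℂ), neg_ne_zero.2 (dsign_ne _ _),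
      ?_, ?_⟩
    · rw [Finset.card_insert_of_notMem hj]; push_cast at *; omega
    · rw [kbrkp, ddp_singleton _ _ _ (Finset.mem_insert_self j I), xiMulp, if_neg (by simp)]
      rw [show psiC 1 {j} n (insert j I) = 0 by simp [psiC]]
      rw [Finset.erase_insert hj, add_comm 1 n]
      ext1 <;> simp

/-- **Structure of `𝔤₁` for `𝔤 = 𝒜(K'₄)`** (Lemma `g1`).
The subalgebra `𝔤_{>0}` is generated by `𝔤₁` (i.e. `𝔤ᵢ = [𝔤₁, 𝔤_{i-1}]` for `i ≥ 2`), and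
as a `𝔤₀`-module `𝔤₁ = ⟨tξᵢ : 1 ≤ i ≤ 4⟩ ⊕ ⟨ξ_I : |I| = 3⟩`, a direct sum of two
irreducible `𝔤₀`-modules with lowest weight vectors `t(ξ₁ + iξ₂)` and `(ξ₁ + iξ₂)ξ₃ξ₄`. -/
theorem g_positive_generated_by_g1
    (B : (Kp × ℂ) →ₗ[ℂ] (Kp × ℂ) →ₗ[ℂ] (Kp × ℂ))
    (hB : ∀ (m n : ℕ) (I J : Idx),
      B (bp m I, 0) (bp n J, 0) = (kbrkp m I n J, psiC m I n J))
    (hC1 : ∀ x : Kp × ℂ, B ((0 : Kp), (1 : ℂ)) x = 0)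
    (hC2 : ∀ x : Kp × ℂ, B x ((0 : Kp), (1 : ℂ)) = 0) :
    (∀ i : ℤ, 2 ≤ i →
      gdeg i = Submodule.span ℂ
        {z : Kp × ℂ | ∃ x ∈ gdeg 1, ∃ y ∈ gdeg (i - 1), z = B x y}) ∧
    gdeg 1 = V1 ⊔ V2 ∧ V1 ⊓ V2 = ⊥ ∧
    (∀ x ∈ gdeg 0, ∀ v ∈ V1, B x v ∈ V1) ∧
    (∀ W : Submodule ℂ (Kp × ℂ), W ≤ V1 →
      (∀ x ∈ gdeg 0, ∀ v ∈ W, B x v ∈ W) → W = ⊥ ∨ W = V1) ∧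
    (∀ x ∈ gdeg 0, ∀ v ∈ V2, B x v ∈ V2) ∧
    (∀ W : Submodule ℂ (Kp × ℂ), W ≤ V2 →
      (∀ x ∈ gdeg 0, ∀ v ∈ W, B x v ∈ W) → W = ⊥ ∨ W = V2) ∧
    lw1 ∈ V1 ∧ lw1 ≠ 0 ∧ B fxG lw1 = 0 ∧ B fyG lw1 = 0 ∧
    lw2 ∈ V2 ∧ lw2 ≠ 0 ∧ B fxG lw2 = 0 ∧ B fyG lw2 = 0 := by
  have hB1 : ∀ i j : Fin 4, i ≠ j →
      B (bp 0 {i, j}, 0) (bp 1 {i}, 0) = (((if i < j then 1 else -1 : ℤ) : ℂ)) • (bp 1 {j}, 0) := by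
    intro i j hij
    rw [hB, kbrkp_quad_one _ _ (Finset.card_pair hij), ddp_eq_of_dz _ _ _ _ _ (dz_one i j · hij)]
    split_ifs <;> simp [psiC]
  have hB10 : ∀ i j k : Fin 4, i ≠ j → k ≠ i → k ≠ j →
      B (bp 0 {i, j}, 0) (bp 1 {k}, 0) = 0 := by
    intro i j k hij hi hj
    rw [hB, kbrkp_quad_one _ _ (Finset.card_pair hij),
      ddp_eq_of_dz _ _ _ ∅ 0 (by intro K; rw [dz_one_zero i j k K hij hi hj, ite_self])]
    simp [psiC]
  have hpsi3 : ∀ i j k : Fin 4, i ≠ j → psiC 0 {i, j} 0 {k}ᶜ = 0 := by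
    intro i j k hij
    apply psiC_zero
    rw [Finset.card_pair hij, Finset.card_compl]
    simp
  have hB3 : ∀ i j : Fin 4, i ≠ j →
      B (bp 0 {i, j}, 0) (bp 0 {i}ᶜ, 0) = ((sg3 i j : ℤ) : ℂ) • (bp 0 {j}ᶜ, 0) := by
    intro i j hij
    rw [hB, kbrkp_quad_three _ _ (Finset.card_pair hij),
      ddp_eq_of_dz _ _ _ _ _ (dz_three i j · hij), hpsi3 i j i hij]
    simp
  have hB30 : ∀ i j k : Fin 4, i ≠ j → k ≠ i → k ≠ j →
      B (bp 0 {i, j}, 0) (bp 0 {k}ᶜ, 0) = 0 := by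
    intro i j k hij hi hj
    rw [hB, kbrkp_quad_three _ _ (Finset.card_pair hij), hpsi3 i j k hij,
      ddp_eq_of_dz _ _ _ ∅ 0 (by intro K; rw [dz_three_zero i j k K hij hi hj, ite_self])]
    simp
  have hg0 : ∀ P Q : Submodule ℂ (Kp × ℂ), ∀ T : Set (Kp × ℂ), P = Submodule.span ℂ T →
      (∀ y ∈ T, B (bp 1 ∅, 0) y ∈ Q) →
      (∀ i j : Fin 4, i ≠ j → ∀ y ∈ T, B (bp 0 {i, j}, 0) y ∈ Q) →
      ∀ x ∈ gdeg 0, ∀ v ∈ P, B x v ∈ Q := by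
    rintro P Q T rfl ht hx
    refine bilin_mem B _ T Q ?_
    rintro x (⟨m, I, hd, rfl⟩ | ⟨-, rfl⟩) y hy
    · have hm : m = 0 ∨ m = 1 := by omega
      rcases hm with rfl | rfl
      · obtain ⟨i, j, hij, rfl⟩ := Finset.card_eq_two.1 (show I.card = 2 by push_cast at hd; omega)
        exact hx i j hij y hy
      · obtain rfl := Finset.card_eq_zero.1 (show I.card = 0 by push_cast at hd; omega)
        exact ht y hy
    · rw [hC1]; exact Q.zero_mem
  have hquad : ∀ i j : Fin 4, i ≠ j → ((bp 0 {i, j}, 0) : Kp × ℂ) ∈ gdeg 0 := by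
    intro i j hij
    exact bp_mem_gdeg 0 0 _ (by rw [Finset.card_pair hij]; norm_num)
  have hfx : fxG = (2 : ℂ)⁻¹ • ((bp 0 {0, 2}, 0) + (bp 0 {1, 3}, 0)
      - Complex.I • (bp 0 {0, 3}, 0) + Complex.I • (bp 0 {1, 2}, 0)) := by
    simp [fxG]
  have hfy : fyG = (2 : ℂ)⁻¹ • ((bp 0 {0, 2}, 0) - (bp 0 {1, 3}, 0)
      + Complex.I • (bp 0 {0, 3}, 0) + Complex.I • (bp 0 {1, 2}, 0)) := by
    simp [fyG]
  have hl1 : lw1 = (bp 1 {0}, 0) + Complex.I • (bp 1 {1}, 0) := by simp [lw1]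
  have hl2 : lw2 = (bp 0 {1}ᶜ, 0) + Complex.I • (bp 0 {0}ᶜ, 0) := by
    rw [show ({1}ᶜ : Idx) = {0, 2, 3} by decide, show ({0}ᶜ : Idx) = {1, 2, 3} by decide]
    simp [lw2]
  have a1 : B (bp 0 {0, 2}, 0) (bp 1 {0}, 0) = (bp 1 {2}, 0) := by
    simpa using hB1 0 2 (by decide)
  have a5 := hB10 0 2 1 (by decide) (by decide) (by decide)
  have c1 := hB3 0 2 (by decide)
  rw [show sg3 0 2 = 1 by decide +kernel] at c1
  have c5 := hB30 0 2 1 (by decide) (by decide) (by decide)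
  have a2 : B (bp 0 {0, 3}, 0) (bp 1 {0}, 0) = (bp 1 {3}, 0) := by
    simpa using hB1 0 3 (by decide)
  have a6 := hB10 0 3 1 (by decide) (by decide) (by decide)
  have c2 := hB3 0 3 (by decide)
  rw [show sg3 0 3 = -1 by decide +kernel] at c2
  have c6 := hB30 0 3 1 (by decide) (by decide) (by decide)
  have a3 : B (bp 0 {1, 2}, 0) (bp 1 {1}, 0) = (bp 1 {2}, 0) := by
    simpa using hB1 1 2 (by decide)
  have a7 := hB10 1 2 0 (by decide) (by decide) (by decide)
  have c3 := hB3 1 2 (by decide)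
  rw [show sg3 1 2 = -1 by decide +kernel] at c3
  have c7 := hB30 1 2 0 (by decide) (by decide) (by decide)
  have a4 : B (bp 0 {1, 3}, 0) (bp 1 {1}, 0) = (bp 1 {3}, 0) := by
    simpa using hB1 1 3 (by decide)
  have a8 := hB10 1 3 0 (by decide) (by decide) (by decide)
  have c4 := hB3 1 3 (by decide)
  rw [show sg3 1 3 = 1 by decide +kernel] at c4
  have c8 := hB30 1 3 0 (by decide) (by decide) (by decide)
  refine ⟨?_, ?_, ?_, ?_, ?_, ?_, ?_, ?_, ?_, ?_, ?_, ?_, ?_, ?_, ?_⟩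
  · intro i hi
    apply le_antisymm
    · conv_lhs => unfold gdeg
      rw [Submodule.span_le]
      rintro z (⟨m, I, hd, rfl⟩ | ⟨h0, -⟩)
      · obtain ⟨j, n, J, c, hc, hJ, he⟩ := gen_step i hi m I hd
        refine (Submodule.smul_mem_iff _ hc).1 ?_
        rw [← he, ← hB]
        exact Submodule.subset_span ⟨_, bp_mem_gdeg 1 1 {j} (by simp), _,
          bp_mem_gdeg _ n J hJ, rfl⟩
      · omega
    · rw [Submodule.span_le]
      rintro z ⟨x, hx, y, hy, rfl⟩
      refine bilin_mem B _ _ (gdeg i) ?_ x hx y hy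
      rintro x (⟨m, I, hd, rfl⟩ | ⟨h0, -⟩) y (⟨n, J, hd', rfl⟩ | ⟨h0', -⟩)
      · rw [hB]
        have := brk_mem 1 (i - 1) (by omega) m n I J hd hd'
        rwa [add_sub_cancel] at this
      all_goals omega
  · apply le_antisymm
    · unfold gdeg
      rw [Submodule.span_le]
      rintro z (⟨m, I, hd, rfl⟩ | ⟨h0, -⟩)
      · have hm : m = 0 ∨ m = 1 := by omega
        rcases hm with rfl | rfl
        · exact Submodule.mem_sup_right (Submodule.subset_span
            ⟨I, by push_cast at hd; omega, rfl⟩)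
        · obtain ⟨k, rfl⟩ := Finset.card_eq_one.1 (show I.card = 1 by push_cast at hd; omega)
          exact Submodule.mem_sup_left (Submodule.subset_span ⟨k, rfl⟩)
      · omega
    · refine sup_le (Submodule.span_le.2 ?_) (Submodule.span_le.2 ?_)
      · rintro z ⟨k, rfl⟩
        exact bp_mem_gdeg 1 1 _ (by simp)
      · rintro z ⟨I, hI, rfl⟩
        exact bp_mem_gdeg 1 0 _ (by rw [hI]; norm_num)
  · rw [eq_bot_iff]
    rintro ⟨f, c⟩ ⟨hz1, hz2⟩
    have e1 : ∀ z ∈ V1, z.2 = 0 ∧ ∀ K, z.1 (0, K) = 0 := by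
      intro z hz
      induction hz using Submodule.span_induction with
      | mem x hx => obtain ⟨k, rfl⟩ := hx; simp [bp, Finsupp.single_apply]
      | zero => simp
      | add x y _ _ h1 h2 => simp [h1, h2]
      | smul a x _ h1 => simp [h1]
    have e2 : ∀ z ∈ V2, ∀ n K, z.1 (n + 1, K) = 0 := by
      intro z hz
      induction hz using Submodule.span_induction with
      | mem x hx => obtain ⟨k, -, rfl⟩ := hx; simp [bp, Finsupp.single_apply]
      | zero => simp
      | add x y _ _ h1 h2 => simp [h1, h2]
      | smul a x _ h1 => simp [h1]
    rw [Submodule.mem_bot]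
    refine Prod.ext (Finsupp.ext ?_) (e1 _ hz1).1
    rintro ⟨_ | n, K⟩
    · exact (e1 _ hz1).2 K
    · exact e2 _ hz2 n K
  · refine hg0 V1 V1 _ rfl ?_ ?_
    · rintro y ⟨k, rfl⟩
      have : B (bp 1 ∅, 0) (bp 1 {k}, 0) = (bp 1 {k}, 0) := by
        rw [hB]
        simp [kbrkp, psiC, xiMulp, ddp, msign]
      rw [this]
      exact Submodule.subset_span ⟨k, rfl⟩
    · rintro i j hij y ⟨k, rfl⟩
      by_cases hi : k = i
      · subst hi
        rw [hB1 k j hij]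
        exact Submodule.smul_mem _ _ (Submodule.subset_span ⟨j, rfl⟩)
      · by_cases hj : k = j
        · subst hj
          rw [Finset.pair_comm, hB1 k i hi]
          exact Submodule.smul_mem _ _ (Submodule.subset_span ⟨i, rfl⟩)
        · rw [hB10 i j k hij hi hj]
          exact Submodule.zero_mem _
  · intro W hW hst
    rw [V1_eq] at hW ⊢
    refine irred (fun i j => B (bp 0 {i, j}, 0)) _ ?_ ?_ hB10 W hW ?_
    · intro i j
      simp only [Finset.pair_comm]
    · intro i j hij
      exact ⟨_, by split_ifs <;> simp, hB1 i j hij⟩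
    · intro i j hij v hv
      exact hst _ (hquad i j hij) v hv
  · refine hg0 V2 V2 _ V2_eq ?_ ?_
    · rintro y ⟨k, rfl⟩
      have : B (bp 1 ∅, 0) (bp 0 {k}ᶜ, 0) = (bp 0 {k}ᶜ, 0) := by
        rw [hB]
        have h3 : (({k}ᶜ : Idx)).card = 3 := by simp [Finset.card_compl]
        simp only [kbrkp, h3]
        norm_num [psiC, xiMulp, ddp, msign]
      simp only [this]
      exact Submodule.subset_span ⟨{k}ᶜ, by simp [Finset.card_compl], rfl⟩
    · have hmem : ∀ j : Fin 4, ((bp 0 {j}ᶜ, 0) : Kp × ℂ) ∈ V2 := by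
        intro j
        exact Submodule.subset_span ⟨{j}ᶜ, by simp [Finset.card_compl], rfl⟩
      rintro i j hij y ⟨k, rfl⟩
      by_cases hi : k = i
      · subst hi
        simp only [hB3 k j hij]
        exact Submodule.smul_mem _ _ (hmem j)
      · by_cases hj : k = j
        · subst hj
          simp only [Finset.pair_comm i k, hB3 k i hi]
          exact Submodule.smul_mem _ _ (hmem i)
        · simp only [hB30 i j k hij hi hj]
          exact Submodule.zero_mem _
  · intro W hW hst
    rw [V2_eq] at hW ⊢
    refine irred (fun i j => B (bp 0 {i, j}, 0)) _ ?_ ?_ hB30 W hW ?_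
    · intro i j
      simp only [Finset.pair_comm]
    · intro i j hij
      exact ⟨_, by exact_mod_cast sg3_ne i j hij, hB3 i j hij⟩
    · intro i j hij v hv
      exact hst _ (hquad i j hij) v hv
  · have : lw1 = (bp 1 {0}, 0) + Complex.I • (bp 1 {1}, 0) := by simp [lw1]
    rw [this]
    exact Submodule.add_mem _ (Submodule.subset_span ⟨0, rfl⟩)
      (Submodule.smul_mem _ _ (Submodule.subset_span ⟨1, rfl⟩))
  · intro h
    have := congrArg (fun z : Kp × ℂ => z.1 (1, {0})) h
    simp [lw1, bp, Finsupp.single_apply] at this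
  · rw [hfx, hl1]
    simp only [map_add, map_sub, map_smul, LinearMap.add_apply, LinearMap.sub_apply,
      LinearMap.smul_apply, a1, a2, a3, a4, a5, a6, a7, a8]
    match_scalars <;> ring_nf <;> simp
  · rw [hfy, hl1]
    simp only [map_add, map_sub, map_smul, LinearMap.add_apply, LinearMap.sub_apply,
      LinearMap.smul_apply, a1, a2, a3, a4, a5, a6, a7, a8]
    match_scalars <;> ring_nf <;> simp
  · rw [hl2]
    exact Submodule.add_mem _ (Submodule.subset_span ⟨{1}ᶜ, rfl, rfl⟩)
      (Submodule.smul_mem _ _ (Submodule.subset_span ⟨{0}ᶜ, rfl, rfl⟩))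
  · intro h
    have := congrArg (fun z : Kp × ℂ => z.1 (0, {0, 2, 3})) h
    have hne : ({1, 2, 3} : Idx) ≠ {0, 2, 3} := by decide
    simp [lw2, bp, Finsupp.single_apply, hne] at this
  · rw [hfx, hl2]
    simp only [map_add, map_sub, map_smul, LinearMap.add_apply, LinearMap.sub_apply,
      LinearMap.smul_apply, c1, c2, c3, c4, c5, c6, c7, c8]
    match_scalars <;> ring_nf <;> simp
  · rw [hfy, hl2]
    simp only [map_add, map_sub, map_smul, LinearMap.add_apply, LinearMap.sub_apply,
      LinearMap.smul_apply, c1, c2, c3, c4, c5, c6, c7, c8]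
    match_scalars <;> ring_nf <;> simp

end
end
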